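/- Let h, ψ, ζ : 𝕋ⁿ → ℝ be smooth. Then the map ε ↦ G(h+εζ)ψ is differentiable at ε = 0, with derivative (in L²(𝕋ⁿ)) given by the shape derivative formula lim_{ε→0} ε^{-1}(G(h+εζ)ψ − G(h)ψ) = −G(h)(𝔅ζ) − div(𝔙ζ), where 𝔅 = (G(h)ψ + ∇h·∇ψ)/(1+|∇h|²) and 𝔙 = ∇ψ − 𝔅∇h. -/

import Mathlib

open MeasureTheory
open scoped Classical

noncomputable section

/-- ℤⁿ-periodicity for functions on ℝⁿ (model for functions on the torus 𝕋ⁿ = ℝⁿ/ℤⁿ). -/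
def ZPeriodic (n : ℕ) (f : (Fin n → ℝ) → ℝ) : Prop :=
  ∀ (x : Fin n → ℝ) (k : Fin n → ℤ), f (x + fun i => (k i : ℝ)) = f x

/-- ℤⁿ-periodicity in the horizontal variable for functions on ℝⁿ × ℝ. -/
def ZPeriodicE (n : ℕ) (φ : (Fin n → ℝ) × ℝ → ℝ) : Prop :=
  ∀ (x : Fin n → ℝ) (y : ℝ) (k : Fin n → ℤ), φ (x + fun i => (k i : ℝ), y) = φ (x, y)

/-- Fundamental cell of the torus 𝕋ⁿ. -/
def cell (n : ℕ) : Set (Fin n → ℝ) := Set.univ.pi fun _ => Set.Ico (0:ℝ) 1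

/-- i-th partial derivative of a function on ℝⁿ. -/
def pdX (n : ℕ) (f : (Fin n → ℝ) → ℝ) (i : Fin n) (x : Fin n → ℝ) : ℝ :=
  fderiv ℝ f x (Pi.single i 1)

/-- Directional derivative of a function on ℝⁿ × ℝ. -/
def pdE (n : ℕ) (φ : (Fin n → ℝ) × ℝ → ℝ) (v : (Fin n → ℝ) × ℝ)
    (p : (Fin n → ℝ) × ℝ) : ℝ := fderiv ℝ φ p v

def eX (n : ℕ) (i : Fin n) : (Fin n → ℝ) × ℝ := (Pi.single i 1, 0)
def eY (n : ℕ) : (Fin n → ℝ) × ℝ := (0, 1)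

/-- Laplacian Δ_{x,y} on ℝⁿ × ℝ. -/
def lapE (n : ℕ) (φ : (Fin n → ℝ) × ℝ → ℝ) (p : (Fin n → ℝ) × ℝ) : ℝ :=
  (∑ i, pdE n (pdE n φ (eX n i)) (eX n i) p) + pdE n (pdE n φ (eY n)) (eY n) p

/-- |∇_{x,y}φ|². -/
def gradSqE (n : ℕ) (φ : (Fin n → ℝ) × ℝ → ℝ) (p : (Fin n → ℝ) × ℝ) : ℝ :=
  (∑ i, (pdE n φ (eX n i) p)^2) + (pdE n φ (eY n) p)^2

/-- One periodic cell of the fluid domain Ω(h) = {y < h(x)}. -/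
def fluidCell (n : ℕ) (h : (Fin n → ℝ) → ℝ) : Set ((Fin n → ℝ) × ℝ) :=
  {p | p.1 ∈ cell n ∧ p.2 < h p.1}

/-- φ is the harmonic extension of ψ to Ω(h) = {y < h(x)}: it is harmonic in Ω(h),
has boundary value ψ, is periodic in x, and has square-integrable gradient. -/
structure IsHarmonicExt (n : ℕ) (h ψ : (Fin n → ℝ) → ℝ)
    (φ : (Fin n → ℝ) × ℝ → ℝ) : Prop where
  smooth : ContDiff ℝ (⊤ : ℕ∞) φ
  periodic : ZPeriodicE n φ
  harmonic : ∀ p : (Fin n → ℝ) × ℝ, p.2 < h p.1 → lapE n φ p = 0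
  boundary : ∀ x, φ (x, h x) = ψ x
  gradL2 : IntegrableOn (gradSqE n φ) (fluidCell n h)

/-- The Dirichlet-to-Neumann operator:
(G(h)ψ)(x) = ∂_yφ(x,h(x)) − ∇h(x)·∇_xφ(x,h(x)), where φ is the harmonic extension of ψ. -/
def DtN (n : ℕ) (h ψ : (Fin n → ℝ) → ℝ) : (Fin n → ℝ) → ℝ :=
  if H : ∃ φ, IsHarmonicExt n h ψ φ then
    fun x => pdE n H.choose (eY n) (x, h x)
      - ∑ i, pdX n h i x * pdE n H.choose (eX n i) (x, h x)
  else 0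

/-- (B(h)ψ)(x) = ∂_yφ(x,h(x)). -/
def Bop (n : ℕ) (h ψ : (Fin n → ℝ) → ℝ) : (Fin n → ℝ) → ℝ :=
  if H : ∃ φ, IsHarmonicExt n h ψ φ then
    fun x => pdE n H.choose (eY n) (x, h x)
  else 0

/-- (V(h)ψ)(x) = ∇_xφ(x,h(x)). -/
def Vop (n : ℕ) (h ψ : (Fin n → ℝ) → ℝ) : (Fin n → ℝ) → Fin n → ℝ :=
  if H : ∃ φ, IsHarmonicExt n h ψ φ then
    fun x i => pdE n H.choose (eX n i) (x, h x)
  else 0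

/-- Divergence of a vector field on the torus. -/
def divX (n : ℕ) (W : (Fin n → ℝ) → Fin n → ℝ) (x : Fin n → ℝ) : ℝ :=
  ∑ i, pdX n (fun z => W z i) i x

/-- h is a smooth solution of the Hele-Shaw equation ∂ₜh + G(h)h = 0 on [0,T]. -/
structure IsHeleShawSol (n : ℕ) (T : ℝ) (h : ℝ → (Fin n → ℝ) → ℝ) : Prop where
  smooth : ContDiff ℝ (⊤ : ℕ∞) (Function.uncurry h)
  periodic : ∀ t : ℝ, ZPeriodic n (h t)
  extension : ∀ t ∈ Set.Icc 0 T, ∃ φ, IsHarmonicExt n (h t) (h t) φ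
  equation : ∀ t ∈ Set.Icc 0 T, ∀ x, deriv (fun s => h s x) t + DtN n (h t) (h t) x = 0

/-- B(t,x) = (B(h(t,·))h(t,·))(x). -/
def HSB (n : ℕ) (h : ℝ → (Fin n → ℝ) → ℝ) (t : ℝ) (x : Fin n → ℝ) : ℝ :=
  Bop n (h t) (h t) x

/-- V(t,x) = (V(h(t,·))h(t,·))(x). -/
def HSV (n : ℕ) (h : ℝ → (Fin n → ℝ) → ℝ) (t : ℝ) (x : Fin n → ℝ) : Fin n → ℝ :=
  Vop n (h t) (h t) x

/-- The Rayleigh–Taylor coefficient a = 1 − B. -/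
def HSa (n : ℕ) (h : ℝ → (Fin n → ℝ) → ℝ) (t : ℝ) (x : Fin n → ℝ) : ℝ :=
  1 - HSB n h t x

/-- γ = (1+|∇h|²)⁻¹ ( G(h)(B²+|V|²) − 2B G(h)B − 2V·G(h)V ). -/
def HSgamma (n : ℕ) (h : ℝ → (Fin n → ℝ) → ℝ) (t : ℝ) (x : Fin n → ℝ) : ℝ :=
  (1 + ∑ i, (pdX n (h t) i x)^2)⁻¹ *
    ( DtN n (h t) (fun z => (HSB n h t z)^2 + ∑ i, (HSV n h t z i)^2) x
      - 2 * HSB n h t x * DtN n (h t) (fun z => HSB n h t z) x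
      - 2 * ∑ i, HSV n h t x i * DtN n (h t) (fun z => HSV n h t z i) x )

/-- L(h)f = −V·∇f − ½(div V)f + √a G(h)(√a f). -/
def Lop (n : ℕ) (h : ℝ → (Fin n → ℝ) → ℝ) (t : ℝ) (f : (Fin n → ℝ) → ℝ)
    (x : Fin n → ℝ) : ℝ :=
  - (∑ i, HSV n h t x i * pdX n f i x)
  - (1/2) * divX n (HSV n h t) x * f x
  + Real.sqrt (HSa n h t x) * DtN n (h t) (fun z => Real.sqrt (HSa n h t z) * f z) x


/-- 𝔅 = (G(h)ψ + ∇h·∇ψ)/(1+|∇h|²). -/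
noncomputable def frakB (n : ℕ) (h ψ : (Fin n → ℝ) → ℝ) (z : Fin n → ℝ) : ℝ :=
  (DtN n h ψ z + ∑ i, pdX n h i z * pdX n ψ i z) / (1 + ∑ i, (pdX n h i z)^2)

/-- 𝔙 = ∇ψ − 𝔅∇h. -/
noncomputable def frakV (n : ℕ) (h ψ : (Fin n → ℝ) → ℝ) (z : Fin n → ℝ) (i : Fin n) : ℝ :=
  pdX n ψ i z - frakB n h ψ z * pdX n h i z

set_option linter.unusedSectionVars false
set_option linter.unusedVariables false

namespace ShapeD

/-! ### Lattice sums and rapidly decreasing families -/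

/-- Rapidly decreasing families indexed by `ℤⁿ`. -/
def Rap {n : ℕ} {G : Type*} [NormedAddCommGroup G] (c : (Fin n → ℤ) → G) : Prop :=
  ∀ N : ℕ, ∃ C : ℝ, ∀ k, (1 + ‖k‖) ^ N * ‖c k‖ ≤ C

lemma summable_prod_inv (n : ℕ) :
    Summable (fun k : Fin n → ℤ => ∏ i, ((1 + |(k i : ℝ)|) ^ 2)⁻¹) := by
  induction n with
  | zero => exact Summable.of_finite
  | succ n ih =>
    have h1 : Summable (fun a : ℤ => ((1 + |(a : ℝ)|) ^ 2)⁻¹) := by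
      have h2 : Summable (fun a : ℤ => 1 / (a : ℝ) ^ 2) :=
        (Real.summable_one_div_int_pow (p := 2)).mpr (by norm_num)
      refine (summable_of_isBigO h2 ?_)
      refine Asymptotics.IsBigO.of_bound 1 ?_
      have : ∀ᶠ a : ℤ in Filter.cofinite, a ≠ 0 := by
        simpa using (Set.finite_singleton (0:ℤ)).compl_mem_cofinite
      filter_upwards [this] with a ha
      have ha' : (0:ℝ) < |(a:ℝ)| := by positivity
      rw [one_mul, Real.norm_of_nonneg (by positivity), Real.norm_of_nonneg (by positivity), one_div]
      refine inv_anti₀ (by positivity) ?_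
      nlinarith [sq_abs (a:ℝ)]
    have h3 := h1.mul_of_nonneg ih (fun _ => by positivity)
      (fun k => Finset.prod_nonneg (fun _ _ => by positivity))
    rw [← (Fin.consEquiv (fun _ : Fin (n+1) => ℤ)).summable_iff]
    refine h3.congr (fun p => ?_)
    simp [Fin.prod_univ_succ, Fin.consEquiv, mul_comm]

lemma summable_lattice (n : ℕ) :
    Summable (fun k : Fin n → ℤ => ((1 + ‖k‖) ^ (2 * n))⁻¹) := by
  refine Summable.of_nonneg_of_le (fun k => by positivity) (fun k => ?_) (summable_prod_inv n)
  rw [Finset.prod_inv_distrib]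
  gcongr
  · calc ∏ i, (1 + |(k i : ℝ)|) ^ 2 ≤ ∏ _i : Fin n, (1 + ‖k‖) ^ 2 := by
          refine Finset.prod_le_prod (fun _ _ => by positivity) (fun i _ => ?_)
          gcongr
          have := norm_le_pi_norm k i
          simpa [Int.norm_eq_abs] using this
      _ = _ := by simp [← pow_mul]

variable {n : ℕ}

lemma Rap.summable {G : Type*} [NormedAddCommGroup G] {c : (Fin n → ℤ) → G} (hc : Rap c)
    (N : ℕ) : Summable (fun k => (1 + ‖k‖) ^ N * ‖c k‖) := by
  obtain ⟨C, hC⟩ := hc (N + 2 * n)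
  refine Summable.of_nonneg_of_le (fun k => by positivity) (fun k => ?_)
    ((summable_lattice n).mul_left C)
  rw [← div_eq_mul_inv, le_div_iff₀ (by positivity)]
  calc _ = (1 + ‖k‖) ^ (N + 2 * n) * ‖c k‖ := by ring
    _ ≤ C := hC k

lemma Rap.summable_norm {G : Type*} [NormedAddCommGroup G] {c : (Fin n → ℤ) → G} (hc : Rap c) :
    Summable (fun k => ‖c k‖) := by simpa using hc.summable 0

lemma rap_of_le {G G' : Type*} [NormedAddCommGroup G] [NormedAddCommGroup G']
    {c : (Fin n → ℤ) → G} {d : (Fin n → ℤ) → G'} (hc : Rap c) (C₀ : ℝ) (M : ℕ)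
    (h : ∀ k, ‖d k‖ ≤ C₀ * (1 + ‖k‖) ^ M * ‖c k‖) : Rap d := by
  intro N
  obtain ⟨C, hC⟩ := hc (N + M)
  refine ⟨|C₀| * C, fun k => ?_⟩
  calc (1 + ‖k‖) ^ N * ‖d k‖ ≤ (1 + ‖k‖) ^ N * (|C₀| * (1 + ‖k‖) ^ M * ‖c k‖) := by
        gcongr
        exact (h k).trans (by gcongr; exact le_abs_self _)
    _ = |C₀| * ((1 + ‖k‖) ^ (N + M) * ‖c k‖) := by ring
    _ ≤ |C₀| * C := by gcongr; exact hC k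

lemma Rap.add {G : Type*} [NormedAddCommGroup G] {c d : (Fin n → ℤ) → G} (hc : Rap c)
    (hd : Rap d) : Rap (fun k => c k + d k) := by
  intro N
  obtain ⟨C, hC⟩ := hc N
  obtain ⟨D, hD⟩ := hd N
  refine ⟨C + D, fun k => ?_⟩
  calc _ ≤ (1 + ‖k‖) ^ N * (‖c k‖ + ‖d k‖) := by gcongr; exact norm_add_le _ _
    _ ≤ _ := by rw [mul_add]; exact add_le_add (hC k) (hD k)

lemma Rap.neg {G : Type*} [NormedAddCommGroup G] {c : (Fin n → ℤ) → G} (hc : Rap c) :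
    Rap (fun k => - c k) := rap_of_le hc 1 0 (fun k => by simp)

lemma Rap.sub {G : Type*} [NormedAddCommGroup G] {c d : (Fin n → ℤ) → G} (hc : Rap c)
    (hd : Rap d) : Rap (fun k => c k - d k) := by
  simpa [sub_eq_add_neg] using hc.add hd.neg

lemma Rap.zero {G : Type*} [NormedAddCommGroup G] : Rap (fun _ : Fin n → ℤ => (0 : G)) :=
  fun N => ⟨0, fun k => by simp⟩

lemma Rap.sum {G ι : Type*} [NormedAddCommGroup G] (s : Finset ι) {c : ι → (Fin n → ℤ) → G}
    (hc : ∀ i ∈ s, Rap (c i)) : Rap (fun k => ∑ i ∈ s, c i k) := by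
  induction s using Finset.induction_on with
  | empty => simpa using Rap.zero
  | insert a s ha ih =>
    simp only [Finset.sum_insert ha]
    exact (hc _ (Finset.mem_insert_self _ _)).add
      (ih (fun i hi => hc i (Finset.mem_insert_of_mem hi)))

/-- `2πi kᵢ`. -/
def dk (i : Fin n) (k : Fin n → ℤ) : ℂ := 2 * Real.pi * Complex.I * (k i : ℂ)

lemma norm_dk_le (i : Fin n) (k : Fin n → ℤ) : ‖dk i k‖ ≤ (2 * Real.pi) * (1 + ‖k‖) := by
  have := norm_le_pi_norm k i
  have h2 : ‖((k i : ℤ) : ℂ)‖ = ‖k i‖ := by simp [Int.norm_eq_abs]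
  simp only [dk, norm_mul, h2, Complex.norm_I, mul_one]
  rw [show ‖(2:ℂ)‖ = 2 by simp, show ‖((Real.pi : ℝ) : ℂ)‖ = Real.pi by
    simp [abs_of_pos Real.pi_pos]]
  gcongr
  linarith

lemma Rap.dk_smul {G : Type*} [NormedAddCommGroup G] [NormedSpace ℂ G] {c : (Fin n → ℤ) → G}
    (hc : Rap c) (i : Fin n) : Rap (fun k => dk i k • c k) :=
  rap_of_le hc (2 * Real.pi) 1 (fun k => by
    rw [norm_smul, pow_one]; gcongr; exact norm_dk_le i k)

lemma Rap.of_summable_bound {c : (Fin n → ℤ) → ℂ} (hc : Rap c) {G : Type*}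
    [NormedAddCommGroup G] (e : (Fin n → ℤ) → G) (he : Rap e) (f : (Fin n → ℤ) → G)
    (h : ∀ k, ‖f k‖ ≤ ∑' m, ‖c m‖ * ‖e (k - m)‖) : Rap f := by
  intro N
  obtain ⟨C, hC⟩ := he N
  have hs := hc.summable N
  refine ⟨∑' m, ((1 + ‖m‖) ^ N * ‖c m‖) * C, fun k => ?_⟩
  have hpt : ∀ m, (1 + ‖k‖) ^ N * (‖c m‖ * ‖e (k - m)‖) ≤ ((1 + ‖m‖) ^ N * ‖c m‖) * C := by
    intro m
    have h1 : 1 + ‖k‖ ≤ (1 + ‖m‖) * (1 + ‖k - m‖) := by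
      have : ‖k‖ ≤ ‖m‖ + ‖k - m‖ := by simpa using norm_add_le m (k - m)
      nlinarith [norm_nonneg m, norm_nonneg (k - m), mul_nonneg (norm_nonneg m) (norm_nonneg (k - m))]
    calc _ ≤ ((1 + ‖m‖) * (1 + ‖k - m‖)) ^ N * (‖c m‖ * ‖e (k - m)‖) := by gcongr
      _ = ((1 + ‖m‖) ^ N * ‖c m‖) * ((1 + ‖k - m‖) ^ N * ‖e (k - m)‖) := by rw [mul_pow]; ring
      _ ≤ _ := by gcongr; exact hC _
  have hs2 := hs.mul_right C
  calc _ ≤ (1 + ‖k‖) ^ N * ∑' m, ‖c m‖ * ‖e (k - m)‖ := by gcongr; exact h k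
    _ = ∑' m, (1 + ‖k‖) ^ N * (‖c m‖ * ‖e (k - m)‖) := by rw [tsum_mul_left]
    _ ≤ _ := Summable.tsum_le_tsum hpt
        (Summable.of_nonneg_of_le (fun m => by positivity) hpt hs2) hs2

end ShapeD

namespace ShapeD

/-! ### Fourier analysis on the torus -/

variable {n : ℕ}

/-- Normalised measure on the circle (as in Mathlib's multivariate Fourier file). -/
local instance instMSCircle : MeasureSpace UnitAddCircle := ⟨AddCircle.haarAddCircle⟩

local instance instHaarCircle : Measure.IsAddHaarMeasure (volume : Measure UnitAddCircle) :=
  inferInstanceAs (Measure.IsAddHaarMeasure AddCircle.haarAddCircle)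

local instance instProbCircle : IsProbabilityMeasure (volume : Measure UnitAddCircle) :=
  inferInstanceAs (IsProbabilityMeasure AddCircle.haarAddCircle)

/-- Periodicity for functions with values in an arbitrary type. -/
def Per {G : Type*} (f : (Fin n → ℝ) → G) : Prop :=
  ∀ (x : Fin n → ℝ) (k : Fin n → ℤ), f (x + fun i => (k i : ℝ)) = f x

/-- The projection onto the torus. -/
def tp (x : Fin n → ℝ) : UnitAddTorus (Fin n) := fun i => (x i : UnitAddCircle)

/-- The function on the torus induced by a (periodic) function. -/
def tl {G : Type*} (f : (Fin n → ℝ) → G) : UnitAddTorus (Fin n) → G :=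
  fun t => f (fun i => ((AddCircle.equivIco (1:ℝ) 0 (t i) : Set.Ico (0:ℝ) (0+1)) : ℝ))

lemma tl_tp {G : Type*} {f : (Fin n → ℝ) → G} (hf : Per f) (x : Fin n → ℝ) :
    tl f (tp x) = f x := by
  unfold tl tp
  have h := hf x (fun i => - ⌊x i⌋)
  rw [← h]
  congr 1
  ext i
  rw [AddCircle.coe_equivIco_mk_apply]
  simp [Int.fract, sub_eq_add_neg]

lemma tp_quot : IsOpenQuotientMap (tp : (Fin n → ℝ) → UnitAddTorus (Fin n)) :=
  IsOpenQuotientMap.piMap (fun _ => QuotientAddGroup.isOpenQuotientMap_mk)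

lemma continuous_tl {G : Type*} [TopologicalSpace G] {f : (Fin n → ℝ) → G} (hf : Per f)
    (hc : Continuous f) : Continuous (tl f) := by
  rw [tp_quot.isQuotientMap.continuous_iff]
  exact hc.congr (fun x => (tl_tp hf x).symm)

lemma cell_ae : (cell n : Set (Fin n → ℝ)) =ᵐ[volume]
    {x : Fin n → ℝ | ∀ i, x i ∈ Set.Ioc ((fun _ => (0:ℝ)) i) ((fun _ => (0:ℝ)) i + 1)} := by
  have h1 : (cell n : Set (Fin n → ℝ)) =ᵐ[volume] Set.Icc (fun _ => 0) (fun _ => 1) :=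
    Measure.univ_pi_Ico_ae_eq_Icc
  have h2 : (Set.univ.pi fun _ : Fin n => Set.Ioc (0:ℝ) 1) =ᵐ[volume]
      Set.Icc (fun _ => 0) (fun _ => 1) := Measure.univ_pi_Ioc_ae_eq_Icc
  have h3 : {x : Fin n → ℝ | ∀ i, x i ∈ Set.Ioc ((fun _ => (0:ℝ)) i) ((fun _ => (0:ℝ)) i + 1)} =
    (Set.univ.pi fun _ : Fin n => Set.Ioc (0:ℝ) 1) := by ext x; simp
  rw [h3]
  exact h1.trans h2.symm

lemma cell_meas : MeasurableSet (cell n) :=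
  MeasurableSet.univ_pi (fun _ => measurableSet_Ico)

lemma cell_subset : cell n ⊆ Set.Icc (fun _ => 0) (fun _ => 1) := by
  intro x hx
  simp only [cell, Set.mem_pi, Set.mem_univ, true_implies, Set.mem_Ico] at hx
  exact ⟨fun i => (hx i).1, fun i => (hx i).2.le⟩

lemma cell_vol : volume (cell n) = 1 := by
  rw [cell, volume_pi_pi]; simp

instance : IsFiniteMeasure (volume.restrict (cell n)) := ⟨by simp [cell_vol]⟩

instance : IsProbabilityMeasure (volume.restrict (cell n)) := ⟨by simp [cell_vol]⟩

variable {G : Type*} [NormedAddCommGroup G] [NormedSpace ℝ G]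

lemma integral_cell_eq {f : (Fin n → ℝ) → G} (hf : Per f) :
    ∫ x in cell n, f x = ∫ t : UnitAddTorus (Fin n), tl f t := by
  rw [UnitAddTorus.integral_preimage (tl f) (fun _ => 0), setIntegral_congr_set cell_ae]
  congr 1
  ext x
  exact (tl_tp hf x).symm

lemma Per.shift {G : Type*} {f : (Fin n → ℝ) → G} (hf : Per f) (v : Fin n → ℝ) :
    Per (fun x => f (x + v)) := by
  intro x k
  have := hf (x + v) k
  simp only
  rw [← this]; congr 1; ring

lemma integral_cell_shift {f : (Fin n → ℝ) → G} (hf : Per f) (v : Fin n → ℝ) :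
    ∫ x in cell n, f (x + v) = ∫ x in cell n, f x := by
  rw [integral_cell_eq (hf.shift v), integral_cell_eq hf, ← integral_add_right_eq_self (tl f) (tp v)]
  congr 1
  ext t
  obtain ⟨x, rfl⟩ := tp_quot.surjective t
  have : tp x + tp v = tp (x + v) := rfl
  rw [this, tl_tp hf, tl_tp (hf.shift v)]

lemma Per.bounded {f : (Fin n → ℝ) → G} (hf : Per f) (hc : Continuous f) :
    ∃ C, ∀ x, ‖f x‖ ≤ C := by
  obtain ⟨C, hC⟩ := isCompact_univ.exists_bound_of_continuousOn
    (continuous_tl hf hc).continuousOn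
  exact ⟨C, fun x => by rw [← tl_tp hf x]; exact hC _ (Set.mem_univ _)⟩

lemma integrableOn_cell {f : (Fin n → ℝ) → G} (hc : Continuous f) :
    IntegrableOn f (cell n) :=
  (hc.continuousOn.integrableOn_compact isCompact_Icc).mono_set cell_subset

/-- Partial derivatives for vector valued functions. -/
def pd (f : (Fin n → ℝ) → G) (i : Fin n) (x : Fin n → ℝ) : G := fderiv ℝ f x (Pi.single i 1)

lemma Per.pd {f : (Fin n → ℝ) → G} (hf : Per f) (i : Fin n) : Per (pd f i) := by
  intro x k
  unfold ShapeD.pd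
  rw [← fderiv_comp_add_right]
  congr 2
  ext y
  exact hf y k

lemma contDiff_pd {f : (Fin n → ℝ) → G} (hf : ContDiff ℝ (⊤ : ℕ∞) f) (i : Fin n) :
    ContDiff ℝ (⊤ : ℕ∞) (pd f i) := by
  unfold pd
  exact (hf.fderiv_right (m := (⊤ : ℕ∞)) (by simp)).clm_apply contDiff_const

lemma hasDerivAt_line {f : (Fin n → ℝ) → G} (hf : ContDiff ℝ (⊤ : ℕ∞) f) (i : Fin n)
    (x : Fin n → ℝ) (s : ℝ) :
    HasDerivAt (fun t : ℝ => f (x + t • Pi.single i 1)) (pd f i (x + s • Pi.single i 1)) s := by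
  have h1 : HasFDerivAt f (fderiv ℝ f (x + s • Pi.single i 1)) (x + s • Pi.single i 1) :=
    (hf.differentiable (by simp) _).hasFDerivAt
  have h2 : HasDerivAt (fun t : ℝ => x + t • (Pi.single i 1 : Fin n → ℝ)) (Pi.single i 1) s := by
    simpa using ((hasDerivAt_id s).smul_const (Pi.single i 1 : Fin n → ℝ)).const_add x
  exact h1.comp_hasDerivAt s h2

/-- The exponentials. -/
def ek (k : Fin n → ℤ) (x : Fin n → ℝ) : ℂ :=
  Complex.exp (∑ i, dk i k * (x i : ℂ))

lemma ek_eq (k : Fin n → ℤ) (x : Fin n → ℝ) : ek k x = UnitAddTorus.mFourier k (tp x) := by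
  simp only [ek, UnitAddTorus.mFourier, ContinuousMap.coe_mk, tp, fourier_coe_apply, dk,
    Complex.exp_sum]
  congr 1; ext i; congr 1; simp

lemma ek_zero (x : Fin n → ℝ) : ek 0 x = 1 := by simp [ek, dk]

lemma ek_add (k l : Fin n → ℤ) (x : Fin n → ℝ) : ek (k + l) x = ek k x * ek l x := by
  simp only [ek, ← Complex.exp_add, ← Finset.sum_add_distrib, dk]
  congr 1; apply Finset.sum_congr rfl; intro i _; simp; ring

lemma ek_add_right (k : Fin n → ℤ) (x y : Fin n → ℝ) : ek k (x + y) = ek k x * ek k y := by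
  simp only [ek, ← Complex.exp_add, ← Finset.sum_add_distrib, dk]
  congr 1; apply Finset.sum_congr rfl; intro i _; simp; ring

lemma ek_per (k : Fin n → ℤ) : Per (ek k) := by
  intro x l
  rw [ek_eq, ek_eq]
  congr 1
  ext i
  simp only [tp, Pi.add_apply, QuotientAddGroup.mk_add, add_eq_left]
  have h : ((l i : ℝ) : UnitAddCircle) = ((l i • (1:ℝ) : ℝ) : UnitAddCircle) := by simp
  rw [h, AddCircle.coe_zsmul, AddCircle.coe_period, smul_zero]

lemma norm_ek (k : Fin n → ℤ) (x : Fin n → ℝ) : ‖ek k x‖ = 1 := by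
  rw [ek, Complex.norm_exp]; simp [dk]

lemma ek_neg (k : Fin n → ℤ) (x : Fin n → ℝ) : ek (-k) x = (starRingEnd ℂ) (ek k x) := by
  rw [ek_eq, ek_eq, UnitAddTorus.mFourier_neg]

lemma contDiff_ek (k : Fin n → ℤ) : ContDiff ℝ (⊤ : ℕ∞) (ek k) := by
  unfold ek
  refine Complex.contDiff_exp.comp (ContDiff.sum fun i _ => contDiff_const.mul ?_)
  exact Complex.ofRealCLM.contDiff.comp (contDiff_apply ℝ ℝ i)

/-- Fourier coefficients. -/
def fc (f : (Fin n → ℝ) → ℂ) (k : Fin n → ℤ) : ℂ := ∫ x in cell n, ek (-k) x * f x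

lemma Per.mul {f g : (Fin n → ℝ) → ℂ} (hf : Per f) (hg : Per g) : Per (fun x => f x * g x) :=
  fun x k => by simp only [hf x k, hg x k]

lemma fc_eq {f : (Fin n → ℝ) → ℂ} (hf : Per f) (k : Fin n → ℤ) :
    fc f k = UnitAddTorus.mFourierCoeff (tl f) k := by
  rw [fc, integral_cell_eq ((ek_per (-k)).mul hf), UnitAddTorus.mFourierCoeff]
  congr 1
  ext t
  obtain ⟨x, rfl⟩ := tp_quot.surjective t
  rw [tl_tp ((ek_per (-k)).mul hf), tl_tp hf, ek_eq]; rfl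

lemma norm_fc_le {f : (Fin n → ℝ) → ℂ} {C : ℝ} (hC : ∀ x, ‖f x‖ ≤ C) (k : Fin n → ℤ) :
    ‖fc f k‖ ≤ C := by
  have := norm_integral_le_of_norm_le_const (μ := volume.restrict (cell n))
    (f := fun x => ek (-k) x * f x) (C := C)
    (Filter.Eventually.of_forall fun x => by simpa [norm_ek] using hC x)
  simpa [fc] using this

lemma hasDerivAt_integral_cell {F F' : (Fin n → ℝ) → ℝ → G} (hF : Continuous (Function.uncurry F))
    (hF' : Continuous (Function.uncurry F')) (h : ∀ x t, HasDerivAt (F x) (F' x t) t) (t : ℝ) :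
    HasDerivAt (fun t => ∫ x in cell n, F x t) (∫ x in cell n, F' x t) t := by
  have hcpt : IsCompact (Set.Icc (fun _ : Fin n => (0:ℝ)) (fun _ => 1) ×ˢ Metric.closedBall t 1) :=
    isCompact_Icc.prod (isCompact_closedBall _ _)
  obtain ⟨C, hC⟩ := hcpt.exists_bound_of_continuousOn hF'.continuousOn
  refine (hasDerivAt_integral_of_dominated_loc_of_deriv_le (𝕜 := ℝ) (F := fun t x => F x t)
    (F' := fun t x => F' x t) (μ := volume.restrict (cell n)) (bound := fun _ => C)
    (Metric.ball_mem_nhds t one_pos) ?_ ?_ ?_ ?_ ?_ ?_).2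
  · exact Filter.Eventually.of_forall fun s =>
      (integrableOn_cell (hF.comp (Continuous.prodMk_left s))).aestronglyMeasurable
  · exact integrableOn_cell (hF.comp (Continuous.prodMk_left t))
  · exact (integrableOn_cell (hF'.comp (Continuous.prodMk_left t))).aestronglyMeasurable
  · filter_upwards [ae_restrict_mem cell_meas] with x hx s hs
    exact hC (x, s) ⟨cell_subset hx, Metric.ball_subset_closedBall hs⟩
  · exact integrable_const _
  · exact Filter.Eventually.of_forall fun x s _ => h x s

lemma fc_pd {f : (Fin n → ℝ) → ℂ} (hf : Per f) (hs : ContDiff ℝ (⊤ : ℕ∞) f) (i : Fin n)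
    (k : Fin n → ℤ) : fc (pd f i) k = dk i k * fc f k := by
  have key : ∀ t : ℝ, ∫ x in cell n, ek (-k) x * f (x + t • Pi.single i 1) =
      Complex.exp (dk i k * t) * fc f k := by
    intro t
    have h1 := integral_cell_shift (f := fun x => ek (-k) x * f x)
      ((ek_per (-k)).mul hf) (t • Pi.single i 1)
    simp only [ek_add_right] at h1
    have h2 : ek (-k) (t • Pi.single i 1) = Complex.exp (-(dk i k * t)) := by
      rw [ek]
      congr 1
      rw [Finset.sum_eq_single i]
      · simp [dk]
      · intro j _ hj; simp [hj]
      · simp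
    have h3 : (∫ x in cell n, ek (-k) x * ek (-k) (t • Pi.single i 1) * f (x + t • Pi.single i 1))
        = Complex.exp (-(dk i k * t)) * ∫ x in cell n, ek (-k) x * f (x + t • Pi.single i 1) := by
      rw [← integral_const_mul]; congr 1; ext x; rw [h2]; ring
    rw [h3] at h1
    rw [fc, ← h1, ← mul_assoc, ← Complex.exp_add]; simp
  have hd := hasDerivAt_integral_cell (n := n)
    (F := fun x t => ek (-k) x * f (x + t • Pi.single i 1))
    (F' := fun x t => ek (-k) x * pd f i (x + t • Pi.single i 1))
    (by
      have := (contDiff_ek (-k)).continuous; have := hs.continuous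
      simp only [Function.uncurry_def]; fun_prop)
    (by
      have := (contDiff_ek (-k)).continuous; have := (contDiff_pd hs i).continuous
      simp only [Function.uncurry_def]; fun_prop)
    (fun x t => (hasDerivAt_line hs i x t).const_mul _) 0
  simp only [key] at hd
  have hd2 : HasDerivAt (fun t : ℝ => Complex.exp (dk i k * t) * fc f k)
      (dk i k * fc f k) 0 := by
    have h0 : HasDerivAt (fun t : ℝ => dk i k * (t:ℂ)) (dk i k) 0 := by
      simpa using (Complex.ofRealCLM.hasDerivAt (x := (0:ℝ))).const_mul (dk i k)
    simpa using (h0.cexp).mul_const (fc f k)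
  have := hd.unique hd2
  simpa [fc] using this

lemma fc_rap {f : (Fin n → ℝ) → ℂ} (hf : Per f) (hs : ContDiff ℝ (⊤ : ℕ∞) f) : Rap (fc f) := by
  have key : ∀ (N : ℕ) (i : Fin n), ∃ C, ∀ k : Fin n → ℤ, |(k i : ℝ)| ^ N * ‖fc f k‖ ≤ C := by
    intro N i
    have : ∀ (g : (Fin n → ℝ) → ℂ), Per g → ContDiff ℝ (⊤ : ℕ∞) g →
        ∃ C, ∀ k : Fin n → ℤ, |(k i : ℝ)| ^ N * ‖fc g k‖ ≤ C := by
      induction N with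
      | zero =>
        intro g hg hgs
        obtain ⟨C, hC⟩ := hg.bounded hgs.continuous
        exact ⟨C, fun k => by simpa using norm_fc_le hC k⟩
      | succ N ih =>
        intro g hg hgs
        obtain ⟨C, hC⟩ := ih (pd g i) (hg.pd i) (contDiff_pd hgs i)
        refine ⟨C, fun k => le_trans ?_ (hC k)⟩
        rw [fc_pd hg hgs, norm_mul, pow_succ, mul_assoc]
        gcongr
        have h2 : ‖dk i k‖ = 2 * Real.pi * |(k i : ℝ)| := by
          simp [dk, abs_of_pos Real.pi_pos]
        rw [h2]
        have := Real.pi_gt_three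
        nlinarith [abs_nonneg (k i : ℝ)]
    exact this f hf hs
  intro N
  choose C hC using fun i => key N i
  obtain ⟨C0, hC0⟩ := hf.bounded hs.continuous
  have hC0' : 0 ≤ C0 := (norm_nonneg _).trans (hC0 0)
  refine ⟨2 ^ N * (C0 + ∑ i, |C i|), fun k => ?_⟩
  have hpos : 0 ≤ ∑ i, |C i| := Finset.sum_nonneg fun _ _ => abs_nonneg _
  have hf0 := norm_fc_le hC0 k
  by_cases hk : ‖k‖ ≤ 1
  · calc (1 + ‖k‖) ^ N * ‖fc f k‖ ≤ (1 + 1) ^ N * C0 := by gcongr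
      _ ≤ _ := by rw [one_add_one_eq_two]; gcongr; linarith
  · push Not at hk
    have hne : Nonempty (Fin n) := by
      by_contra hne
      rw [not_nonempty_iff] at hne
      rw [Subsingleton.elim k 0] at hk; simp at hk; linarith
    obtain ⟨i, hi⟩ : ∃ i, ‖k‖ = ‖k i‖ := by
      obtain ⟨i, hi⟩ := Finite.exists_max (fun i => ‖k i‖)
      exact ⟨i, le_antisymm ((pi_norm_le_iff_of_nonneg (norm_nonneg _)).2 hi) (norm_le_pi_norm k i)⟩
    calc (1 + ‖k‖) ^ N * ‖fc f k‖ ≤ (2 * ‖k‖) ^ N * ‖fc f k‖ := by gcongr; linarith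
      _ = 2 ^ N * (|(k i : ℝ)| ^ N * ‖fc f k‖) := by rw [hi, Int.norm_eq_abs, mul_pow, mul_assoc]
      _ ≤ 2 ^ N * C i := by gcongr; exact hC i k
      _ ≤ _ := by
        gcongr
        have := Finset.single_le_sum (f := fun i => |C i|) (fun _ _ => abs_nonneg _) (Finset.mem_univ i)
        have h3 := le_abs_self (C i)
        linarith

lemma fc_hasSum {f : (Fin n → ℝ) → ℂ} (hf : Per f) (hs : ContDiff ℝ (⊤ : ℕ∞) f)
    (x : Fin n → ℝ) : HasSum (fun k => fc f k * ek k x) (f x) := by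
  have h1 : Summable (UnitAddTorus.mFourierCoeff (tl f)) := by
    refine Summable.of_norm ?_
    simpa [fc_eq hf] using (fc_rap hf hs).summable_norm
  have h2 := UnitAddTorus.hasSum_mFourier_series_apply_of_summable
    (f := ⟨tl f, continuous_tl hf hs.continuous⟩) h1 (tp x)
  simp only [ContinuousMap.coe_mk, smul_eq_mul] at h2
  rw [tl_tp hf] at h2
  simpa [fc_eq hf, ek_eq] using h2

/-- Real valued functions have symmetric Fourier coefficients. -/
lemma fc_conj {f : (Fin n → ℝ) → ℝ} (k : Fin n → ℤ) :
    fc (fun x => (f x : ℂ)) (-k) = (starRingEnd ℂ) (fc (fun x => (f x : ℂ)) k) := by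
  simp only [fc]
  rw [← integral_conj]
  congr 1
  ext x
  rw [ek_neg (-k)]; simp

lemma fc_ek (k l : Fin n → ℤ) : fc (ek k) l = if k = l then 1 else 0 := by
  rw [fc_eq (ek_per k)]
  have : tl (ek k) = UnitAddTorus.mFourier k := by
    ext t
    obtain ⟨x, rfl⟩ := tp_quot.surjective t
    rw [tl_tp (ek_per k), ek_eq]
  rw [this]
  have h := (orthonormal_iff_ite.1 (UnitAddTorus.orthonormal_mFourier (d := Fin n))) l k
  simp only [UnitAddTorus.mFourierLp, ContinuousMap.inner_toLp, ← UnitAddTorus.mFourier_neg] at h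
  rw [UnitAddTorus.mFourierCoeff]
  simp only [smul_eq_mul]
  rw [show (if k = l then (1:ℂ) else 0) = if l = k then 1 else 0 by simp [eq_comm]]
  rw [← h]
  congr 1; ext x; ring

/-- Coefficients of an absolutely convergent series. -/
lemma fc_tsum {c : (Fin n → ℤ) → ℂ} (hc : Summable (fun k => ‖c k‖)) (l : Fin n → ℤ) :
    fc (fun x => ∑' k, c k * ek k x) l = c l := by
  have h1 : fc (fun x => ∑' k, c k * ek k x) l = ∑' k, ∫ x in cell n, ek (-l) x * (c k * ek k x) := by
    rw [fc]
    simp only [← tsum_mul_left]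
    refine (integral_tsum_of_summable_integral_norm (fun k => ?_) ?_).symm
    · exact integrableOn_cell ((contDiff_ek _).continuous.mul
        (continuous_const.mul (contDiff_ek _).continuous))
    · simpa [norm_ek] using hc
  rw [h1]
  have h2 : ∀ k, ∫ x in cell n, ek (-l) x * (c k * ek k x) = c k * if k = l then 1 else 0 := by
    intro k
    rw [← fc_ek, fc, ← integral_const_mul]
    congr 1; ext x; ring
  simp [h2]

lemma integral_pd {f : (Fin n → ℝ) → ℂ} (hf : Per f) (hs : ContDiff ℝ (⊤ : ℕ∞) f) (i : Fin n) :
    ∫ x in cell n, pd f i x = 0 := by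
  have := fc_pd hf hs i 0
  simpa [fc, ek_zero, dk] using this

end ShapeD

namespace ShapeD

/-! ### Convolution of families indexed by the lattice -/

variable {n : ℕ}

section conv

variable {G : Type*} [NormedAddCommGroup G] [NormedSpace ℂ G]

/-- Convolution. -/
def conv (t : (Fin n → ℤ) → ℂ) (F : (Fin n → ℤ) → G) (k : Fin n → ℤ) : G :=
  ∑' m, t m • F (k - m)

lemma Rap.bdd {F : (Fin n → ℤ) → G} (hF : Rap F) : ∃ C, 0 ≤ C ∧ ∀ k, ‖F k‖ ≤ C := by
  obtain ⟨C, hC⟩ := hF 0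
  exact ⟨C, (by simpa using (norm_nonneg _).trans (by simpa using hC 0)), fun k => by simpa using hC k⟩

lemma conv_summable_norm {t : (Fin n → ℤ) → ℂ} (ht : Rap t) {F : (Fin n → ℤ) → G} (hF : Rap F)
    (k : Fin n → ℤ) : Summable (fun m => ‖t m‖ * ‖F (k - m)‖) := by
  obtain ⟨C, _, hC⟩ := hF.bdd
  exact Summable.of_nonneg_of_le (fun m => by positivity)
    (fun m => by gcongr; exact hC _) (ht.summable_norm.mul_right C)

variable [CompleteSpace G]

lemma conv_summable {t : (Fin n → ℤ) → ℂ} (ht : Rap t) {F : (Fin n → ℤ) → G} (hF : Rap F)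
    (k : Fin n → ℤ) : Summable (fun m => t m • F (k - m)) :=
  Summable.of_norm (by simpa [norm_smul] using conv_summable_norm ht hF k)

lemma Rap.conv {t : (Fin n → ℤ) → ℂ} (ht : Rap t) {F : (Fin n → ℤ) → G} (hF : Rap F) :
    Rap (conv t F) := by
  refine Rap.of_summable_bound ht F hF _ (fun k => ?_)
  refine (norm_tsum_le_tsum_norm ?_).trans (le_of_eq ?_)
  · simpa [norm_smul] using conv_summable_norm ht hF k
  · simp [norm_smul]

lemma conv_add {t : (Fin n → ℤ) → ℂ} (ht : Rap t) {F F' : (Fin n → ℤ) → G} (hF : Rap F)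
    (hF' : Rap F') (k) : conv t (fun k => F k + F' k) k = conv t F k + conv t F' k := by
  simp only [conv, smul_add]
  exact (conv_summable ht hF k).tsum_add (conv_summable ht hF' k)

lemma conv_sub {t : (Fin n → ℤ) → ℂ} (ht : Rap t) {F F' : (Fin n → ℤ) → G} (hF : Rap F)
    (hF' : Rap F') (k) : conv t (fun k => F k - F' k) k = conv t F k - conv t F' k := by
  simp only [conv, smul_sub]
  exact (conv_summable ht hF k).tsum_sub (conv_summable ht hF' k)

omit [CompleteSpace G] in
lemma conv_neg {t : (Fin n → ℤ) → ℂ} {F : (Fin n → ℤ) → G} (k) :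
    conv t (fun k => - F k) k = - conv t F k := by
  simp only [conv, smul_neg, tsum_neg]

lemma conv_sum {ι : Type*} (s : Finset ι) {t : (Fin n → ℤ) → ℂ} (ht : Rap t)
    {F : ι → (Fin n → ℤ) → G} (hF : ∀ i, Rap (F i)) (k) :
    conv t (fun k => ∑ i ∈ s, F i k) k = ∑ i ∈ s, conv t (F i) k := by
  simp only [conv, Finset.smul_sum]
  exact Summable.tsum_finsetSum (fun i _ => conv_summable ht (hF i) k)

lemma map_conv {G' : Type*} [NormedAddCommGroup G'] [NormedSpace ℂ G'] (ℓ : G →L[ℂ] G')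
    {t : (Fin n → ℤ) → ℂ} (ht : Rap t) {F : (Fin n → ℤ) → G} (hF : Rap F) (k) :
    ℓ (conv t F k) = conv t (fun k => ℓ (F k)) k := by
  rw [conv, ℓ.map_tsum (conv_summable ht hF k)]
  simp [conv]

omit [CompleteSpace G] in
lemma Rap.map {G' : Type*} [NormedAddCommGroup G'] [NormedSpace ℂ G'] (ℓ : G →L[ℂ] G')
    {F : (Fin n → ℤ) → G} (hF : Rap F) : Rap (fun k => ℓ (F k)) :=
  rap_of_le hF ‖ℓ‖ 0 (fun k => by simpa using ℓ.le_opNorm (F k))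

lemma conv_leibniz {t : (Fin n → ℤ) → ℂ} (ht : Rap t) {F : (Fin n → ℤ) → G} (hF : Rap F)
    (i : Fin n) (k) : dk i k • conv t F k =
      conv (fun m => dk i m * t m) F k + conv t (fun m => dk i m • F m) k := by
  have h1 := conv_summable (ht.dk_smul i) hF k
  have h2 := conv_summable ht (hF.dk_smul i) k
  simp only [smul_eq_mul] at h1
  simp only [conv]
  rw [← h1.tsum_add h2, ← (conv_summable ht hF k).tsum_const_smul]
  congr 1; ext m
  have : dk i k = dk i m + dk i (k - m) := by simp [dk]; ring
  rw [this, add_smul, smul_comm (t m), smul_smul]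

/-- Double series lemma. -/
lemma conv_conv {t s : (Fin n → ℤ) → ℂ} (ht : Rap t) (hs : Rap s) {F : (Fin n → ℤ) → G}
    (hF : Rap F) (k) : conv t (conv s F) k = conv (conv t s) F k := by
  obtain ⟨C, hC0, hC⟩ := hF.bdd
  have hsum : Summable (fun p : (Fin n → ℤ) × (Fin n → ℤ) => (t p.1 * s p.2) • F (k - p.1 - p.2)) := by
    refine Summable.of_norm_bounded (g := fun p => (‖t p.1‖ * ‖s p.2‖) * C) ?_ ?_
    · exact (ht.summable_norm.mul_of_nonneg hs.summable_norm (fun _ => norm_nonneg _)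
        (fun _ => norm_nonneg _)).mul_right C
    · intro p; rw [norm_smul, norm_mul]; gcongr; exact hC _
  let e : (Fin n → ℤ) × (Fin n → ℤ) ≃ (Fin n → ℤ) × (Fin n → ℤ) :=
    { toFun := fun p => (p.2, p.1 - p.2)
      invFun := fun p => (p.1 + p.2, p.1)
      left_inv := fun p => by simp
      right_inv := fun p => by simp }
  have hsum2 := e.summable_iff.2 hsum
  simp only [Function.comp_def] at hsum2
  have h1 : conv t (conv s F) k =
      ∑' p : (Fin n → ℤ) × (Fin n → ℤ), (t p.1 * s p.2) • F (k - p.1 - p.2) := by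
    rw [hsum.tsum_prod]
    simp only [conv]
    congr 1; ext m
    rw [← (conv_summable hs hF (k - m)).tsum_const_smul]
    simp [smul_smul]
  rw [h1, ← e.tsum_eq, hsum2.tsum_prod]
  simp only [conv]
  congr 1; ext j
  have hts : Summable fun m => t m • s (j - m) := conv_summable ht hs j
  rw [← hts.tsum_smul_const]
  congr 1; ext m
  simp [e]

lemma conv_comm (t s : (Fin n → ℤ) → ℂ) : conv t s = conv s t := by
  ext k
  simp only [conv]
  rw [← (Equiv.subLeft k).tsum_eq]
  congr 1; ext m; simp [mul_comm]

lemma conv_swap {t s : (Fin n → ℤ) → ℂ} (ht : Rap t) (hs : Rap s) {F : (Fin n → ℤ) → G}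
    (hF : Rap F) (k) : conv t (conv s F) k = conv s (conv t F) k := by
  rw [conv_conv ht hs hF, conv_conv hs ht hF, conv_comm]

/-- Sum of the Fourier series. -/
def ev (x : Fin n → ℝ) (F : (Fin n → ℤ) → G) : G := ∑' k, ek k x • F k

lemma ev_summable {F : (Fin n → ℤ) → G} (hF : Rap F) (x : Fin n → ℝ) :
    Summable (fun k => ek k x • F k) :=
  Summable.of_norm (by simpa [norm_smul, norm_ek] using hF.summable_norm)

lemma ev_conv {t : (Fin n → ℤ) → ℂ} (ht : Rap t) {F : (Fin n → ℤ) → G} (hF : Rap F)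
    (x : Fin n → ℝ) : ev x (conv t F) = ev x t • ev x F := by
  have hsum : Summable (fun p : (Fin n → ℤ) × (Fin n → ℤ) => (ek p.1 x * t p.1) • (ek p.2 x • F p.2)) := by
    refine Summable.of_norm_bounded (g := fun p => (‖t p.1‖ * ‖F p.2‖)) ?_ ?_
    · exact (ht.summable_norm.mul_of_nonneg hF.summable_norm (fun _ => norm_nonneg _)
        (fun _ => norm_nonneg _))
    · intro p; rw [norm_smul, norm_mul, norm_smul, norm_ek, norm_ek]; simp
  let e : (Fin n → ℤ) × (Fin n → ℤ) ≃ (Fin n → ℤ) × (Fin n → ℤ) :=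
    { toFun := fun p => (p.2, p.1 - p.2)
      invFun := fun p => (p.1 + p.2, p.1)
      left_inv := fun p => by simp
      right_inv := fun p => by simp }
  have hsum2 := e.summable_iff.2 hsum
  simp only [Function.comp_def] at hsum2
  have h1 : ev x t • ev x F =
      ∑' p : (Fin n → ℤ) × (Fin n → ℤ), (ek p.1 x * t p.1) • (ek p.2 x • F p.2) := by
    rw [hsum.tsum_prod]
    simp only [ev]
    have := ev_summable ht x
    rw [← this.tsum_smul_const]
    congr 1; ext m
    rw [← (ev_summable hF x).tsum_const_smul]
    simp
  rw [h1, ← e.tsum_eq, hsum2.tsum_prod]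
  simp only [ev, conv]
  congr 1; ext k
  rw [← (conv_summable ht hF k).tsum_const_smul]
  congr 1; ext m
  have : ek k x = ek m x * ek (k - m) x := by rw [← ek_add]; simp
  simp only [e, Equiv.coe_fn_mk, Function.comp, smul_smul, this]
  congr 1; ring

lemma ev_add {F F' : (Fin n → ℤ) → G} (hF : Rap F) (hF' : Rap F') (x : Fin n → ℝ) :
    ev x (fun k => F k + F' k) = ev x F + ev x F' := by
  simp only [ev, smul_add]
  exact (ev_summable hF x).tsum_add (ev_summable hF' x)

lemma ev_sub {F F' : (Fin n → ℤ) → G} (hF : Rap F) (hF' : Rap F') (x : Fin n → ℝ) :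
    ev x (fun k => F k - F' k) = ev x F - ev x F' := by
  simp only [ev, smul_sub]
  exact (ev_summable hF x).tsum_sub (ev_summable hF' x)

omit [CompleteSpace G] in
lemma ev_neg {F : (Fin n → ℤ) → G} (x : Fin n → ℝ) :
    ev x (fun k => - F k) = - ev x F := by
  simp only [ev, smul_neg, tsum_neg]

lemma ev_sum {ι : Type*} (s : Finset ι) {F : ι → (Fin n → ℤ) → G} (hF : ∀ i, Rap (F i))
    (x : Fin n → ℝ) : ev x (fun k => ∑ i ∈ s, F i k) = ∑ i ∈ s, ev x (F i) := by
  simp only [ev, Finset.smul_sum]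
  exact Summable.tsum_finsetSum (fun i _ => ev_summable (hF i) x)

lemma ev_fc {f : (Fin n → ℝ) → ℂ} (hf : Per f) (hs : ContDiff ℝ (⊤ : ℕ∞) f) (x : Fin n → ℝ) :
    ev x (fc f) = f x := by
  rw [ev, ← (fc_hasSum hf hs x).tsum_eq]
  congr 1; ext k; simp [mul_comm]

/-- Uniqueness of Fourier coefficients. -/
lemma ev_inj {c d : (Fin n → ℤ) → ℂ} (hc : Rap c) (hd : Rap d) (h : ∀ x, ev x c = ev x d) :
    c = d := by
  ext l
  rw [← fc_tsum hc.summable_norm l, ← fc_tsum hd.summable_norm l]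
  congr 1; ext x
  simpa [ev, mul_comm] using h x

lemma fc_mul {f g : (Fin n → ℝ) → ℂ} (hf : Per f) (hfs : ContDiff ℝ (⊤ : ℕ∞) f)
    (hg : Per g) (hgs : ContDiff ℝ (⊤ : ℕ∞) g) :
    fc (fun x => f x * g x) = conv (fc f) (fc g) := by
  refine ev_inj (fc_rap (hf.mul hg) (hfs.mul hgs)) ((fc_rap hf hfs).conv (fc_rap hg hgs))
    (fun x => ?_)
  rw [ev_fc (hf.mul hg) (hfs.mul hgs), ev_conv (fc_rap hf hfs) (fc_rap hg hgs), ev_fc hf hfs,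
    ev_fc hg hgs, smul_eq_mul]

/-- unit for convolution -/
lemma fc_one : fc (fun _ : Fin n → ℝ => (1:ℂ)) = fun k => if k = 0 then 1 else 0 := by
  ext k
  have h : (fun _ : Fin n → ℝ => (1:ℂ)) = ek 0 := by ext x; rw [ek_zero]
  rw [h, fc_ek]; simp [eq_comm]

omit [CompleteSpace G] in
lemma conv_one (F : (Fin n → ℤ) → G) : conv (fun k => if k = 0 then 1 else 0) F = F := by
  ext k
  rw [conv, tsum_eq_single 0]
  · simp
  · intro m hm; simp [hm]

end conv

end ShapeD

namespace ShapeD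

/-! ### Operators on square summable families -/

variable {n : ℕ} {L : Type*} [NormedAddCommGroup L] [InnerProductSpace ℂ L] [CompleteSpace L]

/-- Square summable families. -/
abbrev HH (n : ℕ) (L : Type*) [NormedAddCommGroup L] := lp (fun _ : Fin n → ℤ => L) 2

lemma memℓ2_iff {F : (Fin n → ℤ) → L} :
    Memℓp F 2 ↔ Summable (fun k => ‖F k‖ ^ 2) := by
  rw [memℓp_gen_iff (by norm_num)]
  simp

lemma HH.summable (F : HH n L) : Summable (fun k => ‖F k‖ ^ 2) :=
  memℓ2_iff.1 (lp.memℓp F)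

lemma HH.norm_sq (F : HH n L) : ‖F‖ ^ 2 = ∑' k, ‖F k‖ ^ 2 := by
  have := lp.norm_rpow_eq_tsum (p := 2) (by norm_num) F
  simpa using this

/-- make an element -/
def HH.mk (F : (Fin n → ℤ) → L) (h : Summable (fun k => ‖F k‖ ^ 2)) : HH n L :=
  ⟨F, memℓ2_iff.2 h⟩

@[simp] lemma HH.mk_apply (F : (Fin n → ℤ) → L) (h) (k) : HH.mk F h k = F k := rfl

/-- evaluation of a component -/
def evk (k : Fin n → ℤ) : HH n L →L[ℂ] L :=
  LinearMap.mkContinuous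
    { toFun := fun F => F k, map_add' := fun _ _ => rfl, map_smul' := fun _ _ => rfl } 1
    (fun F => by
      rw [one_mul]
      exact lp.norm_apply_le_norm (p := 2) (by norm_num) F k)

@[simp] lemma evk_apply (k : Fin n → ℤ) (F : HH n L) : evk k F = F k := rfl

/-- shifts -/
def Sh (m : Fin n → ℤ) : HH n L →L[ℂ] HH n L :=
  LinearMap.mkContinuous
    { toFun := fun F => HH.mk (fun k => F (k - m))
        ((HH.summable F).comp_injective (sub_left_injective (b := m)))
      map_add' := fun _ _ => rfl
      map_smul' := fun _ _ => rfl } 1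
    (fun F => by
      rw [one_mul]
      refine le_of_sq_le_sq ?_ (norm_nonneg _)
      simp only [LinearMap.coe_mk, AddHom.coe_mk]
      rw [HH.norm_sq, HH.norm_sq, ← (Equiv.subRight m).tsum_eq (fun k => ‖F k‖ ^ 2)]
      rfl)

@[simp] lemma Sh_apply (m : Fin n → ℤ) (F : HH n L) (k) : Sh m F k = F (k - m) := rfl

lemma norm_Sh_le (m : Fin n → ℤ) : ‖(Sh m : HH n L →L[ℂ] HH n L)‖ ≤ 1 :=
  LinearMap.mkContinuous_norm_le _ zero_le_one _

lemma diag_summable {c : (Fin n → ℤ) → ℂ} {C : ℝ} (hC : ∀ k, ‖c k‖ ≤ C) (F : HH n L) :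
    Summable (fun k => ‖c k • F k‖ ^ 2) := by
  refine Summable.of_nonneg_of_le (fun _ => by positivity) (fun k => ?_)
    ((HH.summable F).mul_left (C ^ 2))
  rw [norm_smul, mul_pow]
  gcongr
  exact hC k

/-- diagonal operators (for bounded symbols) -/
def Dg (c : (Fin n → ℤ) → ℂ) : HH n L →L[ℂ] HH n L :=
  if h : ∃ C : ℝ, ∀ k, ‖c k‖ ≤ C then
    LinearMap.mkContinuous
      { toFun := fun F => HH.mk (fun k => c k • F k) (diag_summable h.choose_spec F)
        map_add' := fun F G => by ext k; simp
        map_smul' := fun a F => by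
          ext k
          show c k • (a • F k) = a • (c k • F k)
          exact smul_comm _ _ _ } (h.choose)
      (fun F => by
        have hC := h.choose_spec
        have hC0 : 0 ≤ h.choose := (norm_nonneg _).trans (hC 0)
        refine le_of_sq_le_sq ?_ (by positivity)
        simp only [LinearMap.coe_mk, AddHom.coe_mk]
        rw [HH.norm_sq, mul_pow, HH.norm_sq, ← tsum_mul_left]
        refine Summable.tsum_le_tsum (fun k => ?_) (diag_summable hC F)
          ((HH.summable F).mul_left _)
        simp only [HH.mk_apply]
        rw [norm_smul, mul_pow]
        gcongr
        exact hC k)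
  else 0

lemma Dg_apply {c : (Fin n → ℤ) → ℂ} {C : ℝ} (hC : ∀ k, ‖c k‖ ≤ C) (F : HH n L) (k) :
    Dg c F k = c k • F k := by
  rw [Dg, dif_pos ⟨C, hC⟩]; rfl

lemma norm_Dg_le {c : (Fin n → ℤ) → ℂ} {C : ℝ} (hC : ∀ k, ‖c k‖ ≤ C) :
    ‖(Dg c : HH n L →L[ℂ] HH n L)‖ ≤ C := by
  have hC0 : 0 ≤ C := (norm_nonneg _).trans (hC 0)
  refine ContinuousLinearMap.opNorm_le_bound _ hC0 (fun F => ?_)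
  refine le_of_sq_le_sq ?_ (by positivity)
  rw [HH.norm_sq, mul_pow, HH.norm_sq, ← tsum_mul_left]
  have := diag_summable hC F
  refine Summable.tsum_le_tsum (fun k => ?_) ?_ ((HH.summable F).mul_left _)
  · rw [Dg_apply hC, norm_smul, mul_pow]
    gcongr
    exact hC k
  · exact this.congr (fun k => by rw [Dg_apply hC])

/-- Operators given by kernels. -/
def Kop (a : (Fin n → ℤ) → (Fin n → ℤ) → ℂ) : HH n L →L[ℂ] HH n L :=
  ∑' m, (Dg (a m)).comp (Sh m)

section
variable {a : (Fin n → ℤ) → (Fin n → ℤ) → ℂ} {α : (Fin n → ℤ) → ℝ}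

lemma norm_Kop_term (ha : ∀ m k, ‖a m k‖ ≤ α m) (m) :
    ‖(Dg (a m)).comp (Sh m : HH n L →L[ℂ] HH n L)‖ ≤ α m := by
  have h0 : 0 ≤ α m := (norm_nonneg _).trans (ha m 0)
  calc _ ≤ ‖(Dg (a m) : HH n L →L[ℂ] HH n L)‖ * ‖(Sh m : HH n L →L[ℂ] HH n L)‖ :=
        ContinuousLinearMap.opNorm_comp_le _ _
    _ ≤ α m * 1 := by gcongr; exacts [norm_Dg_le (ha m), norm_Sh_le m]
    _ = α m := mul_one _

lemma Kop_summable (ha : ∀ m k, ‖a m k‖ ≤ α m) (hα : Summable α) :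
    Summable (fun m => (Dg (a m)).comp (Sh m : HH n L →L[ℂ] HH n L)) :=
  Summable.of_norm_bounded hα (norm_Kop_term ha)

lemma norm_Kop_le (ha : ∀ m k, ‖a m k‖ ≤ α m) (hα : Summable α) :
    ‖(Kop a : HH n L →L[ℂ] HH n L)‖ ≤ ∑' m, α m :=
  tsum_of_norm_bounded hα.hasSum (norm_Kop_term ha)

lemma Kop_hasSum (ha : ∀ m k, ‖a m k‖ ≤ α m) (hα : Summable α) (F : HH n L) (k) :
    HasSum (fun m => a m k • F (k - m)) (Kop a F k) := by
  have h1 := (Kop_summable (L := L) ha hα).hasSum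
  have h2 := h1.mapL ((evk k).comp (ContinuousLinearMap.apply ℂ (HH n L) F))
  simpa [Dg_apply (ha _), Kop] using h2

lemma Kop_apply (ha : ∀ m k, ‖a m k‖ ≤ α m) (hα : Summable α) (F : HH n L) (k) :
    Kop a F k = ∑' m, a m k • F (k - m) := (Kop_hasSum ha hα F k).tsum_eq.symm

lemma Kop_sub {b : (Fin n → ℤ) → (Fin n → ℤ) → ℂ} {β : (Fin n → ℤ) → ℝ}
    (ha : ∀ m k, ‖a m k‖ ≤ α m) (hα : Summable α) (hb : ∀ m k, ‖b m k‖ ≤ β m) (hβ : Summable β) :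
    (Kop a - Kop b : HH n L →L[ℂ] HH n L) = Kop (fun m k => a m k - b m k) := by
  ext F k
  have hab : ∀ m k, ‖a m k - b m k‖ ≤ α m + β m := fun m k =>
    (norm_sub_le _ _).trans (add_le_add (ha m k) (hb m k))
  rw [Kop_apply hab (hα.add hβ)]
  show Kop a F k - Kop b F k = _
  rw [Kop_apply ha hα, Kop_apply hb hβ,
    ← (Kop_hasSum ha hα F k).summable.tsum_sub (Kop_hasSum hb hβ F k).summable]
  simp [sub_smul]

end

/-- The weight `1 + δ‖k‖`. -/
def wt (δ : ℝ) (k : Fin n → ℤ) : ℝ := 1 + δ * ‖k‖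

/-- Weighted multiplication operators. -/
def Tw (δ : ℝ) (s : ℕ) (t : (Fin n → ℤ) → ℂ) : HH n L →L[ℂ] HH n L :=
  Kop (fun m k => t m * (((wt δ k / wt δ (k - m)) ^ s : ℝ) : ℂ))

lemma wt_pos {δ : ℝ} (hδ : 0 ≤ δ) (k : Fin n → ℤ) : 0 < wt δ k := by
  unfold wt; positivity

lemma one_le_wt {δ : ℝ} (hδ : 0 ≤ δ) (k : Fin n → ℤ) : 1 ≤ wt δ k := by
  unfold wt; have := mul_nonneg hδ (norm_nonneg k); linarith

lemma wt_ratio {δ : ℝ} (hδ : 0 ≤ δ) (k m : Fin n → ℤ) :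
    wt δ k / wt δ (k - m) ≤ wt δ m := by
  rw [div_le_iff₀ (wt_pos hδ _)]
  unfold wt
  have h : ‖k‖ ≤ ‖m‖ + ‖k - m‖ := by simpa using norm_add_le m (k - m)
  nlinarith [mul_nonneg (mul_nonneg hδ (norm_nonneg m)) (mul_nonneg hδ (norm_nonneg (k - m)))]

lemma wt_ratio' {δ : ℝ} (hδ : 0 ≤ δ) (k m : Fin n → ℤ) :
    (wt δ m)⁻¹ ≤ wt δ k / wt δ (k - m) := by
  have := wt_ratio hδ (k - m) (-m)
  rw [sub_neg_eq_add, sub_add_cancel] at this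
  have h2 : wt δ (-m) = wt δ m := by simp [wt]
  rw [h2] at this
  rw [← inv_div]
  exact inv_anti₀ (div_pos (wt_pos hδ _) (wt_pos hδ _)) this

section
variable {t : (Fin n → ℤ) → ℂ} {δ : ℝ}

lemma Tw_bound (hδ : 0 ≤ δ) (hδ1 : δ ≤ 1) (s : ℕ) (m k : Fin n → ℤ) :
    ‖t m * (((wt δ k / wt δ (k - m)) ^ s : ℝ) : ℂ)‖ ≤ (1 + ‖m‖) ^ s * ‖t m‖ := by
  have h1 := wt_ratio hδ k m
  have h3 := div_pos (wt_pos hδ k) (wt_pos hδ (k - m))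
  have h2 : wt δ m ≤ 1 + ‖m‖ := by unfold wt; nlinarith [norm_nonneg m]
  rw [norm_mul, mul_comm, Complex.norm_real, Real.norm_of_nonneg (by positivity)]
  gcongr
  exact h1.trans h2

lemma Tw_apply (ht : Rap t) (hδ : 0 ≤ δ) (hδ1 : δ ≤ 1) (s : ℕ) (F : HH n L) (k) :
    Tw δ s t F k = ∑' m, (t m * (((wt δ k / wt δ (k - m)) ^ s : ℝ) : ℂ)) • F (k - m) :=
  Kop_apply (Tw_bound hδ hδ1 s) (ht.summable s) F k

lemma Tw_hasSum (ht : Rap t) (hδ : 0 ≤ δ) (hδ1 : δ ≤ 1) (s : ℕ) (F : HH n L) (k) :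
    HasSum (fun m => (t m * (((wt δ k / wt δ (k - m)) ^ s : ℝ) : ℂ)) • F (k - m)) (Tw δ s t F k) :=
  Kop_hasSum (Tw_bound hδ hδ1 s) (ht.summable s) F k

/-- Unweighted multiplication operators. -/
def Tm (t : (Fin n → ℤ) → ℂ) : HH n L →L[ℂ] HH n L := Tw 0 0 t

lemma Tm_apply (ht : Rap t) (F : HH n L) (k) : Tm t F k = conv t F k := by
  rw [Tm, Tw_apply ht le_rfl zero_le_one]
  simp [conv]

lemma Tw_sub_Tm (ht : Rap t) (s : ℕ) (hδ : 0 ≤ δ) (hδ1 : δ ≤ 1) :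
    ‖(Tw δ s t - Tm t : HH n L →L[ℂ] HH n L)‖ ≤ δ * ∑' m, (1 + ‖m‖) ^ s * ‖t m‖ := by
  have hb : ∀ m k : Fin n → ℤ, ‖t m * (((wt 0 k / wt 0 (k - m)) ^ 0 : ℝ) : ℂ)‖ ≤
    (1 + ‖m‖) ^ 0 * ‖t m‖ := Tw_bound le_rfl zero_le_one 0
  rw [Tm, Tw, Tw, Kop_sub (Tw_bound hδ hδ1 s) (ht.summable s) hb (ht.summable 0), ← tsum_mul_left]
  refine norm_Kop_le (fun m k => ?_) ((ht.summable s).mul_left δ)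
  simp only [pow_zero, Complex.ofReal_one, mul_one]
  have e : t m * (((wt δ k / wt δ (k - m)) ^ s : ℝ) : ℂ) - t m =
    t m * (((wt δ k / wt δ (k - m)) ^ s - 1 : ℝ) : ℂ) := by push_cast; ring
  rw [e, norm_mul, Complex.norm_real, mul_comm ‖t m‖, ← mul_assoc]
  gcongr
  set r := wt δ k / wt δ (k - m)
  have hr0 : 0 < r := div_pos (wt_pos hδ k) (wt_pos hδ (k - m))
  have h1 : r ≤ wt δ m := wt_ratio hδ k m
  have h2 : (wt δ m)⁻¹ ≤ r := wt_ratio' hδ k m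
  -- convexity bound
  have h3 : (wt δ m) ^ s - 1 ≤ δ * (1 + ‖m‖) ^ s := by
    have : wt δ m = (1 - δ) * 1 + δ * (1 + ‖m‖) := by unfold wt; ring
    have hc : ((1 - δ) • (1 : ℝ) + δ • (1 + ‖m‖)) ^ s ≤ (1 - δ) • (1 : ℝ) ^ s + δ • (1 + ‖m‖) ^ s :=
      (convexOn_pow s).2 (Set.mem_Ici.2 zero_le_one) (Set.mem_Ici.2 (by positivity))
        (by linarith) hδ (by ring)
    simp only [smul_eq_mul, one_pow, mul_one] at hc
    rw [this, mul_one]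
    linarith
  have hw1 : 1 ≤ wt δ m := one_le_wt hδ m
  have hw : 1 ≤ wt δ m ^ s := one_le_pow₀ hw1
  have h4 : r ^ s ≤ wt δ m ^ s := by gcongr
  have h5 : (wt δ m ^ s)⁻¹ ≤ r ^ s := by
    rw [← inv_pow]
    have := wt_pos hδ m
    gcongr
  have h6 : 1 - (wt δ m ^ s)⁻¹ ≤ wt δ m ^ s - 1 := by
    have hp : 0 < wt δ m ^ s := by linarith
    have : 2 ≤ wt δ m ^ s + (wt δ m ^ s)⁻¹ := by
      rw [← sub_nonneg]
      have : wt δ m ^ s + (wt δ m ^ s)⁻¹ - 2 = (wt δ m ^ s - 1) ^ 2 * (wt δ m ^ s)⁻¹ := by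
        field_simp; ring
      rw [this]; positivity
    linarith
  rw [Real.norm_eq_abs, abs_le]
  constructor <;> linarith

/-- The smoothing operator. -/
def Jw (δ : ℝ) (s : ℕ) : HH n L →L[ℂ] HH n L := Dg (fun k => (((wt δ k) ^ s)⁻¹ : ℝ))

lemma Jw_bound (hδ : 0 ≤ δ) (s : ℕ) (k : Fin n → ℤ) : ‖((((wt δ k) ^ s)⁻¹ : ℝ) : ℂ)‖ ≤ 1 := by
  have h1 := one_le_pow₀ (one_le_wt hδ k) (n := s)
  rw [Complex.norm_real, Real.norm_of_nonneg (by positivity)]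
  exact inv_le_one_of_one_le₀ h1

lemma Jw_apply (hδ : 0 ≤ δ) (s : ℕ) (F : HH n L) (k) :
    Jw δ s F k = ((((wt δ k) ^ s)⁻¹ : ℝ) : ℂ) • F k := Dg_apply (Jw_bound hδ s) F k

lemma Jw_Tw (ht : Rap t) (hδ : 0 ≤ δ) (hδ1 : δ ≤ 1) (s : ℕ) (F : HH n L) :
    Jw δ s (Tw δ s t F) = Tm t (Jw δ s F) := by
  ext k
  rw [Jw_apply hδ, Tw_apply ht hδ hδ1, Tm_apply ht, conv,
    ← (Tw_hasSum ht hδ hδ1 s F k).summable.tsum_const_smul]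
  congr 1; ext m
  rw [Jw_apply hδ, smul_smul, smul_smul]
  congr 1
  have h1 := (wt_pos hδ k).ne'
  have h2 := (wt_pos hδ (k - m)).ne'
  have h1' : (wt δ k : ℂ) ≠ 0 := by exact_mod_cast h1
  have h2' : (wt δ (k - m) : ℂ) ≠ 0 := by exact_mod_cast h2
  push_cast
  rw [div_pow]
  field_simp

lemma inner_HH (F G : HH n L) : inner ℂ F G = ∑' k, inner ℂ (F k) (G k) := lp.inner_eq_tsum F G

lemma inner_HH_hasSum (F G : HH n L) :
    HasSum (fun k => inner ℂ (F k) (G k)) (inner ℂ F G) := lp.hasSum_inner F G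

lemma inner_Sh (m : Fin n → ℤ) (F G : HH n L) : inner ℂ (Sh m F) G = inner ℂ F (Sh (-m) G) := by
  rw [inner_HH, inner_HH, ← (Equiv.addRight m).tsum_eq]
  congr 1; ext k; simp

lemma inner_Jw (hδ : 0 ≤ δ) (s : ℕ) (F G : HH n L) :
    inner ℂ (Jw δ s F) G = inner ℂ F (Jw δ s G) := by
  rw [inner_HH, inner_HH]
  congr 1; ext k
  rw [Jw_apply hδ, Jw_apply hδ, inner_smul_left, inner_smul_right, Complex.conj_ofReal]

lemma Tm_hasSum (ht : Rap t) (F : HH n L) : HasSum (fun m => t m • Sh m F) (Tm t F) := by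
  have hb : ∀ m k : Fin n → ℤ, ‖t m * (((wt 0 k / wt 0 (k - m)) ^ 0 : ℝ) : ℂ)‖ ≤
    (1 + ‖m‖) ^ 0 * ‖t m‖ := Tw_bound le_rfl zero_le_one 0
  have h1 := (Kop_summable (L := L) hb (ht.summable 0)).hasSum.mapL
    (ContinuousLinearMap.apply ℂ (HH n L) F)
  refine (h1.congr_fun ?_)
  intro m
  ext k
  simp only [ContinuousLinearMap.apply_apply, ContinuousLinearMap.comp_apply]
  rw [Dg_apply (hb m)]
  simp

lemma inner_Tm (ht : Rap t) (hsym : ∀ m, t (-m) = (starRingEnd ℂ) (t m)) (F G : HH n L) :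
    inner ℂ (Tm t F) G = inner ℂ F (Tm t G) := by
  have h1 : HasSum (fun m => inner ℂ (t m • Sh m F) G) (inner ℂ (Tm t F) G) := by
    have h := (Tm_hasSum ht F).mapL (innerSL ℂ G)
    have h' := h.star
    simpa only [innerSL_apply_apply, RCLike.star_def, inner_conj_symm] using h'
  have h2 : HasSum (fun m => inner ℂ F (t m • Sh m G)) (inner ℂ F (Tm t G)) := by
    simpa using (Tm_hasSum ht G).mapL (innerSL ℂ F)
  rw [← h1.tsum_eq, ← h2.tsum_eq, ← (Equiv.neg (Fin n → ℤ)).tsum_eq]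
  congr 1; ext m
  simp only [Equiv.neg_apply, inner_smul_left, inner_smul_right, inner_Sh, neg_neg, hsym,
    Complex.conj_conj]

end

end ShapeD

namespace ShapeD

/-! ### The half line -/

/-- Lebesgue measure on the half line. -/
abbrev μ0 : Measure ℝ := volume.restrict (Set.Iic (0:ℝ))

/-- Square integrable functions on the half line. -/
abbrev LL := Lp ℂ 2 μ0

lemma μ0_Icc_ne_top (a : ℝ) : μ0 (Set.Icc a 0) ≠ ⊤ := by
  refine ne_of_lt (lt_of_le_of_lt (Measure.restrict_apply_le _ _) ?_)
  simp

/-- indicator of `[a,0]` -/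
def chi (a : ℝ) : LL := indicatorConstLp 2 measurableSet_Icc (μ0_Icc_ne_top a) (1:ℂ)

/-- hat function -/
def ppf (a : ℝ) : ℝ → ℂ := (Set.Icc a 0).indicator (fun t => ((t - a : ℝ) : ℂ))

lemma ppf_memLp (a : ℝ) : MemLp (ppf a) 2 μ0 := by
  have h1 : MemLp ((Set.Icc a 0).indicator (fun _ => (|a| : ℝ))) 2 μ0 :=
    memLp_indicator_const 2 measurableSet_Icc _ (Or.inr (μ0_Icc_ne_top a))
  refine h1.of_le ?_ ?_
  · refine (Measurable.indicator ?_ measurableSet_Icc).aestronglyMeasurable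
    fun_prop
  · refine Filter.Eventually.of_forall (fun t => ?_)
    unfold ppf
    by_cases ht : t ∈ Set.Icc a 0
    · rw [Set.indicator_of_mem ht, Set.indicator_of_mem ht, Complex.norm_real, Real.norm_eq_abs,
        Real.norm_eq_abs, abs_abs, abs_of_nonneg (by linarith [ht.1]),
        abs_of_nonpos (by linarith [ht.1, ht.2])]
      linarith [ht.2]
    · rw [Set.indicator_of_notMem ht, Set.indicator_of_notMem ht]; simp

/-- hat function in L² -/
def pp (a : ℝ) : LL := (ppf_memLp a).toLp

lemma pp_ae (a : ℝ) : pp a =ᵐ[μ0] ppf a := (ppf_memLp a).coeFn_toLp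

lemma chi_ae (a : ℝ) : chi a =ᵐ[μ0] (Set.Icc a 0).indicator (fun _ => (1:ℂ)) :=
  indicatorConstLp_coeFn

lemma μ0_restrict (a : ℝ) : μ0.restrict (Set.Icc a 0) = volume.restrict (Set.Icc a 0) := by
  rw [Measure.restrict_restrict measurableSet_Icc]
  congr 1
  ext t; simp

lemma chi_inner {a : ℝ} (ha : a ≤ 0) (f : LL) : inner ℂ (chi a) f = ∫ t in a..0, f t := by
  rw [chi, L2.inner_indicatorConstLp_one, μ0_restrict, intervalIntegral.integral_of_le ha,
    integral_Icc_eq_integral_Ioc]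

lemma pp_inner {a : ℝ} (ha : a ≤ 0) (f : LL) :
    inner ℂ (pp a) f = ∫ t in a..0, ((t - a : ℝ) : ℂ) * f t := by
  rw [L2.inner_def, intervalIntegral.integral_of_le ha, ← integral_Icc_eq_integral_Ioc,
    ← μ0_restrict, ← integral_indicator measurableSet_Icc]
  refine integral_congr_ae ?_
  filter_upwards [pp_ae a] with t ht
  rw [ht, ppf]
  by_cases h : t ∈ Set.Icc a 0
  · rw [Set.indicator_of_mem h, Set.indicator_of_mem h]
    simp [RCLike.inner_apply, mul_comm]
  · rw [Set.indicator_of_notMem h, Set.indicator_of_notMem h]; simp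

lemma intervalIntegrable_LL (f : LL) {a b : ℝ} (ha : a ≤ 0) (hb : b ≤ 0) :
    IntervalIntegrable f volume a b := by
  have h : IntegrableOn f (Set.Icc (min a b) 0) μ0 :=
    integrableOn_Lp_of_measure_ne_top f fact_one_le_two_ennreal.elim (μ0_Icc_ne_top _)
  rw [IntegrableOn, μ0_restrict] at h
  rw [intervalIntegrable_iff]
  refine IntegrableOn.mono_set (t := Set.Icc (min a b) 0) h ?_
  intro t ht
  rw [Set.uIoc, Set.mem_Ioc] at ht
  exact ⟨ht.1.le, ht.2.trans (max_le ha hb)⟩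

lemma ae_Iic {p : ℝ → Prop} (h : ∀ᵐ t ∂μ0, p t) : ∀ᵐ t, t ≤ 0 → p t :=
  (ae_restrict_iff' measurableSet_Iic).1 h

lemma chi_inner_chi {a a' : ℝ} (h : a ≤ a') (ha : a' ≤ 0) :
    inner ℂ (chi a') (chi a) = -(a' : ℂ) := by
  rw [chi_inner ha]
  have : ∫ t in a'..0, chi a t = ∫ t in a'..0, (1:ℂ) := by
    refine intervalIntegral.integral_congr_ae ?_
    filter_upwards [ae_Iic (chi_ae a)] with t ht ht2
    rw [Set.uIoc_of_le ha] at ht2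
    have hm : t ∈ Set.Icc a 0 := ⟨h.trans ht2.1.le, ht2.2⟩
    rw [ht ht2.2, Set.indicator_of_mem hm]
  rw [this]
  simp

lemma chi_inner_pp {a a' : ℝ} (h : a ≤ a') (ha : a' ≤ 0) :
    inner ℂ (chi a') (pp a) = ((∫ t in a'..0, (t - a) : ℝ) : ℂ) := by
  rw [chi_inner ha, ← intervalIntegral.integral_ofReal]
  refine intervalIntegral.integral_congr_ae ?_
  filter_upwards [ae_Iic (pp_ae a)] with t ht ht2
  rw [Set.uIoc_of_le ha] at ht2
  have hm : t ∈ Set.Icc a 0 := ⟨h.trans ht2.1.le, ht2.2⟩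
  rw [ht ht2.2, ppf, Set.indicator_of_mem hm]

lemma pp_inner_chi {a a' : ℝ} (h : a ≤ a') (ha : a' ≤ 0) :
    inner ℂ (pp a') (chi a) = ((∫ t in a'..0, (t - a') : ℝ) : ℂ) := by
  rw [pp_inner ha, ← intervalIntegral.integral_ofReal]
  refine intervalIntegral.integral_congr_ae ?_
  filter_upwards [ae_Iic (chi_ae a)] with t ht ht2
  rw [Set.uIoc_of_le ha] at ht2
  have hm : t ∈ Set.Icc a 0 := ⟨h.trans ht2.1.le, ht2.2⟩
  rw [ht ht2.2, Set.indicator_of_mem hm, mul_one]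

lemma hat_pair_aux {a a' : ℝ} (h : a ≤ a') (ha : a' ≤ 0) :
    inner ℂ (chi a') (pp a) + inner ℂ (pp a') (chi a) = ((a * a' : ℝ) : ℂ) := by
  rw [chi_inner_pp h ha, pp_inner_chi h ha, ← Complex.ofReal_add]
  congr 1
  rw [intervalIntegral.integral_sub (by simp) (by simp),
    intervalIntegral.integral_sub (by simp) (by simp), integral_id]
  simp
  ring

lemma hat_pair {a a' : ℝ} (ha : a ≤ 0) (ha' : a' ≤ 0) :
    inner ℂ (chi a') (pp a) + inner ℂ (pp a') (chi a) = ((a * a' : ℝ) : ℂ) := by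
  rcases le_total a a' with h | h
  · exact hat_pair_aux h ha'
  · have := congrArg (starRingEnd ℂ) (hat_pair_aux h ha)
    rw [map_add, inner_conj_symm, inner_conj_symm, Complex.conj_ofReal] at this
    rw [add_comm, this, mul_comm]

lemma norm_chi_sub_sq {a b : ℝ} (ha : a ≤ 0) (hb : b ≤ 0) : ‖chi a - chi b‖ ^ 2 = |a - b| := by
  wlog h : a ≤ b generalizing a b
  · rw [norm_sub_rev, this hb ha (le_of_not_ge h), abs_sub_comm]
  have h1 : ((‖chi a - chi b‖ ^ 2 : ℝ) : ℂ) = inner ℂ (chi a - chi b) (chi a - chi b) := by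
    rw [inner_self_eq_norm_sq_to_K]; simp
  have h2 : inner ℂ (chi a) (chi b) = -(b : ℂ) := by
    rw [← inner_conj_symm, chi_inner_chi h hb]; simp
  rw [inner_sub_left, inner_sub_right, inner_sub_right, chi_inner_chi le_rfl ha,
    chi_inner_chi le_rfl hb, chi_inner_chi h hb, h2] at h1
  have h3 : ((‖chi a - chi b‖ ^ 2 : ℝ) : ℂ) = ((b - a : ℝ) : ℂ) := by
    rw [h1]; push_cast; ring
  rw [Complex.ofReal_inj] at h3
  rw [h3, abs_of_nonpos (by linarith)]; ring

lemma chi_zero : chi 0 = 0 := by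
  have : ‖chi 0‖ ^ 2 = 0 := by
    have h1 : ((‖chi 0‖ ^ 2 : ℝ) : ℂ) = inner ℂ (chi 0) (chi 0) := by
      rw [inner_self_eq_norm_sq_to_K]; simp
    rw [chi_inner_chi le_rfl le_rfl] at h1
    simpa using h1
  simpa using this

lemma norm_chi_sq {a : ℝ} (ha : a ≤ 0) : ‖chi a‖ ^ 2 = -a := by
  have := norm_chi_sub_sq ha le_rfl
  rwa [chi_zero, sub_zero, sub_zero, abs_of_nonpos ha] at this

lemma norm_chi_le {a : ℝ} (ha : a ≤ 0) : ‖chi a‖ ≤ 1 + |a| := by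
  have := norm_chi_sq ha
  rw [abs_of_nonpos ha]
  nlinarith [norm_nonneg (chi a)]

lemma norm_pp_le_chi {a : ℝ} (ha : a ≤ 0) : ‖pp a‖ ≤ |a| * ‖chi a‖ := by
  refine Lp.norm_le_mul_norm_of_ae_le_mul ?_
  filter_upwards [pp_ae a, chi_ae a] with t h1 h2
  rw [h1, h2, ppf]
  by_cases ht : t ∈ Set.Icc a 0
  · rw [Set.indicator_of_mem ht, Set.indicator_of_mem ht, Complex.norm_real, Real.norm_eq_abs,
      abs_of_nonneg (by linarith [ht.1]), abs_of_nonpos (by linarith [ht.1, ht.2])]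
    simp; linarith [ht.2]
  · rw [Set.indicator_of_notMem ht, Set.indicator_of_notMem ht]; simp

lemma norm_pp_le {a : ℝ} (ha : a ≤ 0) : ‖pp a‖ ≤ (1 + |a|) ^ 2 := by
  have h1 := norm_pp_le_chi ha
  have h2 := norm_chi_le ha
  nlinarith [abs_nonneg a, norm_nonneg (chi a)]

lemma pp_zero : pp 0 = 0 := by
  have := norm_pp_le_chi le_rfl
  simpa using this

lemma pp_diff {a b : ℝ} (ha : a ≤ 0) (hb : b ≤ 0) :
    ‖pp b - pp a + ((b - a : ℝ) : ℂ) • chi a‖ ≤ |b - a| * ‖chi b - chi a‖ := by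
  refine Lp.norm_le_mul_norm_of_ae_le_mul ?_
  filter_upwards [pp_ae a, chi_ae a, pp_ae b, chi_ae b,
    Lp.coeFn_add (pp b - pp a) (((b - a : ℝ) : ℂ) • chi a), Lp.coeFn_sub (pp b) (pp a),
    Lp.coeFn_smul (((b - a : ℝ) : ℂ)) (chi a), Lp.coeFn_sub (chi b) (chi a),
    ae_restrict_mem measurableSet_Iic] with t h1 h2 h3 h4 h5 h6 h7 h8 h9
  rw [h5, h8]
  simp only [Pi.add_apply, Pi.sub_apply, h6, h7, Pi.smul_apply]
  rw [h1, h2, h3, h4, ppf, ppf]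
  have h9' : t ≤ 0 := h9
  by_cases hta : a ≤ t
  · have hma : t ∈ Set.Icc a 0 := ⟨hta, h9'⟩
    rw [Set.indicator_of_mem hma,
      Set.indicator_of_mem hma]
    by_cases htb : b ≤ t
    · have hmb : t ∈ Set.Icc b 0 := ⟨htb, h9'⟩
      rw [Set.indicator_of_mem hmb,
        Set.indicator_of_mem hmb]
      simp
    · have hmb : t ∉ Set.Icc b 0 := fun h => htb h.1
      rw [Set.indicator_of_notMem hmb, Set.indicator_of_notMem hmb]
      have e : (0:ℂ) - ((t - a : ℝ) : ℂ) + ((b - a : ℝ) : ℂ) • (1:ℂ) = ((b - t : ℝ) : ℂ) := by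
        push_cast; simp
      rw [e, Complex.norm_real, Real.norm_eq_abs, abs_of_nonneg (by linarith),
        abs_of_nonneg (by linarith)]
      simp; linarith
  · have hma : t ∉ Set.Icc a 0 := fun h => hta h.1
    rw [Set.indicator_of_notMem hma, Set.indicator_of_notMem hma]
    by_cases htb : b ≤ t
    · have hmb : t ∈ Set.Icc b 0 := ⟨htb, h9'⟩
      rw [Set.indicator_of_mem hmb,
        Set.indicator_of_mem hmb]
      simp only [sub_zero, smul_zero, add_zero]
      rw [Complex.norm_real, Real.norm_eq_abs, abs_of_nonneg (by linarith),
        abs_of_nonpos (by linarith)]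
      simp; linarith
    · have hmb : t ∉ Set.Icc b 0 := fun h => htb h.1
      rw [Set.indicator_of_notMem hmb, Set.indicator_of_notMem hmb]
      simp

lemma chi_continuousOn : ContinuousOn chi (Set.Iic 0) := by
  intro a ha
  rw [ContinuousWithinAt, tendsto_iff_norm_sub_tendsto_zero]
  have h1 : Filter.Tendsto (fun b : ℝ => Real.sqrt |b - a|) (nhdsWithin a (Set.Iic 0)) (nhds 0) := by
    have : Continuous (fun b : ℝ => Real.sqrt |b - a|) := by fun_prop
    simpa using (this.tendsto a).mono_left (nhdsWithin_le_nhds (s := Set.Iic 0))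
  refine h1.congr' ?_
  filter_upwards [self_mem_nhdsWithin] with b hb
  rw [← norm_chi_sub_sq hb ha, Real.sqrt_sq (norm_nonneg _)]

lemma pp_hasDerivWithinAt {a : ℝ} (ha : a ≤ 0) :
    HasDerivWithinAt pp (-chi a) (Set.Iic 0) a := by
  rw [hasDerivWithinAt_iff_isLittleO, Asymptotics.isLittleO_iff]
  intro c hc
  have h1 := (tendsto_iff_norm_sub_tendsto_zero.1 (chi_continuousOn a ha))
  filter_upwards [h1.eventually_lt_const hc, self_mem_nhdsWithin] with b hb hb0
  have h2 := pp_diff ha hb0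
  have e : pp b - pp a - (b - a) • -chi a = pp b - pp a + ((b - a : ℝ) : ℂ) • chi a := by
    rw [smul_neg, sub_neg_eq_add]
    congr 1
  rw [e, Real.norm_eq_abs]
  refine h2.trans ?_
  rw [mul_comm]
  gcongr

/-- weak derivative relation `f' = g`, `f(0)=c` -/
def wd (f g : LL) (c : ℂ) : Prop :=
  ∀ a : ℝ, a ≤ 0 → inner ℂ (chi a) f + inner ℂ (pp a) g = -(a:ℂ) * c

/-- the trace functional -/
def tr (f g : LL) : ℂ := inner ℂ (chi (-1)) f + inner ℂ (pp (-1)) g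

lemma wd.tr {f g : LL} {c : ℂ} (h : wd f g c) : tr f g = c := by
  have := h (-1) (by norm_num)
  simpa [ShapeD.tr] using this

lemma wd.add {f g f' g' : LL} {c c' : ℂ} (h : wd f g c) (h' : wd f' g' c') :
    wd (f + f') (g + g') (c + c') := by
  intro a ha
  rw [inner_add_right, inner_add_right]
  linear_combination h a ha + h' a ha

lemma wd.smul {f g : LL} {c : ℂ} (h : wd f g c) (r : ℂ) : wd (r • f) (r • g) (r * c) := by
  intro a ha
  rw [inner_smul_right, inner_smul_right]
  linear_combination r * h a ha

lemma wd_zero : wd 0 0 0 := by intro a _; simp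

lemma wd.neg {f g : LL} {c : ℂ} (h : wd f g c) : wd (-f) (-g) (-c) := by
  simpa using h.smul (-1)

lemma wd.sub {f g f' g' : LL} {c c' : ℂ} (h : wd f g c) (h' : wd f' g' c') :
    wd (f - f') (g - g') (c - c') := by
  simpa [sub_eq_add_neg] using h.add h'.neg

lemma wd.sum {ι : Type*} (s : Finset ι) {f g : ι → LL} {c : ι → ℂ} (h : ∀ i ∈ s, wd (f i) (g i) (c i)) :
    wd (∑ i ∈ s, f i) (∑ i ∈ s, g i) (∑ i ∈ s, c i) := by
  induction s using Finset.induction_on with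
  | empty => simpa using wd_zero
  | insert i s hi ih =>
    rw [Finset.sum_insert hi, Finset.sum_insert hi, Finset.sum_insert hi]
    exact (h i (by simp)).add (ih fun j hj => h j (by simp [hj]))

lemma wd.hasSum {ι : Type*} {f g : ι → LL} {c : ι → ℂ} (h : ∀ i, wd (f i) (g i) (c i))
    {f0 g0 : LL} {c0 : ℂ} (hf : HasSum f f0) (hg : HasSum g g0) (hc : HasSum c c0) : wd f0 g0 c0 := by
  intro a ha
  have h1 := (hf.mapL (innerSL ℂ (chi a))).add (hg.mapL (innerSL ℂ (pp a)))
  have h2 := hc.mul_left (-(a:ℂ))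
  refine h1.unique (h2.congr_fun ?_)
  intro i
  simpa using h i a ha

lemma wd_pp {a : ℝ} (ha : a ≤ 0) : wd (pp a) (chi a) (-a) := by
  intro b hb
  rw [hat_pair ha hb]
  push_cast; ring

/-- pointwise representative -/
def hatf (g : LL) (c : ℂ) (z : ℝ) : ℂ := c - inner ℂ (chi z) g

lemma hatf_zero (g : LL) (c : ℂ) : hatf g c 0 = c := by simp [hatf, chi_zero]

lemma hatf_continuousOn (g : LL) (c : ℂ) : ContinuousOn (hatf g c) (Set.Iic 0) :=
  continuousOn_const.sub (chi_continuousOn.inner continuousOn_const)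

lemma pp_inner_hasDeriv (g : LL) {z : ℝ} (hz : z ≤ 0) :
    HasDerivWithinAt (fun z => inner ℂ (pp z) g : ℝ → ℂ) (-inner ℂ (chi z) g) (Set.Iic 0) z := by
  have := (pp_hasDerivWithinAt hz).inner ℂ (hasDerivWithinAt_const z (Set.Iic 0) g)
  simpa using this

lemma norm_hatf_le (g : LL) (c : ℂ) {z : ℝ} (hz : z ≤ 0) :
    ‖hatf g c z‖ ≤ ‖c‖ + (1 + |z|) * ‖g‖ := by
  refine (norm_sub_le _ _).trans ?_
  gcongr
  refine (norm_inner_le_norm _ _).trans ?_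
  gcongr
  exact norm_chi_le hz

lemma chi_inner_hasDeriv {f g : LL} {c : ℂ} (h : wd f g c) {z : ℝ} (hz : z ≤ 0) :
    HasDerivWithinAt (fun z => inner ℂ (chi z) f : ℝ → ℂ) (-hatf g c z) (Set.Iic 0) z := by
  have h1 : HasDerivWithinAt (fun a : ℝ => -(a:ℂ) * c - inner ℂ (pp a) g)
      (-1 * c - -inner ℂ (chi z) g) (Set.Iic 0) z := by
    refine HasDerivWithinAt.sub ?_ (pp_inner_hasDeriv g hz)
    refine HasDerivWithinAt.mul_const ?_ _
    exact (Complex.ofRealCLM.hasDerivAt.neg).hasDerivWithinAt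
  refine (h1.congr_of_mem ?_ hz).congr_deriv ?_
  · intro a ha
    linear_combination h a ha
  · unfold hatf; ring

lemma wd.hatf_deriv {g g2 : LL} {c c2 : ℂ} (h2 : wd g g2 c2) {z : ℝ} (hz : z ≤ 0) :
    HasDerivWithinAt (hatf g c) (hatf g2 c2 z) (Set.Iic 0) z := by
  have := (hasDerivWithinAt_const z (Set.Iic 0) c).sub (chi_inner_hasDeriv h2 hz)
  refine this.congr_deriv ?_
  ring

lemma wd.ae_eq {f g : LL} {c : ℂ} (h : wd f g c) : ∀ᵐ t : ℝ, t ≤ 0 → f t = hatf g c t := by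
  have key : ∀ N : ℕ, ∀ᵐ t : ℝ, t ∈ Set.uIcc (-(N:ℝ)) 0 → f t = hatf g c t := by
    intro N
    have hN : -(N:ℝ) ≤ 0 := by simp
    have h0 : ∀ᵐ t : ℝ, t ≠ 0 := by
      simp [ae_iff]
    filter_upwards [(intervalIntegrable_LL f hN le_rfl).ae_hasDerivAt_integral, h0] with t ht ht0 hmem
    have h1 := ht hmem 0 (Set.right_mem_uIcc)
    rw [Set.uIcc_of_le hN] at hmem
    have hlt : t < 0 := lt_of_le_of_ne hmem.2 ht0
    have h2 := (chi_inner_hasDeriv h hmem.2).hasDerivAt (Iic_mem_nhds hlt)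
    have h3 : HasDerivAt (fun x : ℝ => ∫ s in (0:ℝ)..x, f s) (- -hatf g c t) t := by
      refine h2.neg.congr_of_eventuallyEq ?_
      filter_upwards [Iic_mem_nhds hlt] with x hx
      simp only [Pi.neg_apply]
      rw [chi_inner hx, intervalIntegral.integral_symm]
    rw [neg_neg] at h3
    exact h1.unique h3
  rw [← ae_all_iff] at key
  filter_upwards [key] with t ht h0
  obtain ⟨N, hN⟩ := exists_nat_ge (-t)
  refine ht N ?_
  rw [Set.uIcc_of_le (by simp)]
  exact ⟨by linarith, h0⟩

lemma eq_zero_of_chi {f : LL} (h : ∀ a ≤ 0, inner ℂ (chi a) f = 0) : f = 0 := by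
  have h1 : wd f 0 0 := by intro a ha; simp [h a ha]
  rw [Lp.eq_zero_iff_ae_eq_zero]
  refine (ae_restrict_iff' measurableSet_Iic).2 ?_
  filter_upwards [h1.ae_eq] with t ht ht0
  rw [ht ht0]; simp [hatf]

/-! #### Integration by parts by density -/

lemma exp_ode {P : ℝ → ℂ} {Q : ℝ → ℂ} (h : ∀ z ≤ 0, HasDerivWithinAt P (Q z) (Set.Iic 0) z)
    (h0 : ∀ z ≤ 0, Q z = 0) {z : ℝ} (hz : z ≤ 0) : P z = P 0 := by
  refine (convex_Iic (0:ℝ)).is_const_of_fderivWithin_eq_zero (𝕜 := ℝ) (f := P) ?_ ?_ hz (by simp)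
  · exact fun z hz => (h z hz).differentiableWithinAt
  · intro z hz
    have h1 := (h z hz).hasFDerivWithinAt.fderivWithin (uniqueDiffOn_Iic (0:ℝ) z hz)
    rw [h1, h0 z hz]
    ext; simp

lemma wd_exp_zero {s : LL} (h : wd s s 0) : s = 0 := by
  have hP : ∀ z ≤ 0, inner ℂ (chi z) s = - inner ℂ (pp z) s := by
    intro z hz
    have := h z hz
    linear_combination this
  have h1 : ∀ z ≤ (0:ℝ), (inner ℂ (pp z) s : ℂ) * Complex.exp (-(z:ℂ)) = 0 := by
    intro z hz
    have := exp_ode (P := fun z : ℝ => (inner ℂ (pp z) s : ℂ) * Complex.exp (-(z:ℂ)))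
      (Q := fun z : ℝ => (-inner ℂ (chi z) s : ℂ) * Complex.exp (-(z:ℂ)) +
        (inner ℂ (pp z) s : ℂ) * (Complex.exp (-(z:ℂ)) * (-1))) ?_ ?_ hz
    · simpa [pp_zero] using this
    · intro z hz
      refine (pp_inner_hasDeriv s hz).mul ?_
      exact ((Complex.ofRealCLM.hasDerivAt (x := z)).neg.cexp).hasDerivWithinAt
    · intro z hz
      simp only [hP z hz]; ring
  refine eq_zero_of_chi (fun a ha => ?_)
  rw [hP a ha]
  have := h1 a ha
  simpa [Complex.exp_ne_zero] using this

lemma wd_exp_grow {r : LL} {c : ℂ} (h : wd r (-r) c) : c = 0 ∧ r = 0 := by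
  have hP : ∀ z ≤ 0, inner ℂ (chi z) r = inner ℂ (pp z) r - z * c := by
    intro z hz
    have := h z hz
    rw [inner_neg_right] at this
    linear_combination this
  have h1 : ∀ z ≤ (0:ℝ), ((inner ℂ (pp z) r : ℂ) - c * (z - 1)) * Complex.exp (z:ℂ) = c := by
    intro z hz
    have := exp_ode (P := fun z : ℝ => ((inner ℂ (pp z) r : ℂ) - c * (z - 1)) * Complex.exp (z:ℂ))
      (Q := fun z : ℝ => (-inner ℂ (chi z) r - c * 1 : ℂ) * Complex.exp (z:ℂ) +
        ((inner ℂ (pp z) r : ℂ) - c * (z - 1)) * (Complex.exp (z:ℂ) * 1)) ?_ ?_ hz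
    · rw [this]; simp [pp_zero]
    · intro z hz
      refine HasDerivWithinAt.mul ?_ ?_
      · refine (pp_inner_hasDeriv r hz).sub ?_
        exact (((Complex.ofRealCLM.hasDerivAt (x := z)).sub_const 1).const_mul c).hasDerivWithinAt
      · exact ((Complex.ofRealCLM.hasDerivAt (x := z)).cexp).hasDerivWithinAt
    · intro z hz
      simp only [hP z hz]; ring
  have hc : c = 0 := by
    have hb : ∀ N : ℕ, ‖c‖ ≤ (((1 + N) ^ 2 : ℝ) * (‖r‖ + ‖c‖)) * Real.exp (-N) := by
      intro N
      have hN : -(N:ℝ) ≤ 0 := by simp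
      have h2 := h1 (-N) hN
      have h2' := congrArg norm h2
      rw [norm_mul, Complex.norm_exp, Complex.ofReal_re] at h2'
      refine h2'.symm.le.trans ?_
      gcongr
      refine (norm_sub_le _ _).trans ?_
      rw [mul_add]
      have h3 := norm_pp_le hN
      rw [abs_neg, Nat.abs_cast] at h3
      refine add_le_add ?_ ?_
      · refine (norm_inner_le_norm _ _).trans ?_
        gcongr
      · rw [norm_mul, mul_comm]
        gcongr
        have : ‖((-(N:ℝ) : ℝ) : ℂ) - 1‖ = 1 + N := by
          rw [show ((-(N:ℝ) : ℝ) : ℂ) - 1 = ((-(1 + N) : ℝ) : ℂ) by push_cast; ring,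
            Complex.norm_real, Real.norm_eq_abs, abs_neg, abs_of_nonneg (by positivity)]
        rw [this]
        nlinarith [Nat.cast_nonneg (α := ℝ) N]
    have hl : Filter.Tendsto (fun N : ℕ => (((1 + N) ^ 2 : ℝ) * (‖r‖ + ‖c‖)) * Real.exp (-N))
        Filter.atTop (nhds 0) := by
      have h0 := (Real.tendsto_pow_mul_exp_neg_atTop_nhds_zero 2).comp
        (Filter.tendsto_atTop_add_const_left _ 1 (tendsto_natCast_atTop_atTop (R := ℝ)))
      have h4 := h0.const_mul ((‖r‖ + ‖c‖) * Real.exp 1)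
      rw [mul_zero] at h4
      refine h4.congr (fun N => ?_)
      simp only [Function.comp_apply]
      rw [neg_add, Real.exp_add]
      have : Real.exp 1 * Real.exp (-1) = 1 := by rw [← Real.exp_add]; simp
      linear_combination (‖r‖ + ‖c‖) * (1 + (N:ℝ)) ^ 2 * Real.exp (-N) * this
    have := ge_of_tendsto' hl hb
    simpa using this
  refine ⟨hc, eq_zero_of_chi (fun a ha => ?_)⟩
  subst hc
  have := h1 a ha
  rw [hP a ha]
  simpa [Complex.exp_ne_zero] using this

/-- The graph of the weak derivative. -/
def Gam : Submodule ℂ (WithLp 2 (LL × LL)) where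
  carrier := {v | wd v.fst v.snd (tr v.fst v.snd)}
  add_mem' := by
    intro v w hv hw
    have := wd.add hv hw
    have h2 := this.tr
    simp only [Set.mem_ofPred_eq, WithLp.add_fst, WithLp.add_snd]
    rw [h2]; exact this
  zero_mem' := by
    have := wd_zero
    have h2 := this.tr
    simp only [Set.mem_ofPred_eq, WithLp.zero_fst, WithLp.zero_snd]
    rw [h2]; exact this
  smul_mem' := by
    intro r v hv
    have := wd.smul hv r
    have h2 := this.tr
    simp only [Set.mem_ofPred_eq, WithLp.smul_fst, WithLp.smul_snd]
    rw [h2]; exact this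

/-- span of hat functions -/
def Hat : Submodule ℂ (WithLp 2 (LL × LL)) :=
  Submodule.span ℂ {v | ∃ a : ℝ, a ≤ 0 ∧ v = WithLp.toLp 2 (pp a, chi a)}

lemma continuous_fst_LL : Continuous (fun v : WithLp 2 (LL × LL) => v.fst) :=
  continuous_fst.comp (WithLp.prod_continuous_ofLp 2 LL LL)
lemma continuous_snd_LL : Continuous (fun v : WithLp 2 (LL × LL) => v.snd) :=
  continuous_snd.comp (WithLp.prod_continuous_ofLp 2 LL LL)

lemma Gam_closed : IsClosed (Gam : Set (WithLp 2 (LL × LL))) := by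
  have : (Gam : Set (WithLp 2 (LL × LL))) = ⋂ a : ℝ, {v | a ≤ 0 →
    inner ℂ (chi a) v.fst + inner ℂ (pp a) v.snd = -(a:ℂ) * tr v.fst v.snd} := by
    ext v; simp [Gam, wd]
  rw [this]
  refine isClosed_iInter (fun a => ?_)
  by_cases ha : a ≤ 0
  · simp only [ha, true_imp_iff]
    have h1 := continuous_fst_LL
    have h2 := continuous_snd_LL
    unfold tr
    refine isClosed_eq ?_ ?_ <;> fun_prop
  · simp [ha]

lemma Hat_le : Hat ≤ Gam := by
  refine Submodule.span_le.2 ?_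
  rintro _ ⟨a, ha, rfl⟩
  have := wd_pp ha
  show wd _ _ _
  have h2 := this.tr
  show wd (pp a) (chi a) (tr (pp a) (chi a))
  rw [h2]; exact this

lemma Gam_le : Gam ≤ Hat.topologicalClosure := by
  intro v hv
  have hH : Hat.topologicalClosure ≤ Gam :=
    Submodule.topologicalClosure_minimal _ Hat_le Gam_closed
  have : CompleteSpace Hat.topologicalClosure :=
    (Submodule.isClosed_topologicalClosure Hat).completeSpace_coe
  obtain ⟨w, hw, w', hw', rfl⟩ := Submodule.exists_add_mem_mem_orthogonal (K := Hat.topologicalClosure) v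
  have h3 : w' ∈ Gam := by
    have := Gam.sub_mem hv (hH hw)
    simpa using this
  have h4 : wd w'.snd w'.fst 0 := by
    intro a ha
    have := (Submodule.mem_orthogonal _ _).1 hw' _
      (Submodule.le_topologicalClosure _ (Submodule.subset_span ⟨a, ha, rfl⟩))
    rw [WithLp.prod_inner_apply] at this
    rw [mul_zero, add_comm]
    exact this
  have h5 : wd w'.fst w'.snd (tr w'.fst w'.snd) := h3
  have h6 := h5.sub h4
  rw [← neg_sub w'.fst w'.snd] at h6
  obtain ⟨hc, hr⟩ := wd_exp_grow h6
  rw [sub_zero] at hc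
  rw [sub_eq_zero] at hr
  rw [hc, hr] at h5
  have h7 := wd_exp_zero h5
  have : w' = 0 := by
    apply (WithLp.equiv 2 (LL × LL)).injective
    exact Prod.ext (hr.trans h7) h7
  rw [this, add_zero]
  exact hw

/-- Integration by parts. -/
lemma wd.ibp {f g f' g' : LL} {c c' : ℂ} (h : wd f g c) (h' : wd f' g' c') :
    inner ℂ f g' + inner ℂ g f' = (starRingEnd ℂ) c * c' := by
  have hv : WithLp.toLp 2 (f, g) ∈ Hat.topologicalClosure := by
    refine Gam_le ?_
    show wd f g (ShapeD.tr f g)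
    rw [h.tr]; exact h
  have h1 := continuous_fst_LL
  have h2 := continuous_snd_LL
  have key : ∀ v ∈ Hat.topologicalClosure, inner ℂ v.fst g' + inner ℂ v.snd f' =
      (starRingEnd ℂ) (ShapeD.tr v.fst v.snd) * c' := by
    intro v hv
    refine closure_minimal (s := (Hat : Set (WithLp 2 (LL × LL))))
      (t := {v | inner ℂ v.fst g' + inner ℂ v.snd f' =
      (starRingEnd ℂ) (ShapeD.tr v.fst v.snd) * c'}) ?_ ?_ hv
    · intro v hv
      refine Submodule.span_induction ?_ ?_ ?_ ?_ hv
      · rintro _ ⟨a, ha, rfl⟩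
        show inner ℂ (pp a) g' + inner ℂ (chi a) f' = (starRingEnd ℂ) (ShapeD.tr (pp a) (chi a)) * c'
        rw [(wd_pp ha).tr, add_comm, h' a ha]
        simp
      · simp [ShapeD.tr]
      · intro x y _ _ hx hy
        simp only [Set.mem_ofPred_eq, WithLp.add_fst, WithLp.add_snd, ShapeD.tr, inner_add_left,
          inner_add_right, map_add] at hx hy ⊢
        linear_combination hx + hy
      · intro a x _ hx
        simp only [Set.mem_ofPred_eq, WithLp.smul_fst, WithLp.smul_snd, ShapeD.tr, inner_smul_left,
          inner_smul_right, map_add, map_mul] at hx ⊢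
        linear_combination (starRingEnd ℂ a) * hx
    · unfold ShapeD.tr
      refine isClosed_eq (by fun_prop) ?_
      refine Continuous.mul ?_ continuous_const
      refine Complex.continuous_conj.comp ?_
      fun_prop
  have := key _ hv
  rw [← h.tr]
  exact this

end ShapeD

namespace ShapeD

variable {n : ℕ}

section abstractE
variable {H : Type*} [NormedAddCommGroup H] [InnerProductSpace ℂ H] [CompleteSpace H]

/-- fields with `n+1` components -/
abbrev EE (n : ℕ) (H : Type*) [NormedAddCommGroup H] := PiLp 2 (fun _ : Option (Fin n) => H)

/-- projection to a component -/
def prj (j : Option (Fin n)) : EE n H →L[ℂ] H := PiLp.proj 2 (fun _ : Option (Fin n) => H) j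

/-- injection of a component -/
def inj (j : Option (Fin n)) : H →L[ℂ] EE n H :=
  ((PiLp.continuousLinearEquiv 2 ℂ (fun _ : Option (Fin n) => H)).symm : _ →L[ℂ] _).comp
    (ContinuousLinearMap.single ℂ (fun _ : Option (Fin n) => H) j)

@[simp] lemma prj_apply (j : Option (Fin n)) (F : EE n H) : prj j F = F j := rfl

lemma inj_apply (j j' : Option (Fin n)) (x : H) : inj j x j' = if j' = j then x else 0 := by
  have : inj j x j' = (Pi.single j x : Option (Fin n) → H) j' := rfl
  rw [this, Pi.single_apply]

/-- first perturbation -/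
def RT (T : Fin n → H →L[ℂ] H) : EE n H →L[ℂ] EE n H :=
  ∑ i, (inj (some i)).comp ((T i).comp (prj none))

/-- second perturbation -/
def CT (T : Fin n → H →L[ℂ] H) : EE n H →L[ℂ] EE n H :=
  ∑ i, (inj none).comp ((T i).comp (prj (some i)))

lemma E_sum_apply {ι : Type*} (s : Finset ι) (f : ι → EE n H) (j) :
    (∑ i ∈ s, f i) j = ∑ i ∈ s, f i j := by
  have := map_sum (prj (H := H) j) f s
  exact this

@[simp] lemma RT_some (T : Fin n → H →L[ℂ] H) (F : EE n H) (i) : RT T F (some i) = T i (F none) := by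
  simp [RT, ContinuousLinearMap.sum_apply, E_sum_apply, inj_apply]

@[simp] lemma RT_none (T : Fin n → H →L[ℂ] H) (F : EE n H) : RT T F none = 0 := by
  simp [RT, ContinuousLinearMap.sum_apply, E_sum_apply, inj_apply]

@[simp] lemma CT_some (T : Fin n → H →L[ℂ] H) (F : EE n H) (i) : CT T F (some i) = 0 := by
  simp [CT, ContinuousLinearMap.sum_apply, E_sum_apply, inj_apply]

@[simp] lemma CT_none (T : Fin n → H →L[ℂ] H) (F : EE n H) :
    CT T F none = ∑ i, T i (F (some i)) := by
  simp [CT, ContinuousLinearMap.sum_apply, E_sum_apply, inj_apply]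

lemma RT_affine (T Z : Fin n → H →L[ℂ] H) (ε : ℂ) :
    RT (fun i => T i + ε • Z i) = RT T + ε • RT Z := by
  ext F j
  cases j <;> simp

lemma CT_affine (T Z : Fin n → H →L[ℂ] H) (ε : ℂ) :
    CT (fun i => T i + ε • Z i) = CT T + ε • CT Z := by
  ext F j
  cases j <;> simp [Finset.sum_add_distrib, Finset.smul_sum]

/-- The operator `A`. -/
def Aop (T : Fin n → H →L[ℂ] H) : EE n H →L[ℂ] EE n H := (1 - CT T) * (1 - RT T)

lemma Aop_some (T : Fin n → H →L[ℂ] H) (F : EE n H) (i) :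
    Aop T F (some i) = F (some i) - T i (F none) := by
  simp [Aop]

lemma Aop_none (T : Fin n → H →L[ℂ] H) (F : EE n H) :
    Aop T F none = F none - ∑ i, T i (F (some i) - T i (F none)) := by
  simp [Aop]

lemma inner_CT (T : Fin n → H →L[ℂ] H) (hT : ∀ i x y, inner ℂ (T i x) y = inner ℂ x (T i y))
    (F G : EE n H) : inner ℂ (CT T F) G = inner ℂ F (RT T G) := by
  simp [PiLp.inner_apply, Fintype.sum_option, sum_inner, hT]

lemma Aop_coercive (T : Fin n → H →L[ℂ] H) (hT : ∀ i x y, inner ℂ (T i x) y = inner ℂ x (T i y))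
    (F : EE n H) : inner ℂ (Aop T F) F = ((‖F - RT T F‖ ^ 2 : ℝ) : ℂ) := by
  have : Aop T F = (F - RT T F) - CT T (F - RT T F) := by simp [Aop]
  rw [this, inner_sub_left, inner_CT T hT, ← inner_sub_right, inner_self_eq_norm_sq_to_K]
  simp

lemma RT_sq (T : Fin n → H →L[ℂ] H) (F : EE n H) : RT T (RT T F) = 0 := by
  ext j; cases j <;> simp

lemma norm_le_sub_RT (T : Fin n → H →L[ℂ] H) (F : EE n H) :
    ‖F‖ ≤ (1 + ‖RT T‖) * ‖F - RT T F‖ := by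
  have : F = (F - RT T F) + RT T (F - RT T F) := by
    rw [map_sub, RT_sq]; simp
  calc ‖F‖ = ‖(F - RT T F) + RT T (F - RT T F)‖ := by rw [← this]
    _ ≤ ‖F - RT T F‖ + ‖RT T‖ * ‖F - RT T F‖ :=
      (norm_add_le _ _).trans (by gcongr; exact ContinuousLinearMap.le_opNorm _ _)
    _ = _ := by ring

variable (V : Submodule ℂ (EE n H)) [V.HasOrthogonalProjection]

/-- the orthogonal projection -/
abbrev PV : EE n H →L[ℂ] EE n H := V.starProjection

/-- the compressed operator -/
def Bop' (A : EE n H →L[ℂ] EE n H) : EE n H →L[ℂ] EE n H := PV V * A * PV V + (1 - PV V)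

lemma PV_idem (F : EE n H) : PV V (PV V F) = PV V F :=
  V.starProjection_eq_self_iff.2 (V.starProjection_apply_mem F)

lemma PV_symm (F G : EE n H) : inner ℂ (PV V F) G = inner ℂ F (PV V G) :=
  V.starProjection_isSymmetric F G

lemma Bop'_apply (A : EE n H →L[ℂ] EE n H) (F) :
    Bop' V A F = PV V (A (PV V F)) + (F - PV V F) := by simp [Bop']

lemma Bop'_unit (T : Fin n → H →L[ℂ] H) (hT : ∀ i x y, inner ℂ (T i x) y = inner ℂ x (T i y)) :
    IsUnit (Bop' V (Aop T)) := by
  set K : ℝ := (1 + ‖RT T‖) with hK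
  have hK1 : 1 ≤ K := by rw [hK]; linarith [norm_nonneg (RT T)]
  have hc : 0 < (K ^ 2)⁻¹ := by positivity
  refine ContinuousLinearMap.isUnit_of_forall_le_norm_inner_map _ (c := ⟨(K ^ 2)⁻¹, hc.le⟩) hc
    (fun F => ?_)
  have e : inner ℂ (Bop' V (Aop T) F) F =
      ((‖PV V F - RT T (PV V F)‖ ^ 2 + ‖F - PV V F‖ ^ 2 : ℝ) : ℂ) := by
    rw [Bop'_apply, inner_add_left, PV_symm, Aop_coercive T hT]
    have h1 : inner ℂ (F - PV V F) F = inner ℂ (F - PV V F) (F - PV V F) := by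
      have : inner ℂ (F - PV V F) (PV V F) = 0 := by
        rw [← PV_symm, map_sub, PV_idem]; simp
      rw [inner_sub_right, this, sub_zero]
    rw [h1, inner_self_eq_norm_sq_to_K]
    simp
  have hp : ‖F‖ ^ 2 = ‖PV V F‖ ^ 2 + ‖F - PV V F‖ ^ 2 := by
    have h0 : inner ℂ (PV V F) (F - PV V F) = 0 := by
      rw [PV_symm, map_sub, PV_idem]; simp
    have := norm_add_sq_eq_norm_sq_add_norm_sq_of_inner_eq_zero (PV V F) (F - PV V F) h0
    rw [add_sub_cancel] at this
    nlinarith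
  rw [e, Complex.norm_real, Real.norm_of_nonneg (by positivity)]
  show ‖F‖ ^ 2 * (K ^ 2)⁻¹ ≤ _
  rw [hp, ← div_eq_mul_inv, div_le_iff₀ (by positivity)]
  have h2 := norm_le_sub_RT T (PV V F)
  have h3 : ‖PV V F‖ ^ 2 ≤ K ^ 2 * ‖PV V F - RT T (PV V F)‖ ^ 2 := by
    rw [← mul_pow]; gcongr
  have h4 : ‖F - PV V F‖ ^ 2 ≤ K ^ 2 * ‖F - PV V F‖ ^ 2 := by
    have : 1 ≤ K ^ 2 := one_le_pow₀ hK1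
    nlinarith [sq_nonneg (‖F - PV V F‖)]
  linarith

lemma Bop'_inj {A : EE n H →L[ℂ] EE n H} (h : IsUnit (Bop' V A)) {F G} (hFG : Bop' V A F = Bop' V A G) :
    F = G := by
  obtain ⟨u, hu⟩ := h
  have : (↑u⁻¹ * ↑u : EE n H →L[ℂ] EE n H) F = (↑u⁻¹ * ↑u : EE n H →L[ℂ] EE n H) G := by
    show (↑u⁻¹ : EE n H →L[ℂ] EE n H) ((↑u : EE n H →L[ℂ] EE n H) F) =
      (↑u⁻¹ : EE n H →L[ℂ] EE n H) ((↑u : EE n H →L[ℂ] EE n H) G)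
    rw [hu, hFG]
  simpa using this

/-- the correction -/
def Gsol (A : EE n H →L[ℂ] EE n H) (Ψ : EE n H) : EE n H := Ring.inverse (Bop' V A) (PV V (A Ψ))

lemma Gsol_eq {A : EE n H →L[ℂ] EE n H} (h : IsUnit (Bop' V A)) (Ψ : EE n H) :
    Bop' V A (Gsol V A Ψ) = PV V (A Ψ) := by
  have := Ring.mul_inverse_cancel _ h
  have := congrArg (fun S : EE n H →L[ℂ] EE n H => S (PV V (A Ψ))) this
  simpa [Gsol] using this

lemma Gsol_mem {A : EE n H →L[ℂ] EE n H} (h : IsUnit (Bop' V A)) (Ψ : EE n H) :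
    PV V (Gsol V A Ψ) = Gsol V A Ψ := by
  have h1 := Gsol_eq V h Ψ
  rw [Bop'_apply] at h1
  have h2 := congrArg (PV V) h1
  rw [map_add, map_sub, PV_idem, PV_idem, PV_idem, sub_self, add_zero] at h2
  rw [h2] at h1
  have : Gsol V A Ψ - PV V (Gsol V A Ψ) = 0 := by simpa using h1
  exact (sub_eq_zero.1 this).symm

lemma Gsol_orth {A : EE n H →L[ℂ] EE n H} (h : IsUnit (Bop' V A)) (Ψ : EE n H) :
    PV V (A (Ψ - Gsol V A Ψ)) = 0 := by
  have h1 := Gsol_eq V h Ψ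
  rw [Bop'_apply, Gsol_mem V h, sub_self, add_zero] at h1
  rw [map_sub, map_sub, h1, sub_self]

/-- transfer between weights -/
lemma Gsol_transfer {A As J : EE n H →L[ℂ] EE n H} (h : IsUnit (Bop' V A)) (hs : IsUnit (Bop' V As))
    (hJA : ∀ F, J (As F) = A (J F)) (hJP : ∀ F, J (PV V F) = PV V (J F)) (Ψ : EE n H) :
    J (Gsol V As Ψ) = Gsol V A (J Ψ) := by
  refine Bop'_inj V h ?_
  rw [Gsol_eq V h, ← hJA, ← hJP, ← Gsol_eq V hs Ψ, Bop'_apply, Bop'_apply]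
  simp only [map_add, map_sub, hJA, hJP]

/-- componentwise application -/
def mapE (S : H →L[ℂ] H) : EE n H →L[ℂ] EE n H := ∑ j, (inj j).comp (S.comp (prj j))

@[simp] lemma mapE_apply (S : H →L[ℂ] H) (F : EE n H) (j) : mapE S F j = S (F j) := by
  cases j <;> simp [mapE, E_sum_apply, inj_apply]

lemma mapE_comm (S : H →L[ℂ] H) (hS : ∀ x y, inner ℂ (S x) y = inner ℂ x (S y))
    (hV : ∀ F ∈ V, mapE S F ∈ V) (F : EE n H) : mapE S (PV V F) = PV V (mapE S F) := by
  have h1 : PV V (mapE S (PV V F)) = mapE S (PV V F) :=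
    V.starProjection_eq_self_iff.2 (hV _ (V.starProjection_apply_mem F))
  have h2 : PV V (mapE S (F - PV V F)) = 0 := by
    rw [Submodule.starProjection_apply_eq_zero_iff, Submodule.mem_orthogonal]
    intro v hv
    have : inner ℂ v (mapE S (F - PV V F)) = inner ℂ (mapE S v) (F - PV V F) := by
      simp [PiLp.inner_apply, hS]
    rw [this]
    exact V.inner_right_of_mem_orthogonal (hV v hv) (V.sub_starProjection_mem_orthogonal F)
  rw [map_sub, map_sub, h1, sub_eq_zero] at h2
  exact h2.symm

lemma mapE_Aop (S : H →L[ℂ] H) (T Ts : Fin n → H →L[ℂ] H) (h : ∀ i x, S (Ts i x) = T i (S x))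
    (F : EE n H) : mapE S (Aop Ts F) = Aop T (mapE S F) := by
  ext j
  cases j with
  | none => simp [Aop_none, h]
  | some i => simp [Aop_some, h]

end abstractE

end ShapeD

namespace ShapeD

variable {n : ℕ}

/-- the concrete space of fields -/
abbrev E' (n : ℕ) := EE n (HH n LL)

/-- component functional -/
def cmp (j : Option (Fin n)) (k : Fin n → ℤ) : E' n →L[ℂ] LL := (evk k).comp (prj j)

@[simp] lemma cmp_apply (j : Option (Fin n)) (k : Fin n → ℤ) (F : E' n) : cmp j k F = F j k := rfl

/-- gradient fields with zero trace -/
def Vs (n : ℕ) : Submodule ℂ (E' n) where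
  carrier := {F | ∀ i k, wd (F (some i) k) (dk i k • F none k) 0}
  add_mem' := by
    intro F G hF hG i k
    have := (hF i k).add (hG i k)
    rw [← smul_add, add_zero] at this
    exact this
  zero_mem' := by
    intro i k
    have := (wd_zero.smul (dk i k))
    rw [mul_zero, smul_zero] at this
    show wd 0 (dk i k • (0:LL)) 0
    rwa [smul_zero]
  smul_mem' := by
    intro c F hF i k
    have := (hF i k).smul c
    rw [smul_comm, mul_zero] at this
    exact this

lemma mem_Vs {F : E' n} : F ∈ Vs n ↔ ∀ i k, wd (F (some i) k) (dk i k • F none k) 0 := Iff.rfl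

lemma isClosed_Vs : IsClosed (Vs n : Set (E' n)) := by
  have : (Vs n : Set (E' n)) = ⋂ (i : Fin n) (k : Fin n → ℤ) (a : ℝ) (_ : a ≤ 0),
      {F : E' n | inner ℂ (chi a) (cmp (some i) k F) + inner ℂ (pp a) (dk i k • cmp none k F) = 0} := by
    ext F
    simp only [SetLike.mem_coe, mem_Vs, Set.mem_iInter, Set.mem_ofPred_eq, wd, mul_zero, cmp_apply]
  rw [this]
  refine isClosed_iInter fun i => isClosed_iInter fun k => isClosed_iInter fun a =>
    isClosed_iInter fun _ => isClosed_eq ?_ continuous_const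
  exact (Continuous.inner continuous_const (cmp (some i) k).continuous).add
    (Continuous.inner continuous_const ((cmp none k).continuous.const_smul (dk i k)))

instance : CompleteSpace (Vs n) := isClosed_Vs.completeSpace_coe

instance : (Vs n).HasOrthogonalProjection := inferInstance

lemma conj_dk (i : Fin n) (k : Fin n → ℤ) : (starRingEnd ℂ) (dk i k) = - dk i k := by
  have : dk i k = ((2 * Real.pi * (k i : ℝ) : ℝ) : ℂ) * Complex.I := by
    rw [dk]; push_cast; ring
  rw [this, map_mul, Complex.conj_ofReal, Complex.conj_I, mul_neg]

/-- trace of the vertical component -/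
def trk (M : E' n) (k : Fin n → ℤ) : ℂ := tr (M none k) (-∑ i, dk i k • M (some i) k)

lemma inner_E (F G : E' n) : inner ℂ F G =
    inner ℂ (F none) (G none) + ∑ i, inner ℂ (F (some i)) (G (some i)) := by
  rw [PiLp.inner_apply, Fintype.sum_option]

/-- test fields -/
def testE (k : Fin n → ℤ) (f g : LL) : E' n :=
  inj none (lp.single 2 k g) + ∑ i, inj (some i) (lp.single 2 k (dk i k • f))

lemma testE_none (k : Fin n → ℤ) (f g : LL) : testE k f g none = lp.single 2 k g := by
  simp [testE, E_sum_apply, inj_apply]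

lemma testE_some (k : Fin n → ℤ) (f g : LL) (i) :
    testE k f g (some i) = lp.single 2 k (dk i k • f) := by
  simp [testE, E_sum_apply, inj_apply]

lemma testE_mem (k : Fin n → ℤ) {f g : LL} (h : wd f g 0) : testE k f g ∈ Vs n := by
  intro i k'
  rw [testE_none, testE_some, lp.single_apply, lp.single_apply]
  by_cases hk : k' = k
  · subst hk
    have := h.smul (dk i k')
    simpa using this
  · rw [Pi.single_eq_of_ne hk, Pi.single_eq_of_ne hk, smul_zero]
    exact wd_zero

lemma wd_of_orth {M : E' n} (h : PV (Vs n) M = 0) (k : Fin n → ℤ) :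
    wd (M none k) (-∑ i, dk i k • M (some i) k) (trk M k) := by
  intro a ha
  have h0 : wd (pp a + (a:ℂ) • pp (-1)) (chi a + (a:ℂ) • chi (-1)) 0 := by
    have := (wd_pp ha).add ((wd_pp (a := -1) (by norm_num)).smul (a:ℂ))
    simpa using this
  have h1 := (Submodule.mem_orthogonal _ _).1
    ((Submodule.starProjection_apply_eq_zero_iff (K := Vs n)).1 h) _ (testE_mem k h0)
  rw [inner_E, testE_none, lp.inner_single_left] at h1
  simp only [testE_some, lp.inner_single_left] at h1
  simp only [inner_smul_left, inner_add_left, conj_dk, Complex.conj_ofReal] at h1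
  rw [trk, tr]
  simp only [inner_neg_right, inner_sum, inner_smul_right]
  have e : ∑ i, -dk i k * (inner ℂ (pp a) (M (some i) k) + a * inner ℂ (pp (-1)) (M (some i) k))
      = - ∑ i, dk i k * inner ℂ (pp a) (M (some i) k)
        - a * ∑ i, dk i k * inner ℂ (pp (-1)) (M (some i) k) := by
    rw [Finset.mul_sum, ← Finset.sum_neg_distrib, ← Finset.sum_sub_distrib]
    exact Finset.sum_congr rfl fun i _ => by ring
  rw [e] at h1
  linear_combination h1

lemma orth_of_wd {M : E' n} {N : Fin n → (Fin n → ℤ) → LL} {c : Fin n → (Fin n → ℤ) → ℂ}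
    (hN : ∀ i k, wd (N i k) (M (some i) k) (c i k))
    (hM : ∀ k, M none k = -∑ i, dk i k • N i k) : PV (Vs n) M = 0 := by
  rw [Submodule.starProjection_apply_eq_zero_iff, Submodule.mem_orthogonal]
  intro G hG
  rw [inner_E]
  have h1 := inner_HH_hasSum (G none) (M none)
  have h2 := hasSum_sum (s := Finset.univ) (fun i _ => inner_HH_hasSum (G (some i)) (M (some i)))
  have h3 := h1.add h2
  refine h3.unique ?_
  convert hasSum_zero using 1
  ext k
  rw [hM, inner_neg_right, inner_sum, neg_add_eq_sub, ← Finset.sum_sub_distrib]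
  refine Finset.sum_eq_zero fun i _ => ?_
  have := (hG i k).ibp (hN i k)
  rw [inner_smul_left, conj_dk, map_zero, zero_mul] at this
  rw [inner_smul_right]
  linear_combination this

lemma Rap.summable_sq {L : Type*} [NormedAddCommGroup L] {F : (Fin n → ℤ) → L} (hF : Rap F) :
    Summable (fun k => ‖F k‖ ^ 2) := by
  have h1 := hF.summable_norm
  obtain ⟨C, hC⟩ := hF 0
  refine Summable.of_nonneg_of_le (fun _ => by positivity) (fun k => ?_) (h1.mul_left C)
  have := hC k
  rw [pow_zero, one_mul] at this
  rw [pow_two]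
  gcongr

/-- element from rapidly decreasing families -/
def mkE (F : Option (Fin n) → (Fin n → ℤ) → LL) (hF : ∀ j, Rap (F j)) : E' n :=
  WithLp.toLp 2 (fun j => HH.mk (F j) (hF j).summable_sq)

@[simp] lemma mkE_apply (F : Option (Fin n) → (Fin n → ℤ) → LL) (hF : ∀ j, Rap (F j)) (j k) :
    mkE F hF j k = F j k := rfl

lemma E_ext {F G : E' n} (h : ∀ j k, F j k = G j k) : F = G := by
  refine PiLp.ext fun j => lp.ext (funext fun k => h j k)

/-- lifting of the data -/
def psiF (ψ : (Fin n → ℤ) → ℂ) : Option (Fin n) → (Fin n → ℤ) → LL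
  | none, k => ψ k • chi (-1)
  | some i, k => (dk i k * ψ k) • pp (-1)

lemma Rap.smul_const {ψ : (Fin n → ℤ) → ℂ} (h : Rap ψ) (f : LL) : Rap (fun k => ψ k • f) := by
  refine rap_of_le h ‖f‖ 0 fun k => ?_
  rw [norm_smul]; simp [mul_comm]

lemma psiF_rap {ψ : (Fin n → ℤ) → ℂ} (h : Rap ψ) (j) : Rap (psiF ψ j) := by
  cases j with
  | none => exact h.smul_const _
  | some i => exact (h.dk_smul i).smul_const _

lemma psiF_wd (ψ : (Fin n → ℤ) → ℂ) (i : Fin n) (k) :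
    wd (psiF ψ (some i) k) (dk i k • psiF ψ none k) (dk i k * ψ k) := by
  have := (wd_pp (a := -1) (by norm_num)).smul (dk i k * ψ k)
  simpa [psiF, smul_smul] using this

end ShapeD

namespace ShapeD

variable {n : ℕ}

/-- the operator at weight level -/
def Aw (δ : ℝ) (s : ℕ) (t : Fin n → (Fin n → ℤ) → ℂ) : E' n →L[ℂ] E' n :=
  Aop (fun i => Tw δ s (t i))

/-- the basic operator -/
def A0 (t : Fin n → (Fin n → ℤ) → ℂ) : E' n →L[ℂ] E' n := Aop (fun i => Tm (t i))

/-- symmetric coefficient families -/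
structure Cf (t : Fin n → (Fin n → ℤ) → ℂ) : Prop where
  rap : ∀ i, Rap (t i)
  sym : ∀ i m, t i (-m) = (starRingEnd ℂ) (t i m)

lemma A0_unit {t : Fin n → (Fin n → ℤ) → ℂ} (ht : Cf t) : IsUnit (Bop' (Vs n) (A0 t)) :=
  Bop'_unit _ _ (fun i => inner_Tm (ht.rap i) (ht.sym i))

lemma continuous_Bop' : Continuous (fun T : Fin n → HH n LL →L[ℂ] HH n LL => Bop' (Vs n) (Aop T)) := by
  have h1 : Continuous (fun T : Fin n → HH n LL →L[ℂ] HH n LL => RT T) := by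
    unfold RT
    refine continuous_finsetSum _ fun i _ => ?_
    exact continuous_const.clm_comp ((continuous_apply i).clm_comp continuous_const)
  have h2 : Continuous (fun T : Fin n → HH n LL →L[ℂ] HH n LL => CT T) := by
    unfold CT
    refine continuous_finsetSum _ fun i _ => ?_
    exact continuous_const.clm_comp ((continuous_apply i).clm_comp continuous_const)
  unfold Bop' Aop
  exact ((continuous_const.mul ((continuous_const.sub h2).mul (continuous_const.sub h1))).mul
    continuous_const).add continuous_const

lemma exists_delta {t : Fin n → (Fin n → ℤ) → ℂ} (ht : Cf t) (s : ℕ) :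
    ∃ δ : ℝ, 0 < δ ∧ δ ≤ 1 ∧ IsUnit (Bop' (Vs n) (Aw δ s t)) := by
  have h1 : Filter.Tendsto (fun δ : ℝ => fun i => (Tw δ s (t i) : HH n LL →L[ℂ] HH n LL))
      (nhdsWithin 0 (Set.Ioi 0)) (nhds (fun i => Tm (t i))) := by
    rw [tendsto_pi_nhds]
    intro i
    rw [tendsto_iff_norm_sub_tendsto_zero]
    have h2 : Filter.Tendsto (fun δ : ℝ => δ * ∑' m, (1 + ‖m‖) ^ s * ‖t i m‖)
        (nhdsWithin 0 (Set.Ioi 0)) (nhds 0) := by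
      have : Filter.Tendsto (fun δ : ℝ => δ * ∑' m, (1 + ‖m‖) ^ s * ‖t i m‖)
        (nhds 0) (nhds (0 * ∑' m, (1 + ‖m‖) ^ s * ‖t i m‖)) :=
        Filter.Tendsto.mul_const _ Filter.tendsto_id
      rw [zero_mul] at this
      exact this.mono_left nhdsWithin_le_nhds
    refine squeeze_zero' (Filter.Eventually.of_forall fun _ => norm_nonneg _) ?_ h2
    have : Set.Ioc (0:ℝ) 1 ∈ nhdsWithin (0:ℝ) (Set.Ioi 0) := Ioc_mem_nhdsGT one_pos
    filter_upwards [this] with δ hδ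
    exact Tw_sub_Tm (ht.rap i) s hδ.1.le hδ.2
  have h3 := (continuous_Bop'.tendsto _).comp h1
  have h4 := h3.eventually (Units.isOpen.mem_nhds (A0_unit ht))
  have h5 : Set.Ioc (0:ℝ) 1 ∈ nhdsWithin (0:ℝ) (Set.Ioi 0) := Ioc_mem_nhdsGT one_pos
  obtain ⟨δ, h6, h7⟩ := (h4.and h5).exists
  exact ⟨δ, h7.1, h7.2, h6⟩

lemma mapJ_apply {δ : ℝ} (hδ : 0 ≤ δ) (s : ℕ) (F : E' n) (j k) :
    mapE (Jw δ s) F j k = ((((wt δ k) ^ s)⁻¹ : ℝ) : ℂ) • F j k := by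
  rw [mapE_apply, Jw_apply hδ]

lemma mapJ_mem {δ : ℝ} (hδ : 0 ≤ δ) (s : ℕ) {F : E' n} (hF : F ∈ Vs n) :
    mapE (Jw δ s) F ∈ Vs n := by
  intro i k
  rw [mapJ_apply hδ, mapJ_apply hδ, smul_comm]
  simpa using (hF i k).smul ((((wt δ k) ^ s)⁻¹ : ℝ) : ℂ)

lemma mapJ_PV {δ : ℝ} (hδ : 0 ≤ δ) (s : ℕ) (F : E' n) :
    mapE (Jw δ s) (PV (Vs n) F) = PV (Vs n) (mapE (Jw δ s) F) :=
  mapE_comm (Vs n) _ (inner_Jw hδ s) (fun _ h => mapJ_mem hδ s h) F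

lemma mapJ_Aw {t : Fin n → (Fin n → ℤ) → ℂ} (ht : ∀ i, Rap (t i)) {δ : ℝ} (hδ : 0 ≤ δ) (hδ1 : δ ≤ 1)
    (s : ℕ) (F : E' n) : mapE (Jw δ s) (Aw δ s t F) = A0 t (mapE (Jw δ s) F) :=
  mapE_Aop _ _ _ (fun i x => Jw_Tw (ht i) hδ hδ1 s x) F

/-- weighted data -/
def wps (δ : ℝ) (s : ℕ) (ψ : (Fin n → ℤ) → ℂ) (k : Fin n → ℤ) : ℂ := (((wt δ k) ^ s : ℝ) : ℂ) * ψ k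

lemma wps_rap {δ : ℝ} (hδ : 0 ≤ δ) (hδ1 : δ ≤ 1) (s : ℕ) {ψ : (Fin n → ℤ) → ℂ} (h : Rap ψ) :
    Rap (wps δ s ψ) := by
  refine rap_of_le h 1 s fun k => ?_
  have h2 : wt δ k ≤ 1 + ‖k‖ := by unfold wt; nlinarith [norm_nonneg k]
  have h3 := wt_pos hδ k
  rw [wps, norm_mul, Complex.norm_real, Real.norm_of_nonneg (by positivity), one_mul]
  gcongr

/-- data field -/
def Ps (ψ : (Fin n → ℤ) → ℂ) (h : Rap ψ) : E' n := mkE (psiF ψ) (psiF_rap h)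

lemma mapJ_Ps {δ : ℝ} (hδ : 0 ≤ δ) (hδ1 : δ ≤ 1) (s : ℕ) {ψ : (Fin n → ℤ) → ℂ} (h : Rap ψ) :
    mapE (Jw δ s) (Ps (wps δ s ψ) (wps_rap hδ hδ1 s h)) = Ps ψ h := by
  refine E_ext fun j k => ?_
  rw [mapJ_apply hδ, Ps, Ps, mkE_apply, mkE_apply]
  have h3 : ((wt δ k : ℝ) : ℂ) ^ s ≠ 0 := pow_ne_zero _ (by exact_mod_cast (wt_pos hδ k).ne')
  cases j with
  | none =>
    simp only [psiF, wps, smul_smul]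
    congr 1
    push_cast
    field_simp
  | some i =>
    simp only [psiF, wps, smul_smul]
    congr 1
    push_cast
    field_simp

/-- the solution -/
def Fsol (A : E' n →L[ℂ] E' n) (Ψ : E' n) : E' n := Ψ - Gsol (Vs n) A Ψ

lemma Fsol_orth {A : E' n →L[ℂ] E' n} (hA : IsUnit (Bop' (Vs n) A)) (Ψ : E' n) :
    PV (Vs n) (A (Fsol A Ψ)) = 0 := Gsol_orth _ hA Ψ

lemma Fsol_mem {A : E' n →L[ℂ] E' n} (hA : IsUnit (Bop' (Vs n) A)) (Ψ : E' n) :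
    Ψ - Fsol A Ψ ∈ Vs n := by
  rw [Fsol, sub_sub_cancel, ← Gsol_mem (Vs n) hA Ψ]
  exact Submodule.starProjection_apply_mem _ _

lemma Fsol_transfer {t : Fin n → (Fin n → ℤ) → ℂ} (ht : Cf t) {δ : ℝ} (hδ : 0 ≤ δ) (hδ1 : δ ≤ 1)
    {s : ℕ} (hs : IsUnit (Bop' (Vs n) (Aw δ s t))) {ψ : (Fin n → ℤ) → ℂ} (h : Rap ψ) :
    mapE (Jw δ s) (Fsol (Aw δ s t) (Ps (wps δ s ψ) (wps_rap hδ hδ1 s h))) = Fsol (A0 t) (Ps ψ h) := by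
  rw [Fsol, Fsol, map_sub, mapJ_Ps hδ hδ1,
    Gsol_transfer (Vs n) (A0_unit ht) hs (mapJ_Aw ht.rap hδ hδ1 s) (mapJ_PV hδ s), mapJ_Ps hδ hδ1]

lemma E_comp_le (F : E' n) (j k) : ‖F j k‖ ≤ ‖F‖ :=
  (lp.norm_apply_le_norm (by norm_num) (F j) k).trans (PiLp.norm_apply_le F j)

lemma Fsol_rap {t : Fin n → (Fin n → ℤ) → ℂ} (ht : Cf t) {ψ : (Fin n → ℤ) → ℂ} (h : Rap ψ) (j) :
    Rap (fun k => Fsol (A0 t) (Ps ψ h) j k) := by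
  intro s
  obtain ⟨δ, hδ, hδ1, hu⟩ := exists_delta ht s
  set Fs := Fsol (Aw δ s t) (Ps (wps δ s ψ) (wps_rap hδ.le hδ1 s h)) with hFs
  refine ⟨(δ ^ s)⁻¹ * ‖Fs‖, fun k => ?_⟩
  show (1 + ‖k‖) ^ s * ‖Fsol (A0 t) (Ps ψ h) j k‖ ≤ _
  rw [← Fsol_transfer ht hδ.le hδ1 hu h, mapJ_apply hδ.le, norm_smul, Complex.norm_real,
    Real.norm_of_nonneg (by have := wt_pos hδ.le k; positivity), ← mul_assoc]
  gcongr ?_ * ?_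
  · have h2 : δ * (1 + ‖k‖) ≤ wt δ k := by unfold wt; nlinarith [norm_nonneg k]
    have h3 := wt_pos hδ.le k
    rw [← div_eq_mul_inv, div_le_iff₀ (by positivity), inv_mul_eq_div, le_div_iff₀ (by positivity),
      ← mul_pow, mul_comm]
    gcongr
  · exact E_comp_le Fs j k

/-- Weak solutions with all the information. -/
structure Sol (t : Fin n → (Fin n → ℤ) → ℂ) (ψ c : (Fin n → ℤ) → ℂ) (F : Fin n → (Fin n → ℤ) → LL)
    (b : (Fin n → ℤ) → LL) : Prop where
  rapF : ∀ i, Rap (F i)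
  rapb : Rap b
  wdF : ∀ i k, wd (F i k) (dk i k • b k) (dk i k * ψ k)
  wdq : ∀ k, wd (b k - ∑ i, conv (t i) (fun k => F i k - conv (t i) b k) k)
    (-∑ i, dk i k • (F i k - conv (t i) b k)) (c k)

lemma A0_some {t : Fin n → (Fin n → ℤ) → ℂ} (ht : ∀ i, Rap (t i)) (F : E' n) (i k) :
    A0 t F (some i) k = F (some i) k - conv (t i) (fun k => F none k) k := by
  rw [A0, Aop_some]
  show F (some i) k - Tm (t i) (F none) k = _
  rw [Tm_apply (ht i)]

lemma HH_sum_apply {ι : Type*} (s : Finset ι) (f : ι → HH n LL) (k) :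
    (∑ i ∈ s, f i) k = ∑ i ∈ s, f i k := by
  have := map_sum (evk (L := LL) k) f s
  exact this

lemma A0_none {t : Fin n → (Fin n → ℤ) → ℂ} (ht : ∀ i, Rap (t i)) (F : E' n) (k) :
    A0 t F none k = F none k -
      ∑ i, conv (t i) (fun k => F (some i) k - conv (t i) (fun k => F none k) k) k := by
  have h1 : A0 t F none k = F none k - (∑ i, Tm (t i) (A0 t F (some i))) k := by
    simp only [A0, Aop_some]
    rw [Aop_none]
    rfl
  rw [h1, HH_sum_apply]
  congr 1
  refine Finset.sum_congr rfl fun i _ => ?_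
  rw [Tm_apply (ht i)]
  congr 1
  ext1 k
  rw [A0_some ht]

lemma exists_Sol {t : Fin n → (Fin n → ℤ) → ℂ} (ht : Cf t) {ψ : (Fin n → ℤ) → ℂ} (h : Rap ψ) :
    Sol t ψ (trk (A0 t (Fsol (A0 t) (Ps ψ h)))) (fun i k => Fsol (A0 t) (Ps ψ h) (some i) k)
      (fun k => Fsol (A0 t) (Ps ψ h) none k) := by
  set F := Fsol (A0 t) (Ps ψ h) with hF
  refine ⟨fun i => Fsol_rap ht h _, Fsol_rap ht h _, fun i k => ?_, fun k => ?_⟩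
  · have h1 := (psiF_wd ψ i k).sub (Fsol_mem (A0_unit ht) (Ps ψ h) i k)
    rw [← hF, ← smul_sub, sub_zero] at h1
    have e : ∀ j, psiF ψ j k - (Ps ψ h - F) j k = F j k := by
      intro j
      show psiF ψ j k - (psiF ψ j k - F j k) = _
      rw [sub_sub_cancel]
    rwa [e, e] at h1
  · have h1 := wd_of_orth (Fsol_orth (A0_unit ht) (Ps ψ h)) k
    rw [← hF, A0_none ht.rap] at h1
    simp only [A0_some ht.rap] at h1
    exact h1

lemma Rap.tr {f g : (Fin n → ℤ) → LL} (hf : Rap f) (hg : Rap g) : Rap (fun k => tr (f k) (g k)) := by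
  unfold ShapeD.tr
  have h1 := hf.map (innerSL ℂ (chi (-1)))
  have h2 := hg.map (innerSL ℂ (pp (-1)))
  exact h1.add h2

end ShapeD

namespace ShapeD

variable {n : ℕ}

section generic
variable {G : Type*} [NormedAddCommGroup G] [NormedSpace ℂ G] [CompleteSpace G]
variable (t : Fin n → (Fin n → ℤ) → ℂ) (μ : (Fin n → ℤ) → ℂ)

/-- recover the vertical derivative -/
def bOf (Y : Option (Fin n) → (Fin n → ℤ) → G) : (Fin n → ℤ) → G :=
  conv μ (fun k => Y none k + ∑ i, conv (t i) (Y (some i)) k)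

/-- vertical derivative of the state -/
def stp (Y : Option (Fin n) → (Fin n → ℤ) → G) : Option (Fin n) → (Fin n → ℤ) → G
  | none, k => -∑ i, dk i k • (Y (some i) k - conv (t i) (bOf t μ Y) k)
  | some i, k => dk i k • bOf t μ Y k

variable {t μ} (ht : ∀ i, Rap (t i)) (hμ : Rap μ)
include ht hμ

lemma bOf_rap0 {Y : Option (Fin n) → (Fin n → ℤ) → G} (hY : ∀ j, Rap (Y j)) :
    Rap (fun k => Y none k + ∑ i, conv (t i) (Y (some i)) k) :=
  (hY none).add (Rap.sum _ fun i _ => (ht i).conv (hY _))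

lemma bOf_rap {Y : Option (Fin n) → (Fin n → ℤ) → G} (hY : ∀ j, Rap (Y j)) : Rap (bOf t μ Y) :=
  hμ.conv (bOf_rap0 ht hμ hY)

lemma stp_rap {Y : Option (Fin n) → (Fin n → ℤ) → G} (hY : ∀ j, Rap (Y j)) (j) :
    Rap (stp t μ Y j) := by
  cases j with
  | none =>
    exact (Rap.sum _ fun i _ => ((hY _).sub ((ht i).conv (bOf_rap ht hμ hY))).dk_smul i).neg
  | some i => exact (bOf_rap ht hμ hY).dk_smul i

lemma bOf_map {G' : Type*} [NormedAddCommGroup G'] [NormedSpace ℂ G'] (ℓ : G →L[ℂ] G')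
    {Y : Option (Fin n) → (Fin n → ℤ) → G} (hY : ∀ j, Rap (Y j)) (k) :
    ℓ (bOf t μ Y k) = bOf t μ (fun j k => ℓ (Y j k)) k := by
  rw [bOf, bOf, map_conv ℓ hμ (bOf_rap0 ht hμ hY)]
  congr 1
  ext1 k
  rw [map_add, map_sum]
  congr 1
  exact Finset.sum_congr rfl fun i _ => map_conv ℓ (ht i) (hY _) k

lemma stp_map {G' : Type*} [NormedAddCommGroup G'] [NormedSpace ℂ G'] (ℓ : G →L[ℂ] G')
    {Y : Option (Fin n) → (Fin n → ℤ) → G} (hY : ∀ j, Rap (Y j)) (j k) :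
    ℓ (stp t μ Y j k) = stp t μ (fun j k => ℓ (Y j k)) j k := by
  cases j with
  | none =>
    simp only [stp]
    rw [map_neg, map_sum]
    congr 1
    refine Finset.sum_congr rfl fun i _ => ?_
    rw [map_smul, map_sub, map_conv ℓ (ht i) (bOf_rap ht hμ hY)]
    congr 3
    ext1 k
    exact bOf_map ht hμ ℓ hY k
  | some i =>
    simp only [stp]
    rw [map_smul, bOf_map ht hμ ℓ hY]

lemma bOf_sub {Y Y' : Option (Fin n) → (Fin n → ℤ) → G} (hY : ∀ j, Rap (Y j)) (hY' : ∀ j, Rap (Y' j))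
    (k) : bOf t μ (fun j k => Y j k - Y' j k) k = bOf t μ Y k - bOf t μ Y' k := by
  rw [bOf, bOf, bOf, ← conv_sub hμ (bOf_rap0 ht hμ hY) (bOf_rap0 ht hμ hY')]
  congr 1
  ext1 k
  rw [add_sub_add_comm, ← Finset.sum_sub_distrib]
  congr 1
  exact Finset.sum_congr rfl fun i _ => conv_sub (ht i) (hY _) (hY' _) k

lemma stp_sub {Y Y' : Option (Fin n) → (Fin n → ℤ) → G} (hY : ∀ j, Rap (Y j)) (hY' : ∀ j, Rap (Y' j))
    (j k) : stp t μ (fun j k => Y j k - Y' j k) j k = stp t μ Y j k - stp t μ Y' j k := by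
  have hb : bOf t μ (fun j k => Y j k - Y' j k) = fun k => bOf t μ Y k - bOf t μ Y' k :=
    funext fun k => bOf_sub ht hμ hY hY' k
  cases j with
  | none =>
    simp only [stp, hb]
    rw [← neg_sub', ← Finset.sum_sub_distrib]
    congr 1
    refine Finset.sum_congr rfl fun i _ => ?_
    rw [conv_sub (ht i) (bOf_rap ht hμ hY) (bOf_rap ht hμ hY'), ← smul_sub]
    congr 1
    abel
  | some i =>
    simp only [stp, hb]
    rw [smul_sub]

end generic

lemma wd_conv {t : (Fin n → ℤ) → ℂ} (ht : Rap t) {f g : (Fin n → ℤ) → LL} {c : (Fin n → ℤ) → ℂ}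
    (hf : Rap f) (hg : Rap g) (hc : Rap c) (h : ∀ k, wd (f k) (g k) (c k)) (k) :
    wd (conv t f k) (conv t g k) (conv t c k) :=
  wd.hasSum (fun m => (h (k - m)).smul (t m)) (conv_summable ht hf k).hasSum
    (conv_summable ht hg k).hasSum (conv_summable ht hc k).hasSum

section wdchain
variable {t : Fin n → (Fin n → ℤ) → ℂ} {μ : (Fin n → ℤ) → ℂ} (ht : ∀ i, Rap (t i)) (hμ : Rap μ)
variable {Y Y' : Option (Fin n) → (Fin n → ℤ) → LL} {c : Option (Fin n) → (Fin n → ℤ) → ℂ}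
include ht hμ

lemma bOf_wd (hY : ∀ j, Rap (Y j)) (hY' : ∀ j, Rap (Y' j)) (hc : ∀ j, Rap (c j))
    (h : ∀ j k, wd (Y j k) (Y' j k) (c j k)) (k) :
    wd (bOf t μ Y k) (bOf t μ Y' k) (bOf t μ c k) := by
  refine wd_conv hμ (bOf_rap0 ht hμ hY) (bOf_rap0 ht hμ hY') (bOf_rap0 ht hμ hc) (fun k => ?_) k
  exact (h none k).add (wd.sum _ fun i _ => wd_conv (ht i) (hY _) (hY' _) (hc _) (h _) k)

lemma stp_wd (hY : ∀ j, Rap (Y j)) (hY' : ∀ j, Rap (Y' j)) (hc : ∀ j, Rap (c j))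
    (h : ∀ j k, wd (Y j k) (Y' j k) (c j k)) (j k) :
    wd (stp t μ Y j k) (stp t μ Y' j k) (stp t μ c j k) := by
  cases j with
  | none =>
    refine (wd.sum _ fun i _ => ((h _ k).sub ?_).smul _).neg
    exact wd_conv (ht i) (bOf_rap ht hμ hY) (bOf_rap ht hμ hY') (bOf_rap ht hμ hc)
      (bOf_wd ht hμ hY hY' hc h) k
  | some i => exact (bOf_wd ht hμ hY hY' hc h k).smul _

omit hμ in
lemma iter_rap {G : Type*} [NormedAddCommGroup G] [NormedSpace ℂ G] [CompleteSpace G] (hμ : Rap μ)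
    {Y : Option (Fin n) → (Fin n → ℤ) → G} (hY : ∀ j, Rap (Y j)) (l : ℕ) (j) :
    Rap ((stp t μ)^[l] Y j) := by
  induction l generalizing j with
  | zero => exact hY j
  | succ l ih =>
    rw [Function.iterate_succ', Function.comp_apply]
    exact stp_rap ht hμ ih j

lemma iter_wd (hY : ∀ j, Rap (Y j)) (hc : ∀ j, Rap (c j))
    (h : ∀ j k, wd (Y j k) (stp t μ Y j k) (c j k)) (l : ℕ) (j k) :
    wd ((stp t μ)^[l] Y j k) ((stp t μ)^[l+1] Y j k) ((stp t μ)^[l] c j k) := by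
  induction l generalizing j k with
  | zero => exact h j k
  | succ l ih =>
    have := stp_wd ht hμ (iter_rap ht hμ hY l) (iter_rap ht hμ hY (l+1)) (iter_rap ht hμ hc l) ih j k
    rw [← Function.comp_apply (f := stp t μ), ← Function.comp_apply (f := stp t μ),
      ← Function.comp_apply (f := stp t μ)] at this
    simpa only [← Function.iterate_succ'] using this

end wdchain

/-- the delta family -/
def del (k : Fin n → ℤ) : ℂ := if k = 0 then 1 else 0

lemma del_rap : Rap (del : (Fin n → ℤ) → ℂ) := by
  intro N
  refine ⟨1, fun k => ?_⟩
  by_cases h : k = 0 <;> simp [del, h]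

/-- `μ` is the inverse of `1 + ∑ tᵢ²`. -/
structure IsInv (t : Fin n → (Fin n → ℤ) → ℂ) (μ : (Fin n → ℤ) → ℂ) : Prop where
  rap : Rap μ
  inv : conv μ (fun k => del k + ∑ i, conv (t i) (t i) k) = del

section
variable {G : Type*} [NormedAddCommGroup G] [NormedSpace ℂ G] [CompleteSpace G]
lemma conv_add_left {t s : (Fin n → ℤ) → ℂ} (ht : Rap t) (hs : Rap s) {F : (Fin n → ℤ) → G}
    (hF : Rap F) (k) : conv (fun k => t k + s k) F k = conv t F k + conv s F k := by
  rw [conv, conv, conv, ← (conv_summable ht hF k).tsum_add (conv_summable hs hF k)]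
  exact tsum_congr fun m => add_smul _ _ _

lemma conv_sum_left {ι : Type*} (S : Finset ι) {t : ι → (Fin n → ℤ) → ℂ} (ht : ∀ i, Rap (t i))
    {F : (Fin n → ℤ) → G} (hF : Rap F) (k) :
    conv (fun k => ∑ i ∈ S, t i k) F k = ∑ i ∈ S, conv (t i) F k := by
  unfold conv
  rw [← Summable.tsum_finsetSum fun i _ => conv_summable (ht i) hF k]
  exact tsum_congr fun m => Finset.sum_smul

lemma conv_del (F : (Fin n → ℤ) → G) : conv del F = F := conv_one F

lemma conv_rho {t : Fin n → (Fin n → ℤ) → ℂ} (ht : ∀ i, Rap (t i)) {F : (Fin n → ℤ) → G}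
    (hF : Rap F) (k) : conv (fun k => del k + ∑ i, conv (t i) (t i) k) F k =
      F k + ∑ i, conv (t i) (conv (t i) F) k := by
  rw [conv_add_left del_rap (Rap.sum _ fun i _ => (ht i).conv (ht i)) hF, conv_del,
    conv_sum_left _ (fun i => (ht i).conv (ht i)) hF]
  congr 1
  exact Finset.sum_congr rfl fun i _ => (conv_conv (ht i) (ht i) hF k).symm

lemma rho_rap {t : Fin n → (Fin n → ℤ) → ℂ} (ht : ∀ i, Rap (t i)) :
    Rap (fun k => del k + ∑ i, conv (t i) (t i) k) :=
  del_rap.add (Rap.sum _ fun i _ => (ht i).conv (ht i))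

lemma IsInv.left {t : Fin n → (Fin n → ℤ) → ℂ} {μ : (Fin n → ℤ) → ℂ} (h : IsInv t μ)
    (ht : ∀ i, Rap (t i)) {F : (Fin n → ℤ) → G} (hF : Rap F) :
    conv μ (fun k => F k + ∑ i, conv (t i) (conv (t i) F) k) = F := by
  have : (fun k => F k + ∑ i, conv (t i) (conv (t i) F) k) =
      conv (fun k => del k + ∑ i, conv (t i) (t i) k) F := funext fun k => (conv_rho ht hF k).symm
  ext1 k
  rw [this, conv_conv h.rap (rho_rap ht) hF, h.inv, conv_del]

lemma IsInv.right {t : Fin n → (Fin n → ℤ) → ℂ} {μ : (Fin n → ℤ) → ℂ} (h : IsInv t μ)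
    (ht : ∀ i, Rap (t i)) {F : (Fin n → ℤ) → G} (hF : Rap F) (k) :
    conv μ F k + ∑ i, conv (t i) (conv (t i) (conv μ F)) k = F k := by
  rw [← conv_rho ht (h.rap.conv hF), conv_swap (rho_rap ht) h.rap hF,
    conv_conv h.rap (rho_rap ht) hF, h.inv, conv_del]

end

/-- Fourier modes of a solution -/
structure Modes (t : Fin n → (Fin n → ℤ) → ℂ) (ψ c : (Fin n → ℤ) → ℂ) (F : Fin n → (Fin n → ℤ) → LL)
    (b b1 : (Fin n → ℤ) → LL) (U : ℕ → (Fin n → ℤ) → ℝ → ℂ) : Prop where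
  deriv : ∀ j k z, z ≤ 0 → HasDerivWithinAt (U j k) (U (j+1) k z) (Set.Iic 0) z
  bound : ∀ j N, ∃ C, ∀ k z, z ≤ 0 → (1 + ‖k‖) ^ N * ‖U j k z‖ ≤ C * (1 + |z|)
  bc : ∀ k, U 0 k 0 = ψ k
  pde : ∀ z, z ≤ 0 → ∀ k, U 2 k z + ∑ i, conv (t i) (conv (t i) (fun k => U 2 k z)) k =
    -∑ i, dk i k * (dk i k * U 0 k z - conv (t i) (fun k => U 1 k z) k) +
      ∑ i, conv (t i) (fun k => dk i k * U 1 k z) k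
  neu : ∀ k, U 1 k 0 - ∑ i, conv (t i) (fun k => dk i k * ψ k - conv (t i) (fun k => U 1 k 0) k) k = c k
  rapF : ∀ i, Rap (F i)
  rapb : Rap b
  rapb1 : Rap b1
  l2b : ∀ k, ∀ᵐ z : ℝ, z ≤ 0 → b k z = U 1 k z
  l2F : ∀ i k, ∀ᵐ z : ℝ, z ≤ 0 → F i k z = dk i k * U 0 k z
  wdF : ∀ i k, wd (F i k) (dk i k • b k) (dk i k * ψ k)
  wdb : ∀ k, wd (b k) (b1 k) (U 1 k 0)

/-- the initial state -/
def st0 {G : Type*} (F : Fin n → (Fin n → ℤ) → G) (q : (Fin n → ℤ) → G) :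
    Option (Fin n) → (Fin n → ℤ) → G
  | none => q
  | some i => F i

lemma hatf_smul (r : ℂ) (g : LL) (c : ℂ) (z : ℝ) : hatf (r • g) (r * c) z = r * hatf g c z := by
  simp only [hatf, inner_smul_right]; ring

lemma hatf_rap {g : (Fin n → ℤ) → LL} {c : (Fin n → ℤ) → ℂ} (hg : Rap g) (hc : Rap c) (N : ℕ) :
    ∃ C, ∀ k z, z ≤ 0 → (1 + ‖k‖) ^ N * ‖hatf (g k) (c k) z‖ ≤ C * (1 + |z|) := by
  obtain ⟨C, hC⟩ := hg N
  obtain ⟨C', hC'⟩ := hc N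
  refine ⟨C' + C, fun k z hz => ?_⟩
  have h1 := norm_hatf_le (g k) (c k) hz
  have h2 := hC k
  have h3 := hC' k
  have h4 : 0 ≤ C' := le_trans (by positivity) h3
  calc (1 + ‖k‖) ^ N * ‖hatf (g k) (c k) z‖ ≤ (1 + ‖k‖) ^ N * (‖c k‖ + (1 + |z|) * ‖g k‖) := by gcongr
    _ = (1 + ‖k‖) ^ N * ‖c k‖ + (1 + |z|) * ((1 + ‖k‖) ^ N * ‖g k‖) := by ring
    _ ≤ C' + (1 + |z|) * C := by gcongr
    _ ≤ _ := by nlinarith [abs_nonneg z]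

lemma exists_Modes {t : Fin n → (Fin n → ℤ) → ℂ} {μ : (Fin n → ℤ) → ℂ} (ht : ∀ i, Rap (t i))
    (hμ : IsInv t μ) {ψ c : (Fin n → ℤ) → ℂ} (hψ : Rap ψ) {F : Fin n → (Fin n → ℤ) → LL}
    {b : (Fin n → ℤ) → LL} (S : Sol t ψ c F b) :
    ∃ b1 U, Modes t ψ c F b b1 U := by
  set m : Fin n → (Fin n → ℤ) → LL := fun i k => F i k - conv (t i) b k with hm
  have hmr : ∀ i, Rap (m i) := fun i => (S.rapF i).sub ((ht i).conv S.rapb)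
  set q : (Fin n → ℤ) → LL := fun k => b k - ∑ i, conv (t i) (m i) k with hq
  have hqr : Rap q := S.rapb.sub (Rap.sum _ fun i _ => (ht i).conv (hmr i))
  set Y := st0 F q with hY
  set c0 := st0 (fun i k => dk i k * ψ k) c with hc0
  have hYr : ∀ j, Rap (Y j) := by rintro (_ | i); exacts [hqr, S.rapF i]
  have hcr : Rap c := by
    have h1 : c = fun k => tr (q k) (-∑ i, dk i k • m i k) := funext fun k => (S.wdq k).tr.symm
    rw [h1]
    exact hqr.tr (Rap.sum _ fun i _ => (hmr i).dk_smul i).neg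
  have hc0r : ∀ j, Rap (c0 j) := by rintro (_ | i); exacts [hcr, hψ.dk_smul i]
  have hb0 : bOf t μ Y = b := by
    refine Eq.trans ?_ (hμ.left ht S.rapb)
    rw [bOf]
    congr 1
    ext1 k
    show b k - ∑ i, conv (t i) (m i) k + ∑ i, conv (t i) (F i) k = _
    rw [sub_add, ← Finset.sum_sub_distrib, sub_eq_add_neg, ← Finset.sum_neg_distrib]
    congr 1
    refine Finset.sum_congr rfl fun i _ => ?_
    rw [hm, conv_sub (ht i) (S.rapF i) ((ht i).conv S.rapb)]
    abel
  have hwd0 : ∀ j k, wd (Y j k) (stp t μ Y j k) (c0 j k) := by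
    rintro (_ | i) k
    · simp only [stp, hb0]; exact S.wdq k
    · simp only [stp, hb0]; exact S.wdF i k
  have hwd := iter_wd ht hμ.rap hYr hc0r hwd0
  have hYi := iter_rap ht hμ.rap hYr
  have hci := iter_rap ht hμ.rap hc0r
  set B : ℕ → (Fin n → ℤ) → LL := fun l => bOf t μ ((stp t μ)^[l] Y) with hB
  set Γ : ℕ → (Fin n → ℤ) → ℂ := fun l => bOf t μ ((stp t μ)^[l] c0) with hΓ
  have hBr : ∀ l, Rap (B l) := fun l => bOf_rap ht hμ.rap (hYi l)
  have hΓr : ∀ l, Rap (Γ l) := fun l => bOf_rap ht hμ.rap (hci l)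
  have hBwd : ∀ l k, wd (B l k) (B (l+1) k) (Γ l k) := fun l k =>
    bOf_wd ht hμ.rap (hYi l) (hYi (l+1)) (hci l) (hwd l) k
  have hB0 : B 0 = b := hb0
  set U : ℕ → (Fin n → ℤ) → ℝ → ℂ := fun l => match l with
    | 0 => fun k => hatf (B 0 k) (ψ k)
    | l+1 => fun k => hatf (B (l+1) k) (Γ l k) with hU
  -- pointwise states
  set Yh : ℕ → ℝ → Option (Fin n) → (Fin n → ℤ) → ℂ := fun l z j k =>
    (stp t μ)^[l] c0 j k - innerSL ℂ (chi z) ((stp t μ)^[l+1] Y j k) with hYh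
  have hYhr : ∀ l z j, Rap (Yh l z j) := fun l z j => (hci l j).sub ((hYi (l+1) j).map _)
  have hUb : ∀ l z, bOf t μ (Yh l z) = fun k => U (l+1) k z := by
    intro l z
    ext1 k
    rw [hYh]
    simp only
    rw [bOf_sub ht hμ.rap (hci l) (fun j => (hYi (l+1) j).map _), ← bOf_map ht hμ.rap _ (hYi (l+1))]
    rfl
  have hYs : ∀ l z, Yh (l+1) z = stp t μ (Yh l z) := by
    intro l z
    ext j k
    rw [hYh]
    simp only
    rw [stp_sub ht hμ.rap (hci l) (fun j => (hYi (l+1) j).map _), ← stp_map ht hμ.rap _ (hYi (l+1)),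
      Function.iterate_succ' _ l, Function.iterate_succ' _ (l+1)]
    rfl
  have hY0i : ∀ z i k, Yh 0 z (some i) k = dk i k * U 0 k z := by
    intro z i k
    show dk i k * ψ k - inner ℂ (chi z) (dk i k • bOf t μ Y k) = dk i k * (ψ k - inner ℂ (chi z) (bOf t μ Y k))
    rw [inner_smul_right, mul_sub]
  refine ⟨B 1, U, ?_, ?_, ?_, ?_, ?_, S.rapF, S.rapb, hBr 1, ?_, ?_, S.wdF, ?_⟩
  · intro j k z hz
    cases j with
    | zero => exact (hBwd 0 k).hatf_deriv hz
    | succ l => exact (hBwd (l+1) k).hatf_deriv hz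
  · intro j N
    cases j with
    | zero => exact hatf_rap (hBr 0) hψ N
    | succ l => exact hatf_rap (hBr (l+1)) (hΓr l) N
  · intro k; exact hatf_zero _ _
  · intro z hz k
    have h1 := hUb 1 z
    have h1' : U 2 k z = bOf t μ (Yh 1 z) k := (congrFun h1 k).symm
    rw [h1', ← h1, bOf, hμ.right ht (bOf_rap0 ht hμ.rap (hYhr 1 z)), hYs 0 z]
    have h2 : stp t μ (Yh 0 z) none k =
        -∑ i, dk i k • (Yh 0 z (some i) k - conv (t i) (bOf t μ (Yh 0 z)) k) := rfl
    have h3 : ∀ i, stp t μ (Yh 0 z) (some i) = fun k => dk i k • bOf t μ (Yh 0 z) k := fun i => rfl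
    rw [h2, hUb 0 z]
    simp only [h3, hUb 0 z, hY0i, smul_eq_mul]
  · intro k
    have h0 : Yh 0 0 = c0 := by
      ext j k
      simp [hYh, chi_zero]
    have h1 := hUb 0 0
    rw [h0] at h1
    have h2 : (fun k => U 1 k 0) = bOf t μ c0 := h1.symm
    have h2r : Rap (fun k => U 1 k 0) := h2 ▸ bOf_rap ht hμ.rap hc0r
    have h3 := hμ.right ht (bOf_rap0 ht hμ.rap hc0r) k
    have h4 : U 1 k 0 = bOf t μ c0 k := congrFun h2 k
    rw [h4, h2]
    have h5 : ∀ i, conv (t i) (fun k => dk i k * ψ k - conv (t i) (bOf t μ c0) k) k =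
        conv (t i) (c0 (some i)) k - conv (t i) (conv (t i) (bOf t μ c0)) k := fun i =>
      conv_sub (ht i) (hc0r (some i)) ((ht i).conv (h2 ▸ h2r)) k
    simp only [h5, Finset.sum_sub_distrib]
    have h6 : bOf t μ c0 k + ∑ i, conv (t i) (conv (t i) (bOf t μ c0)) k =
      c k + ∑ i, conv (t i) (c0 (some i)) k := h3
    linear_combination h6
  · intro k
    have := (hBwd 0 k).ae_eq
    rwa [hB0] at this
  · intro i k
    filter_upwards [(S.wdF i k).ae_eq] with z h1 hz
    rw [h1 hz, hatf_smul, ← hB0]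
  · intro k
    have := hBwd 0 k
    rw [hB0] at this
    have e : U 1 k 0 = Γ 0 k := hatf_zero _ _
    rwa [e]

end ShapeD

namespace ShapeD

/-- Seeley coefficients, unnormalised -/
def sc : ℕ → ℝ
  | 0 => 1
  | j+1 => -((1/2:ℝ)^j / (1 - (1/2)^(j+1))) * sc j

lemma sc_rec (j : ℕ) : sc (j+1) * ((1/2)^(j+1) - 1) = sc j * (1/2)^j := by
  rw [sc]
  have h1 : ((1:ℝ)/2)^(j+1) < 1 := pow_lt_one₀ (by norm_num) (by norm_num) (by omega)
  have h2 : (1:ℝ) - (1/2)^(j+1) ≠ 0 := by linarith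
  have h3 : -((1/2:ℝ)^j / (1 - (1/2)^(j+1))) * sc j * ((1/2)^(j+1) - 1) =
    ((1/2:ℝ)^j / (1 - (1/2)^(j+1)) * (1 - (1/2)^(j+1))) * sc j := by ring
  rw [h3, div_mul_cancel₀ _ h2, mul_comm]

lemma sc_le (j : ℕ) : |sc (j+1)| ≤ 2 * (1/2)^j * |sc j| := by
  rw [sc, abs_mul, abs_neg]
  have h1 : ((1:ℝ)/2)^(j+1) ≤ 1/2 := by
    rw [pow_succ]; have : ((1:ℝ)/2)^j ≤ 1 := pow_le_one₀ (by norm_num) (by norm_num); linarith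
  gcongr
  rw [abs_of_nonneg (by have : (0:ℝ) < 1 - (1/2)^(j+1) := by linarith
                        positivity), div_le_iff₀ (by linarith)]
  have : (0:ℝ) ≤ (1/2)^j := by positivity
  nlinarith

lemma sc_summable (r : ℝ) : Summable (fun j => sc j * r ^ j) := by
  refine summable_of_ratio_norm_eventually_le (r := 1/2) (by norm_num) ?_
  have h1 : Filter.Tendsto (fun j : ℕ => 2 * (1/2:ℝ)^j * |r|) Filter.atTop (nhds 0) := by
    have := ((tendsto_pow_atTop_nhds_zero_of_lt_one (r := (1/2:ℝ)) (by norm_num)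
      (by norm_num)).const_mul 2).mul_const |r|
    simpa using this
  filter_upwards [h1.eventually (ge_mem_nhds (show (0:ℝ) < 1/2 by norm_num))] with j hj
  rw [norm_mul, norm_mul, Real.norm_eq_abs, Real.norm_eq_abs, Real.norm_eq_abs, Real.norm_eq_abs,
    pow_succ, abs_mul]
  have h2 := sc_le j
  calc |sc (j+1)| * (|r ^ j| * |r|) ≤ (2 * (1/2)^j * |sc j|) * (|r ^ j| * |r|) := by gcongr
    _ = (2 * (1/2)^j * |r|) * (|sc j| * |r^j|) := by ring
    _ ≤ _ := by gcongr

lemma sc_func (r : ℝ) : ∑' j, sc j * r ^ j = (1 - r) * ∑' j, sc j * (r/2) ^ j := by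
  have h1 := sc_summable r
  have h2 := sc_summable (r/2)
  have h3 : ∑' j, sc j * (r/2)^j = 1 + ∑' j, sc (j+1) * (r/2)^(j+1) := by
    rw [h2.tsum_eq_zero_add]; simp [sc]
  have h4 : ∑' j, sc j * r^j = 1 + ∑' j, sc (j+1) * r^(j+1) := by
    rw [h1.tsum_eq_zero_add]; simp [sc]
  have h5 : (∑' j, sc (j+1) * (r/2)^(j+1)) - r * ∑' j, sc j * (r/2)^j = ∑' j, sc (j+1) * r^(j+1) := by
    rw [← tsum_mul_left, ← ((summable_nat_add_iff 1).2 h2).tsum_sub (h2.mul_left r)]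
    refine tsum_congr fun j => ?_
    have := sc_rec j
    rw [div_eq_mul_inv, mul_pow, mul_pow, show (2:ℝ)⁻¹ = 1/2 by norm_num]
    linear_combination r^(j+1) * this
  rw [h4, ← h5, sub_mul, one_mul]
  linear_combination -h3

lemma sc_zero (m : ℕ) : ∑' j, sc j * ((2:ℝ)^m) ^ j = 0 := by
  induction m with
  | zero => rw [sc_func]; simp
  | succ m ih =>
    rw [sc_func, pow_succ, mul_div_cancel_right₀ _ (by norm_num), ih, mul_zero]

/-- auxiliary -/
def sa (j : ℕ) : ℝ := sc j / (1 + 2^j)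

lemma sa_summable (r : ℝ) : Summable (fun j => sa j * r ^ j) := by
  refine Summable.of_norm_bounded (g := fun j => ‖sc j * r^j‖) (sc_summable r).norm fun j => ?_
  rw [norm_mul, norm_mul, sa, norm_div]
  gcongr
  refine div_le_self (norm_nonneg _) ?_
  rw [Real.norm_of_nonneg (by positivity)]
  have : (0:ℝ) ≤ 2^j := by positivity
  linarith

lemma sa_rec (m : ℕ) : ∑' j, sa j * ((2:ℝ)^(m+1)) ^ j = - ∑' j, sa j * ((2:ℝ)^m) ^ j := by
  rw [eq_neg_iff_add_eq_zero, ← (sa_summable _).tsum_add (sa_summable _), ← sc_zero m]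
  refine tsum_congr fun j => ?_
  have : (1:ℝ) + 2^j ≠ 0 := by positivity
  rw [sa]
  field_simp
  ring

lemma sa_ne : ∑' j, sa j * ((2:ℝ)^0) ^ j ≠ 0 := by
  have hs := sa_summable (2^0)
  have h1 := hs.sum_add_tsum_nat_add 4
  have h2 : ∀ j, |sc (j+4)| ≤ (16/315) * (1/4)^j := by
    intro j
    induction j with
    | zero => norm_num [sc, abs_of_pos]
    | succ j ih =>
      have h3 := sc_le (j+4)
      have h4 : 2 * (1/2:ℝ)^(j+4) ≤ 1/4 := by
        rw [pow_add]; have : ((1:ℝ)/2)^j ≤ 1 := pow_le_one₀ (by norm_num) (by norm_num)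
        norm_num; linarith
      rw [show j + 1 + 4 = j + 4 + 1 by ring]
      calc _ ≤ 2 * (1/2:ℝ)^(j+4) * |sc (j+4)| := h3
        _ ≤ 1/4 * ((16/315) * (1/4)^j) := by gcongr
        _ = _ := by rw [pow_succ]; ring
  have h3 : ‖∑' j, sa (j+4) * ((2:ℝ)^0)^(j+4)‖ ≤ (1/17) * (16/315) * (1 - 1/4)⁻¹ := by
    refine tsum_of_norm_bounded
      ((hasSum_geometric_of_lt_one (r := (1/4:ℝ)) (by norm_num) (by norm_num)).mul_left _) fun j => ?_
    rw [pow_zero, one_pow, mul_one, sa, norm_div, Real.norm_of_nonneg (by positivity : (0:ℝ) ≤ 1 + 2^(j+4)),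
      div_le_iff₀ (by positivity), Real.norm_eq_abs]
    have h5 : (17:ℝ) ≤ 1 + 2^(j+4) := by
      rw [pow_add]; have : (1:ℝ) ≤ 2^j := one_le_pow₀ (by norm_num)
      norm_num; linarith
    have h6 := h2 j
    have h7 : (0:ℝ) ≤ (16/315) * (1/4)^j := by positivity
    nlinarith
  rw [Real.norm_eq_abs, abs_le] at h3
  intro h0
  rw [h0] at h1
  have h4 : ∑ i ∈ Finset.range 4, sa i * ((2:ℝ)^0)^i = 19/330 + (∑ i ∈ Finset.range 4, sa i - 19/330) := by
    simp
  have h5 : ∑ i ∈ Finset.range 4, sa i * ((2:ℝ)^0)^i > 1/20 := by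
    norm_num [Finset.sum_range_succ, sa, sc]
  norm_num at h3 h1 h5
  linarith [h3.1]

lemma exists_seeley : ∃ a : ℕ → ℝ, (∀ r : ℝ, Summable (fun j => a j * r ^ j)) ∧
    ∀ m : ℕ, ∑' j, a j * (-(2:ℝ)^j) ^ m = 1 := by
  set S := ∑' j, sa j * ((2:ℝ)^0) ^ j with hS
  have h1 : ∀ m : ℕ, ∑' j, sa j * ((2:ℝ)^m) ^ j = (-1)^m * S := by
    intro m
    induction m with
    | zero => simp [hS]
    | succ m ih => rw [sa_rec, ih]; ring
  refine ⟨fun j => sa j / S, fun r => ?_, fun m => ?_⟩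
  · refine ((sa_summable r).div_const S).congr fun j => by ring
  · have h2 : ∀ j, sa j / S * (-(2:ℝ)^j)^m = ((-1)^m / S) * (sa j * ((2:ℝ)^m)^j) := by
      intro j
      rw [neg_pow, ← pow_mul, ← pow_mul, mul_comm j m]; ring
    simp only [h2]
    rw [tsum_mul_left, h1, div_mul_eq_mul_div, ← mul_assoc, ← mul_pow]
    rw [show (-1:ℝ)*(-1)=1 by norm_num, one_pow, one_mul, div_self]
    exact sa_ne

/-- the Seeley coefficients -/
def sea : ℕ → ℝ := exists_seeley.choose

lemma sea_summable (r : ℝ) : Summable (fun j => sea j * r ^ j) := exists_seeley.choose_spec.1 r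

lemma sea_one (m : ℕ) : ∑' j, sea j * (-(2:ℝ)^j) ^ m = 1 := exists_seeley.choose_spec.2 m

lemma sea_abs (m : ℕ) : Summable (fun l => |sea l| * (2^l)^m) := by
  refine (sea_summable (2^m)).abs.congr fun l => ?_
  rw [abs_mul, ← pow_mul, ← pow_mul, mul_comm m l, abs_of_nonneg (by positivity : (0:ℝ) ≤ 2^(l*m))]

/-- C¹ extension by an affine function -/
def aext (U : ℕ → ℝ → ℂ) (j : ℕ) (z : ℝ) : ℂ := U j (min z 0) + (max z 0 : ℝ) * U (j+1) 0

lemma aext_deriv {U : ℕ → ℝ → ℂ} (hU : ∀ j, ∀ z ≤ 0, HasDerivWithinAt (U j) (U (j+1) z) (Set.Iic 0) z)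
    (j : ℕ) (z : ℝ) : HasDerivAt (aext U j) (U (j+1) (min z 0)) z := by
  have hl : ∀ z ≤ 0, HasDerivWithinAt (aext U j) (U (j+1) z) (Set.Iic 0) z := by
    intro z hz
    refine (hU j z hz).congr (fun w hw => ?_) ?_
    · simp only [Set.mem_Iic] at hw; simp [aext, min_eq_left hw, max_eq_right hw]
    · simp [aext, min_eq_left hz, max_eq_right hz]
  have hr : ∀ z, 0 ≤ z → HasDerivWithinAt (aext U j) (U (j+1) 0) (Set.Ici 0) z := by
    intro z hz
    have h1 : HasDerivAt (fun w : ℝ => U j 0 + (w:ℂ) * U (j+1) 0) (U (j+1) 0) z := by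
      have := ((Complex.ofRealCLM.hasDerivAt (x := z)).mul_const (U (j+1) 0)).const_add (U j 0)
      simpa using this
    refine h1.hasDerivWithinAt.congr (fun w hw => ?_) ?_
    · simp only [Set.mem_Ici] at hw; simp [aext, min_eq_right hw, max_eq_left hw]
    · simp [aext, min_eq_right hz, max_eq_left hz]
  rcases lt_trichotomy z 0 with h | h | h
  · rw [min_eq_left h.le]; exact (hl z h.le).hasDerivAt (Iic_mem_nhds h)
  · subst h
    have := (hl 0 le_rfl).union (hr 0 le_rfl)
    rw [Set.Iic_union_Ici, hasDerivWithinAt_univ] at this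
    simpa using this
  · rw [min_eq_right h.le]; exact (hr z h.le).hasDerivAt (Ici_mem_nhds h)

/-- Seeley extension -/
def sext (U : ℕ → ℝ → ℂ) (j : ℕ) (z : ℝ) : ℂ :=
  U j (min z 0) - U j 0 + ∑' l, ((sea l * (-(2:ℝ)^l)^j : ℝ) : ℂ) * U j (min (-(2:ℝ)^l * z) 0)

lemma sext_eq (U : ℕ → ℝ → ℂ) (j : ℕ) {z : ℝ} (hz : z ≤ 0) : sext U j z = U j z := by
  have h1 : ∀ l : ℕ, min (-(2:ℝ)^l * z) 0 = 0 := by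
    intro l
    refine min_eq_right ?_
    have : (0:ℝ) ≤ 2^l := by positivity
    nlinarith
  rw [sext, min_eq_left hz]
  simp only [h1]
  rw [tsum_mul_right, ← Complex.ofReal_tsum, sea_one]
  simp

lemma sea_term_norm (j l : ℕ) : ‖((sea l * (-(2:ℝ)^l)^j : ℝ) : ℂ)‖ = |sea l| * (2^l)^j := by
  rw [Complex.norm_real, Real.norm_eq_abs, abs_mul, abs_pow, abs_neg, abs_of_nonneg (by positivity : (0:ℝ) ≤ 2^l)]

lemma min_abs_le (w : ℝ) : |min w 0| ≤ |w| := by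
  rcases le_total w 0 with h | h
  · rw [min_eq_left h]
  · rw [min_eq_right h, abs_zero]; positivity

lemma sea_bound_summable (j : ℕ) (R : ℝ) : Summable (fun l => |sea l| * (2^l)^j * (1 + 2^l * R)) := by
  refine ((sea_abs j).add ((sea_abs (j+1)).mul_right R)).congr fun l => by ring

lemma sext_term_le {U : ℕ → ℝ → ℂ} {A : ℝ} (hA : 0 ≤ A) {j i : ℕ} (hb : ∀ z ≤ 0, ‖U j z‖ ≤ A * (1 + |z|))
    {R z : ℝ} (hz : |z| ≤ R) (l : ℕ) :
    ‖((sea l * (-(2:ℝ)^l)^i : ℝ) : ℂ) * U j (min (-(2:ℝ)^l * z) 0)‖ ≤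
      A * (|sea l| * (2^l)^i * (1 + 2^l * R)) := by
  rw [norm_mul, sea_term_norm]
  have h1 := hb (min (-(2:ℝ)^l * z) 0) (min_le_right _ _)
  have h2 := min_abs_le (-(2:ℝ)^l * z)
  rw [abs_mul, abs_neg, abs_of_nonneg (by positivity : (0:ℝ) ≤ 2^l)] at h2
  calc _ ≤ |sea l| * (2^l)^i * (A * (1 + 2^l * R)) := by
        gcongr
        refine h1.trans ?_
        gcongr
        refine h2.trans ?_
        gcongr
    _ = _ := by ring

/-- constant in the Seeley bound -/
def sK (j : ℕ) (R : ℝ) : ℝ := (2 + R) + ∑' l, |sea l| * (2^l)^j * (1 + 2^l * R)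

lemma sext_bound {U : ℕ → ℝ → ℂ} {A : ℝ} (hA : 0 ≤ A) {j : ℕ} (hb : ∀ z ≤ 0, ‖U j z‖ ≤ A * (1 + |z|))
    {R z : ℝ} (hz : |z| ≤ R) : ‖sext U j z‖ ≤ A * sK j R := by
  have h1 : ‖∑' l, ((sea l * (-(2:ℝ)^l)^j : ℝ) : ℂ) * U j (min (-(2:ℝ)^l * z) 0)‖ ≤
      A * ∑' l, |sea l| * (2^l)^j * (1 + 2^l * R) :=
    tsum_of_norm_bounded ((sea_bound_summable j R).hasSum.mul_left A) fun l => sext_term_le hA hb hz l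
  have h2 : ‖U j (min z 0)‖ ≤ A * (1 + R) := by
    refine (hb _ (min_le_right _ _)).trans ?_
    gcongr
    exact (min_abs_le z).trans hz
  have h3 : ‖U j 0‖ ≤ A := by simpa using hb 0 le_rfl
  rw [sext, sK]
  calc _ ≤ ‖U j (min z 0)‖ + ‖U j 0‖ + _ := (norm_add_le _ _).trans (add_le_add (norm_sub_le _ _) h1)
    _ ≤ A * (1 + R) + A + _ := by gcongr
    _ = _ := by ring

lemma sext_deriv {U : ℕ → ℝ → ℂ} (hU : ∀ j, ∀ z ≤ 0, HasDerivWithinAt (U j) (U (j+1) z) (Set.Iic 0) z)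
    (hb : ∀ j, ∃ A, ∀ z ≤ 0, ‖U j z‖ ≤ A * (1 + |z|)) (j : ℕ) (z : ℝ) :
    HasDerivAt (sext U j) (sext U (j+1) z) z := by
  obtain ⟨A0, hA0⟩ := hb j
  obtain ⟨A, hA⟩ := hb (j+1)
  have hAn : 0 ≤ A := by
    have := hA 0 le_rfl
    simp at this
    exact (norm_nonneg _).trans this
  have hA0n : 0 ≤ A0 := by
    have := hA0 0 le_rfl
    simp at this
    exact (norm_nonneg _).trans this
  have hsum : ∀ (w : ℝ), Summable (fun l => ((sea l * (-(2:ℝ)^l)^j : ℝ) : ℂ) * U j (min (-(2:ℝ)^l * w) 0)) :=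
    fun w => Summable.of_norm_bounded ((sea_bound_summable j |w|).mul_left A0)
      fun l => sext_term_le hA0n hA0 le_rfl l
  have hm : ∀ w : ℝ, Summable (fun l => ((sea l * (-(2:ℝ)^l)^j * max (-(2:ℝ)^l * w) 0 : ℝ):ℂ)) := by
    intro w
    refine Summable.of_norm_bounded ((sea_abs (j+1)).mul_right |w|) fun l => ?_
    rw [Complex.norm_real, Real.norm_eq_abs, abs_mul, ← Real.norm_eq_abs (sea l * _), ← Complex.norm_real, sea_term_norm]
    have h2 : |max (-(2:ℝ)^l * w) 0| ≤ 2^l * |w| := by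
      have h3 : |-(2:ℝ)^l * w| = 2^l * |w| := by
        rw [abs_mul, abs_neg, abs_of_nonneg (by positivity : (0:ℝ) ≤ 2^l)]
      rw [← h3]
      rcases le_total (-(2:ℝ)^l * w) 0 with h | h
      · rw [max_eq_right h, abs_zero]; positivity
      · rw [max_eq_left h]
    calc _ ≤ |sea l| * (2^l)^j * (2^l * |w|) := by gcongr
      _ = _ := by ring
  have hmax : ∀ w : ℝ, max w 0 + ∑' l, sea l * (-(2:ℝ)^l)^j * max (-(2:ℝ)^l * w) 0 = w := by
    intro w
    rcases le_total w 0 with h | h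
    · have : ∀ l : ℕ, sea l * (-(2:ℝ)^l)^j * max (-(2:ℝ)^l * w) 0 = sea l * (-(2:ℝ)^l)^(j+1) * w := by
        intro l
        rw [max_eq_left (by have : (0:ℝ) ≤ 2^l := by positivity
                            nlinarith)]
        ring
      simp only [this]
      rw [tsum_mul_right, sea_one, max_eq_right h]; ring
    · have : ∀ l : ℕ, sea l * (-(2:ℝ)^l)^j * max (-(2:ℝ)^l * w) 0 = 0 := by
        intro l
        rw [max_eq_right (by have : (0:ℝ) ≤ 2^l := by positivity
                             nlinarith)]
        ring
      simp only [this]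
      rw [tsum_zero, max_eq_left h, add_zero]
  have haext : ∀ w : ℝ, ∀ l : ℕ, ((sea l * (-(2:ℝ)^l)^j : ℝ) : ℂ) * aext U j (-(2:ℝ)^l * w) =
      ((sea l * (-(2:ℝ)^l)^j : ℝ) : ℂ) * U j (min (-(2:ℝ)^l * w) 0) +
      ((sea l * (-(2:ℝ)^l)^j * max (-(2:ℝ)^l * w) 0 : ℝ):ℂ) * U (j+1) 0 := by
    intro w l; rw [aext]; push_cast; ring
  have hform : ∀ w, sext U j w = aext U j w - U j 0 +
      (∑' l, ((sea l * (-(2:ℝ)^l)^j : ℝ) : ℂ) * aext U j (-(2:ℝ)^l * w)) - w * U (j+1) 0 := by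
    intro w
    simp only [haext w]
    rw [(hsum w).tsum_add ((hm w).mul_right _), tsum_mul_right, sext, aext, ← Complex.ofReal_tsum]
    have := congrArg (fun r : ℝ => (r:ℂ)) (hmax w)
    simp only [Complex.ofReal_add] at this
    linear_combination (-U (j+1) 0) * this
  have hz0 : z ∈ Metric.ball (0:ℝ) (|z|+1) := by simp
  have hd : HasDerivAt (fun w => ∑' l, ((sea l * (-(2:ℝ)^l)^j : ℝ) : ℂ) * aext U j (-(2:ℝ)^l * w))
      (∑' l, ((sea l * (-(2:ℝ)^l)^(j+1) : ℝ) : ℂ) * U (j+1) (min (-(2:ℝ)^l * z) 0)) z := by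
    refine hasDerivAt_tsum_of_isPreconnected (u := fun l => A * (|sea l| * (2^l)^(j+1) * (1 + 2^l * (|z|+1))))
      (g := fun l w => ((sea l * (-(2:ℝ)^l)^j : ℝ) : ℂ) * aext U j (-(2:ℝ)^l * w))
      (g' := fun l w => ((sea l * (-(2:ℝ)^l)^(j+1) : ℝ) : ℂ) * U (j+1) (min (-(2:ℝ)^l * w) 0))
      (t := Metric.ball 0 (|z|+1)) (y₀ := z)
      ((sea_bound_summable (j+1) (|z|+1)).mul_left A) Metric.isOpen_ball
      (convex_ball _ _).isPreconnected (fun l w hw => ?_) (fun l w hw => ?_) hz0 ?_ hz0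
    · have h1 := (aext_deriv hU j (-(2:ℝ)^l * w)).scomp w ((hasDerivAt_id w).const_mul (-(2:ℝ)^l))
      have h2 := h1.const_mul ((sea l * (-(2:ℝ)^l)^j : ℝ) : ℂ)
      refine h2.congr_deriv ?_
      simp only [Complex.real_smul]
      push_cast
      ring
    · exact sext_term_le hAn hA (by simpa using (mem_ball_zero_iff.1 hw).le) l
    · simp only [haext z]
      exact (hsum z).add ((hm z).mul_right _)
  have hz : HasDerivAt (fun w : ℝ => (w:ℂ) * U (j+1) 0) (U (j+1) 0) z := by
    have := ((Complex.ofRealCLM.hasDerivAt (x := z)).mul_const (U (j+1) 0))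
    simpa using this
  have := ((((aext_deriv hU j z).sub_const (U j 0)).add hd).sub hz)
  refine (this.congr_of_eventuallyEq (Filter.Eventually.of_forall fun w => hform w)).congr_deriv ?_
  rw [sext]; ring

end ShapeD

namespace ShapeD

variable {n : ℕ}

/-- smooth families of Fourier modes -/
structure Nice (W : ℕ → (Fin n → ℤ) → ℝ → ℂ) : Prop where
  deriv : ∀ j k z, HasDerivAt (W j k) (W (j+1) k z) z
  bound : ∀ j N R, ∃ C, ∀ k z, |z| ≤ R → (1 + ‖k‖) ^ N * ‖W j k z‖ ≤ C

lemma Nice.rap {W : ℕ → (Fin n → ℤ) → ℝ → ℂ} (hW : Nice W) (j z) : Rap (fun k => W j k z) := by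
  intro N
  obtain ⟨C, hC⟩ := hW.bound j N |z|
  exact ⟨C, fun k => hC k z le_rfl⟩

/-- shift -/
def shN (W : ℕ → (Fin n → ℤ) → ℝ → ℂ) : ℕ → (Fin n → ℤ) → ℝ → ℂ := fun j => W (j+1)

/-- horizontal derivative -/
def dN (i : Fin n) (W : ℕ → (Fin n → ℤ) → ℝ → ℂ) : ℕ → (Fin n → ℤ) → ℝ → ℂ :=
  fun j k z => dk i k * W j k z

lemma Nice.sh {W : ℕ → (Fin n → ℤ) → ℝ → ℂ} (hW : Nice W) : Nice (shN W) :=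
  ⟨fun j => hW.deriv (j+1), fun j => hW.bound (j+1)⟩

lemma Nice.d {W : ℕ → (Fin n → ℤ) → ℝ → ℂ} (hW : Nice W) (i : Fin n) : Nice (dN i W) := by
  refine ⟨fun j k z => (hW.deriv j k z).const_mul _, fun j N R => ?_⟩
  obtain ⟨C, hC⟩ := hW.bound j (N+1) R
  refine ⟨2 * Real.pi * C, fun k z hz => ?_⟩
  have h1 := norm_dk_le i k
  have h2 := hC k z hz
  rw [dN, norm_mul]
  calc (1 + ‖k‖)^N * (‖dk i k‖ * ‖W j k z‖) ≤ (1 + ‖k‖)^N * ((2 * Real.pi * (1 + ‖k‖)) * ‖W j k z‖) := by gcongr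
    _ = 2 * Real.pi * ((1 + ‖k‖)^(N+1) * ‖W j k z‖) := by ring
    _ ≤ _ := by have := Real.pi_pos; gcongr

/-- the sum of the series -/
def SN (W : ℕ → (Fin n → ℤ) → ℝ → ℂ) (p : (Fin n → ℝ) × ℝ) : ℂ := ev p.1 (fun k => W 0 k p.2)

/-- the differential of the series -/
def SL (W : ℕ → (Fin n → ℤ) → ℝ → ℂ) (p : (Fin n → ℝ) × ℝ) : ((Fin n → ℝ) × ℝ) →L[ℝ] ℂ :=
  (∑ i, ((ContinuousLinearMap.proj (R := ℝ) (φ := fun _ : Fin n => ℝ) i).comp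
      (ContinuousLinearMap.fst ℝ (Fin n → ℝ) ℝ)).smulRight (SN (dN i W) p)) +
    (ContinuousLinearMap.snd ℝ (Fin n → ℝ) ℝ).smulRight (SN (shN W) p)

lemma SL_apply (W : ℕ → (Fin n → ℤ) → ℝ → ℂ) (p v : (Fin n → ℝ) × ℝ) :
    SL W p v = (∑ i, (v.1 i : ℂ) * SN (dN i W) p) + (v.2 : ℂ) * SN (shN W) p := by
  simp [SL]

/-- the differential of a term -/
def sl (W : ℕ → (Fin n → ℤ) → ℝ → ℂ) (k : Fin n → ℤ) (p : (Fin n → ℝ) × ℝ) : ((Fin n → ℝ) × ℝ) →L[ℝ] ℂ :=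
  (∑ i, ((ContinuousLinearMap.proj (R := ℝ) (φ := fun _ : Fin n => ℝ) i).comp
      (ContinuousLinearMap.fst ℝ (Fin n → ℝ) ℝ)).smulRight (ek k p.1 • dN i W 0 k p.2)) +
    (ContinuousLinearMap.snd ℝ (Fin n → ℝ) ℝ).smulRight (ek k p.1 • shN W 0 k p.2)

lemma ek_hasFDerivAt (k : Fin n → ℤ) (x : Fin n → ℝ) : HasFDerivAt (ek k)
    (∑ i, (ContinuousLinearMap.proj (R := ℝ) (φ := fun _ : Fin n => ℝ) i).smulRight (dk i k * ek k x)) x := by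
  have h1 : HasFDerivAt (fun x : Fin n → ℝ => ∑ i, dk i k * (x i : ℂ))
      (∑ i, (ContinuousLinearMap.proj (R := ℝ) (φ := fun _ : Fin n => ℝ) i).smulRight (dk i k)) x := by
    refine HasFDerivAt.fun_sum fun i _ => ?_
    have h2 := (Complex.ofRealCLM.hasFDerivAt (x := x i)).comp x
      (ContinuousLinearMap.proj (R := ℝ) (φ := fun _ : Fin n => ℝ) i).hasFDerivAt
    refine (h2.const_mul (dk i k)).congr_fderiv ?_
    ext v; simp [mul_comm]
  have h3 := h1.cexp
  have h4 : ek k = fun x => Complex.exp (∑ i, dk i k * (x i : ℂ)) := by ext x; simp [ek]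
  rw [h4]
  refine h3.congr_fderiv ?_
  ext v
  simp only [smul_apply, sum_apply, ContinuousLinearMap.smulRight_apply,
    smul_eq_mul, Finset.mul_sum]
  refine Finset.sum_congr rfl fun i _ => ?_
  simp only [ContinuousLinearMap.proj_apply, Complex.real_smul]; ring

lemma sl_hasFDerivAt {W : ℕ → (Fin n → ℤ) → ℝ → ℂ} (hW : Nice W) (k : Fin n → ℤ) (p : (Fin n → ℝ) × ℝ) :
    HasFDerivAt (fun p : (Fin n → ℝ) × ℝ => ek k p.1 • W 0 k p.2) (sl W k p) p := by
  have h1 := (ek_hasFDerivAt k p.1).comp p (ContinuousLinearMap.fst ℝ (Fin n → ℝ) ℝ).hasFDerivAt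
  have h2 := (hW.deriv 0 k p.2).hasFDerivAt.comp p (ContinuousLinearMap.snd ℝ (Fin n → ℝ) ℝ).hasFDerivAt
  refine (h1.mul h2).congr_fderiv ?_
  ext v
  · simp [sl, dN]
    rw [Finset.mul_sum]
    exact Finset.sum_congr rfl fun i _ => by ring
  · simp [sl, shN]

lemma norm_smulRight_le' {L : ((Fin n → ℝ) × ℝ) →L[ℝ] ℝ} (hL : ‖L‖ ≤ 1) (c : ℂ) : ‖L.smulRight c‖ ≤ ‖c‖ := by
  rw [ContinuousLinearMap.norm_smulRight_apply]
  exact mul_le_of_le_one_left (norm_nonneg _) hL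

lemma norm_pf_le (i : Fin n) : ‖(ContinuousLinearMap.proj (R := ℝ) (φ := fun _ : Fin n => ℝ) i).comp
      (ContinuousLinearMap.fst ℝ (Fin n → ℝ) ℝ)‖ ≤ 1 := by
  refine ContinuousLinearMap.opNorm_le_bound _ zero_le_one fun v => ?_
  simp only [ContinuousLinearMap.comp_apply, ContinuousLinearMap.proj_apply, one_mul]
  exact (norm_le_pi_norm v.1 i).trans (norm_fst_le v)

lemma sl_norm_le (W : ℕ → (Fin n → ℤ) → ℝ → ℂ) (k : Fin n → ℤ) (p : (Fin n → ℝ) × ℝ) :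
    ‖sl W k p‖ ≤ (∑ i, ‖dN i W 0 k p.2‖) + ‖shN W 0 k p.2‖ := by
  rw [sl]
  refine (norm_add_le _ _).trans (add_le_add ((norm_sum_le _ _).trans (Finset.sum_le_sum fun i _ => ?_)) ?_)
  · refine (norm_smulRight_le' (norm_pf_le i) _).trans ?_
    rw [norm_smul, norm_ek, one_mul]
  · refine (norm_smulRight_le' (ContinuousLinearMap.norm_snd_le ℝ _ _) _).trans ?_
    rw [norm_smul, norm_ek, one_mul]

lemma Nice.usum {W : ℕ → (Fin n → ℤ) → ℝ → ℂ} (hW : Nice W) (R : ℝ) :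
    ∃ u : (Fin n → ℤ) → ℝ, Summable u ∧ ∀ k z, |z| ≤ R → ‖W 0 k z‖ ≤ u k := by
  obtain ⟨C, hC⟩ := hW.bound 0 (2*n) R
  refine ⟨fun k => C * ((1 + ‖k‖) ^ (2*n))⁻¹, (summable_lattice n).mul_left C, fun k z hz => ?_⟩
  show _ ≤ C * ((1 + ‖k‖) ^ (2*n))⁻¹
  rw [← div_eq_mul_inv, le_div_iff₀ (by positivity)]
  linarith [hC k z hz]

lemma smulRight_hasSum (L : ((Fin n → ℝ) × ℝ) →L[ℝ] ℝ) {f : (Fin n → ℤ) → ℂ} (hf : Summable f) :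
    HasSum (fun k => L.smulRight (f k)) (L.smulRight (∑' k, f k)) :=
  ((ContinuousLinearMap.smulRightL ℝ ((Fin n → ℝ) × ℝ) ℂ) L).hasSum hf.hasSum

lemma SN_hasFDerivAt {W : ℕ → (Fin n → ℤ) → ℝ → ℂ} (hW : Nice W) (p : (Fin n → ℝ) × ℝ) :
    HasFDerivAt (SN W) (SL W p) p := by
  choose u hu hu' using fun i => (hW.d i).usum (|p.2|+1)
  obtain ⟨u0, hu0, hu0'⟩ := hW.sh.usum (|p.2|+1)
  have hs : SL W p = ∑' k, sl W k p := by
    refine (HasSum.tsum_eq ?_).symm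
    refine (hasSum_sum fun i _ => smulRight_hasSum _ ?_).add (smulRight_hasSum _ ?_)
    · exact ev_summable ((hW.d i).rap 0 p.2) p.1
    · exact ev_summable (hW.sh.rap 0 p.2) p.1
  rw [hs]
  have hp : p ∈ (Set.univ ×ˢ Metric.ball (0:ℝ) (|p.2|+1) : Set ((Fin n → ℝ) × ℝ)) := by simp
  refine hasFDerivAt_tsum_of_isPreconnected (u := fun k => (∑ i, u i k) + u0 k)
    (f := fun k (p : (Fin n → ℝ) × ℝ) => ek k p.1 • W 0 k p.2) (f' := sl W)
    (s := Set.univ ×ˢ Metric.ball (0:ℝ) (|p.2|+1)) (x₀ := p)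
    ((summable_sum fun i _ => hu i).add hu0) (isOpen_univ.prod Metric.isOpen_ball)
    (convex_univ.prod (convex_ball _ _)).isPreconnected (fun k q _ => sl_hasFDerivAt hW k q)
    (fun k q hq => ?_) hp (ev_summable (hW.rap 0 p.2) p.1) hp
  have hq2 : |q.2| ≤ |p.2| + 1 := by
    have := hq.2
    simp at this
    exact this.le
  refine (sl_norm_le W k q).trans (add_le_add (Finset.sum_le_sum fun i _ => hu' i k q.2 hq2) (hu0' k q.2 hq2))

lemma SN_contDiff {W : ℕ → (Fin n → ℤ) → ℝ → ℂ} (hW : Nice W) : ContDiff ℝ (⊤ : ℕ∞) (SN W) := by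
  have key : ∀ m : ℕ, ∀ W : ℕ → (Fin n → ℤ) → ℝ → ℂ, Nice W → ContDiff ℝ m (SN W) := by
    intro m
    induction m with
    | zero =>
      intro W hW
      rw [Nat.cast_zero, contDiff_zero]
      exact continuous_iff_continuousAt.2 fun p => (SN_hasFDerivAt hW p).continuousAt
    | succ m ih =>
      intro W hW
      rw [Nat.cast_succ, contDiff_succ_iff_hasFDerivAt]
      refine ⟨SL W, ?_, SN_hasFDerivAt hW⟩
      unfold SL
      refine (ContDiff.sum fun i _ => ?_).add ?_
      · exact contDiff_const.smulRight (ih _ (hW.d i))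
      · exact contDiff_const.smulRight (ih _ hW.sh)
  exact contDiff_infty.2 fun m => key m W hW

lemma SN_per (W : ℕ → (Fin n → ℤ) → ℝ → ℂ) (x : Fin n → ℝ) (y : ℝ) (k : Fin n → ℤ) :
    SN W (x + fun i => (k i : ℝ), y) = SN W (x, y) := by
  simp only [SN, ev]
  exact tsum_congr fun l => by rw [ek_per l x k]

/-- unflattened function -/
def Ph (h : (Fin n → ℝ) → ℝ) (W : ℕ → (Fin n → ℤ) → ℝ → ℂ) (p : (Fin n → ℝ) × ℝ) : ℂ :=
  SN W (p.1, p.2 - h p.1)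

lemma Ph_contDiff {h : (Fin n → ℝ) → ℝ} (hh : ContDiff ℝ (⊤ : ℕ∞) h) {W : ℕ → (Fin n → ℤ) → ℝ → ℂ} (hW : Nice W) :
    ContDiff ℝ (⊤ : ℕ∞) (Ph h W) :=
  (SN_contDiff hW).comp (contDiff_fst.prodMk (contDiff_snd.sub (hh.comp contDiff_fst)))

lemma Ph_fderiv {h : (Fin n → ℝ) → ℝ} (hh : ContDiff ℝ (⊤ : ℕ∞) h) {W : ℕ → (Fin n → ℤ) → ℝ → ℂ} (hW : Nice W)
    (p v : (Fin n → ℝ) × ℝ) : fderiv ℝ (Ph h W) p v =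
      (∑ i, (v.1 i : ℂ) * Ph h (dN i W) p) + ((v.2 - fderiv ℝ h p.1 v.1 : ℝ) : ℂ) * Ph h (shN W) p := by
  have h1 : HasFDerivAt h (fderiv ℝ h p.1) p.1 := (hh.differentiable (by simp) p.1).hasFDerivAt
  have h2 := (SN_hasFDerivAt hW (p.1, p.2 - h p.1)).comp p
    ((ContinuousLinearMap.fst ℝ (Fin n → ℝ) ℝ).hasFDerivAt.prodMk
    ((ContinuousLinearMap.snd ℝ (Fin n → ℝ) ℝ).hasFDerivAt.sub
      (h1.comp p (ContinuousLinearMap.fst ℝ (Fin n → ℝ) ℝ).hasFDerivAt)))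
  have h3 : fderiv ℝ (Ph h W) p = _ := h2.fderiv
  rw [h3]
  simp [SL_apply, Ph]

end ShapeD

namespace ShapeD

variable {n : ℕ}

/-- complexification -/
def cx (f : (Fin n → ℝ) → ℝ) (x : Fin n → ℝ) : ℂ := ((f x : ℝ) : ℂ)

lemma cx_per {f : (Fin n → ℝ) → ℝ} (hf : Per f) : Per (cx f) := fun x k => by rw [cx, hf x k, cx]

lemma cx_smooth {f : (Fin n → ℝ) → ℝ} (hf : ContDiff ℝ (⊤ : ℕ∞) f) : ContDiff ℝ (⊤ : ℕ∞) (cx f) :=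
  Complex.ofRealCLM.contDiff.comp hf

lemma pd_cx {f : (Fin n → ℝ) → ℝ} (hf : ContDiff ℝ (⊤ : ℕ∞) f) (i : Fin n) :
    pd (cx f) i = cx (pdX n f i) := by
  ext x
  have h1 : HasFDerivAt (cx f) (Complex.ofRealCLM.comp (fderiv ℝ f x)) x :=
    Complex.ofRealCLM.hasFDerivAt.comp x (hf.differentiable (by simp) x).hasFDerivAt
  rw [pd, h1.fderiv, cx, pdX]; simp

lemma pdX_per {f : (Fin n → ℝ) → ℝ} (hf : Per f) (i : Fin n) : Per (pdX n f i) := hf.pd i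

lemma pdX_smooth {f : (Fin n → ℝ) → ℝ} (hf : ContDiff ℝ (⊤ : ℕ∞) f) (i : Fin n) :
    ContDiff ℝ (⊤ : ℕ∞) (pdX n f i) := contDiff_pd hf i

/-- coefficients -/
def tf (h : (Fin n → ℝ) → ℝ) (i : Fin n) : (Fin n → ℤ) → ℂ := fc (cx (pdX n h i))

section
variable {h : (Fin n → ℝ) → ℝ} (hh : ContDiff ℝ (⊤ : ℕ∞) h) (hp : Per h)
include hh hp

lemma tf_rap (i : Fin n) : Rap (tf h i) := fc_rap (cx_per (pdX_per hp i)) (cx_smooth (pdX_smooth hh i))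

lemma tf_cf : Cf (tf h) := ⟨tf_rap hh hp, fun i m => fc_conj m⟩

lemma ev_tf (i : Fin n) (x) : ev x (tf h i) = (pdX n h i x : ℝ) :=
  ev_fc (cx_per (pdX_per hp i)) (cx_smooth (pdX_smooth hh i)) x

lemma ev_dk_tf (i j : Fin n) (x) : ev x (fun k => dk j k * tf h i k) = (pdX n (pdX n h i) j x : ℝ) := by
  have h1 : (fun k => dk j k * tf h i k) = fc (pd (cx (pdX n h i)) j) := by
    ext k
    rw [fc_pd (cx_per (pdX_per hp i)) (cx_smooth (pdX_smooth hh i))]; rfl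
  rw [h1, pd_cx (pdX_smooth hh i), ev_fc (cx_per (pdX_per (pdX_per hp i) j)) (cx_smooth (pdX_smooth (pdX_smooth hh i) j))]
  rfl

/-- the reciprocal function -/
lemma isInv_tf : ∃ μ, IsInv (tf h) μ := by
  set g : (Fin n → ℝ) → ℝ := fun x => (1 + ∑ i, (pdX n h i x)^2)⁻¹ with hg
  have hpos : ∀ x, (0:ℝ) < 1 + ∑ i, (pdX n h i x)^2 := fun x => by positivity
  have hgs : ContDiff ℝ (⊤ : ℕ∞) g := by
    refine ContDiff.inv (contDiff_const.add (ContDiff.sum fun i _ => (pdX_smooth hh i).pow 2)) fun x => (hpos x).ne'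
  have hgp : Per g := by
    intro x k
    simp only [hg]
    congr 2
    exact Finset.sum_congr rfl fun i _ => by rw [pdX_per hp i x k]
  have hr := fc_rap (cx_per hgp) (cx_smooth hgs)
  refine ⟨fc (cx g), hr, ?_⟩
  refine ev_inj (hr.conv (rho_rap (tf_rap hh hp))) del_rap fun x => ?_
  have h1 : ev x (del : (Fin n → ℤ) → ℂ) = 1 := by
    have h2 : (del : (Fin n → ℤ) → ℂ) = fc (fun _ : Fin n → ℝ => (1:ℂ)) := by rw [fc_one]; rfl
    rw [h2, ev_fc (fun _ _ => rfl) contDiff_const]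
  rw [ev_conv hr (rho_rap (tf_rap hh hp)), ev_fc (cx_per hgp) (cx_smooth hgs),
    ev_add del_rap (Rap.sum _ fun i _ => (tf_rap hh hp i).conv (tf_rap hh hp i)),
    ev_sum _ (fun i => (tf_rap hh hp i).conv (tf_rap hh hp i)), h1]
  have h3 : ∀ i, ev x (conv (tf h i) (tf h i)) = (((pdX n h i x)^2 : ℝ) : ℂ) := by
    intro i
    rw [ev_conv (tf_rap hh hp i) (tf_rap hh hp i), ev_tf hh hp]; push_cast; rw [smul_eq_mul]; ring
  simp only [h3, cx, hg, smul_eq_mul]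
  norm_cast
  exact inv_mul_cancel₀ (hpos x).ne'

end

/-- extension of the modes -/
def WW (U : ℕ → (Fin n → ℤ) → ℝ → ℂ) : ℕ → (Fin n → ℤ) → ℝ → ℂ :=
  fun j k z => sext (fun j => U j k) j z

section
variable {t : Fin n → (Fin n → ℤ) → ℂ} {ψ c : (Fin n → ℤ) → ℂ} {F : Fin n → (Fin n → ℤ) → LL}
    {b b1 : (Fin n → ℤ) → LL} {U : ℕ → (Fin n → ℤ) → ℝ → ℂ}

lemma WW_eq (U : ℕ → (Fin n → ℤ) → ℝ → ℂ) (j k) {z : ℝ} (hz : z ≤ 0) : WW U j k z = U j k z := sext_eq _ _ hz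

lemma Modes.bound' (M : Modes t ψ c F b b1 U) (j N : ℕ) : ∃ A, 0 ≤ A ∧ ∀ k z, z ≤ 0 →
    ‖U j k z‖ ≤ (A * ((1 + ‖k‖)^N)⁻¹) * (1 + |z|) := by
  obtain ⟨A, hA⟩ := M.bound j N
  refine ⟨A, ?_, fun k z hz => ?_⟩
  · have := hA 0 0 le_rfl
    simp at this
    exact (norm_nonneg _).trans this
  · have := hA k z hz
    rw [← div_eq_mul_inv, div_mul_eq_mul_div, le_div_iff₀ (by positivity)]
    linarith

lemma Modes.nice (M : Modes t ψ c F b b1 U) : Nice (WW U) := by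
  refine ⟨fun j k z => sext_deriv (U := fun j => U j k) (fun j z hz => M.deriv j k z hz) (fun j => ?_) j z, fun j N R => ?_⟩
  · obtain ⟨A, hA, h⟩ := M.bound' j 0
    exact ⟨_, fun z hz => h k z hz⟩
  · obtain ⟨A, hA, h⟩ := M.bound' j N
    refine ⟨A * sK j R, fun k z hz => ?_⟩
    have h1 := sext_bound (U := fun j => U j k) (A := A * ((1 + ‖k‖)^N)⁻¹) (by positivity) (fun z hz => h k z hz) hz
    have hp : (0:ℝ) < (1 + ‖k‖)^N := by positivity
    calc _ ≤ (1 + ‖k‖)^N * (A * ((1 + ‖k‖)^N)⁻¹ * sK j R) := by gcongr; exact h1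
      _ = _ := by field_simp

end

/-- real part of `Ph` -/
def Rh (h : (Fin n → ℝ) → ℝ) (W : ℕ → (Fin n → ℤ) → ℝ → ℂ) (p : (Fin n → ℝ) × ℝ) : ℝ := (Ph h W p).re

section
variable {h : (Fin n → ℝ) → ℝ} (hh : ContDiff ℝ (⊤ : ℕ∞) h) {W : ℕ → (Fin n → ℤ) → ℝ → ℂ} (hW : Nice W)
include hh hW

lemma Rh_contDiff : ContDiff ℝ (⊤ : ℕ∞) (Rh h W) := Complex.reCLM.contDiff.comp (Ph_contDiff hh hW)

lemma Rh_fderiv (p v : (Fin n → ℝ) × ℝ) : fderiv ℝ (Rh h W) p v = (fderiv ℝ (Ph h W) p v).re := by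
  have h1 : HasFDerivAt (Rh h W) (Complex.reCLM.comp (fderiv ℝ (Ph h W) p)) p :=
    Complex.reCLM.hasFDerivAt.comp p ((Ph_contDiff hh hW).differentiable (by simp) p).hasFDerivAt
  rw [h1.fderiv]; rfl

lemma Rh_eX (i : Fin n) : pdE n (Rh h W) (eX n i) =
    fun p => Rh h (dN i W) p - pdX n h i p.1 * Rh h (shN W) p := by
  ext p
  rw [pdE, Rh_fderiv hh hW, Ph_fderiv hh hW]
  simp only [eX, pdX, Rh]
  have : ∑ j, ((Pi.single (M := fun _ => ℝ) i 1 j : ℝ) : ℂ) * Ph h (dN j W) p = Ph h (dN i W) p := by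
    rw [Finset.sum_eq_single i]
    · simp
    · intro j _ hj; simp [Pi.single_eq_of_ne hj]
    · simp
  rw [this, Complex.add_re, Complex.re_ofReal_mul]; ring

lemma Rh_eY : pdE n (Rh h W) (eY n) = Rh h (shN W) := by
  ext p
  rw [pdE, Rh_fderiv hh hW, Ph_fderiv hh hW]
  simp [eY, Rh]

lemma Rh_eXX (i : Fin n) (p : (Fin n → ℝ) × ℝ) : pdE n (pdE n (Rh h W) (eX n i)) (eX n i) p =
    (Rh h (dN i (dN i W)) p - pdX n h i p.1 * Rh h (shN (dN i W)) p)
    - (pdX n (pdX n h i) i p.1 * Rh h (shN W) p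
      + pdX n h i p.1 * (Rh h (dN i (shN W)) p - pdX n h i p.1 * Rh h (shN (shN W)) p)) := by
  rw [Rh_eX hh hW]
  have h1 := (Rh_contDiff hh (hW.d i)).differentiable (by simp) p
  have h2 := (Rh_contDiff hh hW.sh).differentiable (by simp) p
  have h3 : HasFDerivAt (fun p : (Fin n → ℝ) × ℝ => pdX n h i p.1)
      ((fderiv ℝ (pdX n h i) p.1).comp (ContinuousLinearMap.fst ℝ (Fin n → ℝ) ℝ)) p :=
    ((pdX_smooth hh i).differentiable (by simp) p.1).hasFDerivAt.comp p hasFDerivAt_fst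
  have h4 := h1.hasFDerivAt.sub (h3.mul h2.hasFDerivAt)
  have e1 := congrFun (Rh_eX hh (hW.d i) i) p
  have e2 := congrFun (Rh_eX hh hW.sh i) p
  simp only [pdE] at e1 e2 ⊢
  have h5 : fderiv ℝ (fun p => Rh h (dN i W) p - pdX n h i p.1 * Rh h (shN W) p) p = _ := h4.fderiv
  rw [h5, ← e1, ← e2]
  simp [pdX, eX]
  ring

lemma Rh_lap (p : (Fin n → ℝ) × ℝ) : lapE n (Rh h W) p =
    (∑ i, ((Rh h (dN i (dN i W)) p - pdX n h i p.1 * Rh h (shN (dN i W)) p)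
    - (pdX n (pdX n h i) i p.1 * Rh h (shN W) p
      + pdX n h i p.1 * (Rh h (dN i (shN W)) p - pdX n h i p.1 * Rh h (shN (shN W)) p)))) + Rh h (shN (shN W)) p := by
  rw [lapE, Rh_eY hh hW, Rh_eY hh hW.sh]
  congr 1
  exact Finset.sum_congr rfl fun i _ => Rh_eXX hh hW i p

end

section
variable {ψ c : (Fin n → ℤ) → ℂ} {F : Fin n → (Fin n → ℤ) → LL}
    {b b1 : (Fin n → ℤ) → LL} {U : ℕ → (Fin n → ℤ) → ℝ → ℂ}
    {h : (Fin n → ℝ) → ℝ} (hh : ContDiff ℝ (⊤ : ℕ∞) h) (hp : Per h)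
    (M : Modes (tf h) ψ c F b b1 U)
include hh hp M

lemma Modes.pde_ev (x : Fin n → ℝ) {z : ℝ} (hz : z ≤ 0) :
    SN (shN (shN (WW U))) (x,z) + ∑ i, (pdX n h i x : ℂ) * ((pdX n h i x : ℂ) * SN (shN (shN (WW U))) (x,z)) =
    -(∑ i, (SN (dN i (dN i (WW U))) (x,z) - ((pdX n (pdX n h i) i x : ℂ) * SN (shN (WW U)) (x,z)
      + (pdX n h i x : ℂ) * SN (dN i (shN (WW U))) (x,z)))) + ∑ i, (pdX n h i x : ℂ) * SN (dN i (shN (WW U))) (x,z) := by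
  have hr : ∀ i, Rap (tf h i) := tf_rap hh hp
  have hW := M.nice
  have h0 := hW.rap 0 z
  have h1 := hW.rap 1 z
  have h2 := hW.rap 2 z
  have key := congrArg (ev x) (funext (M.pde z hz))
  simp only [← WW_eq U _ _ hz] at key
  have hd1 : ∀ i, Rap (fun k => dk i k * WW U 1 k z) := fun i => h1.dk_smul i
  have hd0 : ∀ i, Rap (fun k => dk i k * WW U 0 k z) := fun i => h0.dk_smul i
  have hc1 : ∀ i, Rap (conv (tf h i) (fun k => WW U 1 k z)) := fun i => (hr i).conv h1
  have hc2 : ∀ i, Rap (conv (tf h i) (fun k => WW U 2 k z)) := fun i => (hr i).conv h2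
  have hin : ∀ i, Rap (fun k => dk i k * (dk i k * WW U 0 k z - conv (tf h i) (fun k => WW U 1 k z) k)) :=
    fun i => ((hd0 i).sub (hc1 i)).dk_smul i
  rw [ev_add h2 (Rap.sum _ fun i _ => (hr i).conv (hc2 i)), ev_sum _ (fun i => (hr i).conv (hc2 i)),
    ev_add (Rap.sum _ fun i _ => hin i).neg (Rap.sum _ fun i _ => (hr i).conv (hd1 i)),
    ev_neg, ev_sum _ hin, ev_sum _ (fun i => (hr i).conv (hd1 i))] at key
  have e1 : ∀ i, ev x (conv (tf h i) (conv (tf h i) fun k => WW U 2 k z)) =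
      (pdX n h i x : ℂ) * ((pdX n h i x : ℂ) * SN (shN (shN (WW U))) (x,z)) := by
    intro i
    rw [ev_conv (hr i) (hc2 i), ev_conv (hr i) h2, ev_tf hh hp]; rfl
  have e2 : ∀ i, ev x (conv (tf h i) (fun k => dk i k * WW U 1 k z)) =
      (pdX n h i x : ℂ) * SN (dN i (shN (WW U))) (x,z) := by
    intro i
    rw [ev_conv (hr i) (hd1 i), ev_tf hh hp]; rfl
  have e3 : ∀ i, ev x (fun k => dk i k * (dk i k * WW U 0 k z - conv (tf h i) (fun k => WW U 1 k z) k)) =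
      SN (dN i (dN i (WW U))) (x,z) - ((pdX n (pdX n h i) i x : ℂ) * SN (shN (WW U)) (x,z)
      + (pdX n h i x : ℂ) * SN (dN i (shN (WW U))) (x,z)) := by
    intro i
    have e4 : (fun k => dk i k * (dk i k * WW U 0 k z - conv (tf h i) (fun k => WW U 1 k z) k)) =
      fun k => (dk i k * (dk i k * WW U 0 k z)) - (conv (fun m => dk i m * tf h i m) (fun k => WW U 1 k z) k
        + conv (tf h i) (fun k => dk i k * WW U 1 k z) k) := by
      ext k
      have := conv_leibniz (hr i) h1 i k
      simp only [smul_eq_mul] at this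
      rw [← this]; ring
    have r1 : Rap (fun k => dk i k * (dk i k * WW U 0 k z)) := (hd0 i).dk_smul i
    have r2 : Rap (fun m => dk i m * tf h i m) := (hr i).dk_smul i
    rw [e4, ev_sub r1 ((r2.conv h1).add ((hr i).conv (hd1 i))), ev_add (r2.conv h1) ((hr i).conv (hd1 i)),
      ev_conv r2 h1, e2, ev_dk_tf hh hp]
    rfl
  simp only [e1, e2, e3] at key
  exact key

lemma Modes.lap (p : (Fin n → ℝ) × ℝ) (hpp : p.2 < h p.1) : lapE n (Rh h (WW U)) p = 0 := by
  rw [Rh_lap hh M.nice]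
  have key := congrArg Complex.re (M.pde_ev hh hp p.1 (z := p.2 - h p.1) (by linarith))
  simp only [Complex.add_re, Complex.neg_re, Complex.re_sum, Complex.sub_re, Complex.re_ofReal_mul] at key
  have hcomm : ∀ i, shN (dN i (WW U)) = dN i (shN (WW U)) := fun i => rfl
  simp only [hcomm, Rh, Ph]
  simp only [Finset.sum_sub_distrib, Finset.sum_add_distrib, mul_sub] at key ⊢
  linarith

lemma Modes.neu_ev (hψ : Rap ψ) (x : Fin n → ℝ) : ev x (fun k => U 1 k 0)
    - ∑ i, (pdX n h i x : ℂ) * (ev x (fun k => dk i k * ψ k) - (pdX n h i x : ℂ) * ev x (fun k => U 1 k 0)) = ev x c := by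
  have hr : ∀ i, Rap (tf h i) := tf_rap hh hp
  have h1 : Rap (fun k => U 1 k 0) := by
    have := M.nice.rap 1 0
    simpa only [WW_eq U _ _ le_rfl] using this
  have hd : ∀ i, Rap (fun k => dk i k * ψ k) := fun i => hψ.dk_smul i
  have hm : ∀ i, Rap (fun k => dk i k * ψ k - conv (tf h i) (fun k => U 1 k 0) k) := fun i => (hd i).sub ((hr i).conv h1)
  rw [← funext M.neu, ev_sub h1 (Rap.sum _ fun i _ => (hr i).conv (hm i)), ev_sum _ (fun i => (hr i).conv (hm i))]
  congr 1
  refine Finset.sum_congr rfl fun i _ => ?_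
  rw [ev_conv (hr i) (hm i), ev_sub (hd i) ((hr i).conv h1), ev_conv (hr i) h1, ev_tf hh hp]
  rfl

lemma Modes.normal (hψ : Rap ψ) (x : Fin n → ℝ) : pdE n (Rh h (WW U)) (eY n) (x, h x)
      - ∑ i, pdX n h i x * pdE n (Rh h (WW U)) (eX n i) (x, h x) = (ev x c).re := by
  rw [← M.neu_ev hh hp hψ, Rh_eY hh M.nice]
  simp only [Rh_eX hh M.nice, Rh, Ph, SN, dN, shN, sub_self, WW_eq U _ _ le_rfl, M.bc, Complex.sub_re, Complex.re_sum,
    Complex.re_ofReal_mul]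

end

end ShapeD

namespace ShapeD

variable {n : ℕ}

/-- Lattice constant -/
def PP (n : ℕ) : ℝ := ∑' k : Fin n → ℤ, ((1 + ‖k‖)^(2*n))⁻¹

lemma PP_nonneg : 0 ≤ PP n := tsum_nonneg fun k => by positivity

lemma ev_sq_le {w : (Fin n → ℤ) → ℂ} (hw : Rap w) (x : Fin n → ℝ) :
    ‖ev x w‖^2 ≤ PP n * ∑' k, (1 + ‖k‖)^(2*n) * ‖w k‖^2 := by
  have hQ : Summable (fun k => (1 + ‖k‖)^(2*n) * ‖w k‖^2) := by
    obtain ⟨C, hC, hC'⟩ := hw.bdd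
    refine Summable.of_nonneg_of_le (fun k => by positivity) (fun k => ?_) ((hw.summable (2*n)).mul_left C)
    have := hC' k
    calc (1 + ‖k‖)^(2*n) * ‖w k‖^2 = ‖w k‖ * ((1 + ‖k‖)^(2*n) * ‖w k‖) := by ring
      _ ≤ _ := by gcongr
  have h1 : ‖ev x w‖ ≤ ∑' k, ‖w k‖ := by
    refine tsum_of_norm_bounded hw.summable_norm.hasSum fun k => ?_
    rw [norm_smul, norm_ek, one_mul]
  have h2 : (∑' k, ‖w k‖)^2 ≤ PP n * ∑' k, (1 + ‖k‖)^(2*n) * ‖w k‖^2 := by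
    refine le_of_tendsto (hw.summable_norm.hasSum.pow 2) (Filter.Eventually.of_forall fun s => ?_)
    have h3 := Finset.sum_mul_sq_le_sq_mul_sq s (fun k : Fin n → ℤ => ((1 + ‖k‖)^n)⁻¹) (fun k => (1 + ‖k‖)^n * ‖w k‖)
    have h4 : ∀ k : Fin n → ℤ, ((1 + ‖k‖)^n)⁻¹ * ((1 + ‖k‖)^n * ‖w k‖) = ‖w k‖ := by
      intro k
      have : (0:ℝ) < (1 + ‖k‖)^n := by positivity
      field_simp
    simp only [h4] at h3
    refine h3.trans ?_
    refine mul_le_mul ?_ ?_ (by positivity) PP_nonneg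
    · refine le_trans (le_of_eq (Finset.sum_congr rfl fun k _ => ?_)) ((summable_lattice n).sum_le_tsum s fun k _ => by positivity)
      rw [inv_pow, ← pow_mul, mul_comm n 2]
    · refine le_trans (le_of_eq (Finset.sum_congr rfl fun k _ => ?_)) (hQ.sum_le_tsum s fun k _ => by positivity)
      rw [mul_pow, ← pow_mul, mul_comm n 2]
  calc _ ≤ (∑' k, ‖w k‖)^2 := by gcongr
    _ ≤ _ := h2

lemma LL_lintegral (f : LL) : ∫⁻ z in Set.Iic (0:ℝ), ENNReal.ofReal (‖f z‖^2) = ENNReal.ofReal (‖f‖^2) := by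
  have h1 : Integrable (fun z => ‖f z‖^2) μ0 := by
    have := (Lp.memLp f).integrable_norm_pow (p := 2) (by norm_num)
    simpa using this
  rw [← ofReal_integral_eq_lintegral_ofReal h1 (Filter.Eventually.of_forall fun z => by positivity)]
  congr 1
  have h2 : (inner ℂ f f : ℂ) = ((‖f‖^2 : ℝ) : ℂ) := by rw [inner_self_eq_norm_sq_to_K]; norm_cast
  rw [L2.inner_def] at h2
  have h3 : ∀ z, (inner ℂ (f z) (f z) : ℂ) = ((‖f z‖^2 : ℝ) : ℂ) := fun z => by
    rw [inner_self_eq_norm_sq_to_K]; norm_cast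
  simp only [h3] at h2
  rw [integral_complex_ofReal] at h2
  exact_mod_cast h2

lemma lint_finite {f : (Fin n → ℤ) → LL} (hf : Rap f) {w : (Fin n → ℤ) → ℝ → ℂ} (hw : ∀ k, Continuous (w k))
    (hfw : ∀ k, ∀ᵐ z : ℝ, z ≤ 0 → f k z = w k z) :
    ∫⁻ z in Set.Iic (0:ℝ), ∑' k, ENNReal.ofReal ((1 + ‖k‖)^(2*n) * ‖w k z‖^2) < ⊤ := by
  rw [lintegral_tsum (fun k => (by
    have := hw k
    exact (Continuous.measurable (by fun_prop)).ennreal_ofReal.aemeasurable))]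
  have hQ : Summable (fun k => (1 + ‖k‖)^(2*n) * ‖f k‖^2) := by
    obtain ⟨C, hC, hC'⟩ := hf.bdd
    refine Summable.of_nonneg_of_le (fun k => by positivity) (fun k => ?_) ((hf.summable (2*n)).mul_left C)
    have := hC' k
    calc (1 + ‖k‖)^(2*n) * ‖f k‖^2 = ‖f k‖ * ((1 + ‖k‖)^(2*n) * ‖f k‖) := by ring
      _ ≤ _ := by gcongr
  have h1 : ∀ k, ∫⁻ z in Set.Iic (0:ℝ), ENNReal.ofReal ((1 + ‖k‖)^(2*n) * ‖w k z‖^2) =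
      ENNReal.ofReal ((1 + ‖k‖)^(2*n) * ‖f k‖^2) := by
    intro k
    rw [ENNReal.ofReal_mul (by positivity), ← LL_lintegral, ← lintegral_const_mul' _ _ ENNReal.ofReal_ne_top]
    refine setLIntegral_congr_fun_ae measurableSet_Iic ?_
    filter_upwards [hfw k] with z hz hz0
    rw [ENNReal.ofReal_mul (by positivity), hz hz0]
  simp only [h1]
  rw [← ENNReal.ofReal_tsum_of_nonneg (fun k => by positivity) hQ]
  exact ENNReal.ofReal_lt_top

lemma fluid_meas {h : (Fin n → ℝ) → ℝ} (hh : Continuous h) : MeasurableSet (fluidCell n h) :=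
  (measurable_fst cell_meas).inter (measurableSet_lt measurable_snd (hh.measurable.comp measurable_fst))

lemma shear_lintegral (h : (Fin n → ℝ) → ℝ) (hh : Continuous h) (g : ℝ → ENNReal) :
    ∫⁻ p in fluidCell n h, g (p.2 - h p.1) ≤ ∫⁻ z in Set.Iic (0:ℝ), g z := by
  rw [← lintegral_indicator (fluid_meas hh)]
  have h1 : ∀ p : (Fin n → ℝ) × ℝ, (fluidCell n h).indicator (fun p => g (p.2 - h p.1)) p ≤
      (cell n).indicator 1 p.1 * (Set.Iic (0:ℝ)).indicator g (p.2 - h p.1) := by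
    intro p
    by_cases hp : p ∈ fluidCell n h
    · rw [Set.indicator_of_mem hp, Set.indicator_of_mem hp.1, Set.indicator_of_mem]
      · simp
      · have := hp.2
        simp only [Set.mem_Iic]; linarith
    · rw [Set.indicator_of_notMem hp]; positivity
  refine (lintegral_mono h1).trans ?_
  rw [Measure.volume_eq_prod]
  refine (lintegral_prod_le _).trans ?_
  simp only
  have h2 : ∀ x : Fin n → ℝ, ∫⁻ y : ℝ, (cell n).indicator 1 x * (Set.Iic (0:ℝ)).indicator g (y - h x) =
      (cell n).indicator 1 x * ∫⁻ z in Set.Iic (0:ℝ), g z := by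
    intro x
    rw [lintegral_const_mul' _ _ (by by_cases hx : x ∈ cell n <;> simp [hx]),
      lintegral_sub_right_eq_self (fun z => (Set.Iic (0:ℝ)).indicator g z), lintegral_indicator measurableSet_Iic]
  simp only [h2]
  by_cases hI : ∫⁻ z in Set.Iic (0:ℝ), g z = ⊤
  · rw [hI]; exact le_top
  rw [lintegral_mul_const' _ _ hI, lintegral_indicator_one cell_meas, cell_vol, one_mul]

lemma SN_sq_int {h : (Fin n → ℝ) → ℝ} (hh : ContDiff ℝ (⊤ : ℕ∞) h) {W : ℕ → (Fin n → ℤ) → ℝ → ℂ} (hW : Nice W)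
    {f : (Fin n → ℤ) → LL} (hf : Rap f) (hfw : ∀ k, ∀ᵐ z : ℝ, z ≤ 0 → f k z = W 0 k z) :
    IntegrableOn (fun p => ‖Ph h W p‖^2) (fluidCell n h) := by
  refine ⟨(((Ph_contDiff hh hW).continuous.norm.pow 2).aestronglyMeasurable), ?_⟩
  have h1 : ∀ p : (Fin n → ℝ) × ℝ, ‖‖Ph h W p‖^2‖ₑ ≤
      ENNReal.ofReal (PP n) * ∑' k, ENNReal.ofReal ((1 + ‖k‖)^(2*n) * ‖W 0 k (p.2 - h p.1)‖^2) := by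
    intro p
    rw [Real.enorm_of_nonneg (by positivity)]
    have hr := hW.rap 0 (p.2 - h p.1)
    have hQ : Summable (fun k => (1 + ‖k‖)^(2*n) * ‖W 0 k (p.2 - h p.1)‖^2) := by
      obtain ⟨C, hC, hC'⟩ := hr.bdd
      refine Summable.of_nonneg_of_le (fun k => by positivity) (fun k => ?_) ((hr.summable (2*n)).mul_left C)
      have := hC' k
      calc (1 + ‖k‖)^(2*n) * ‖W 0 k (p.2 - h p.1)‖^2 = ‖W 0 k (p.2 - h p.1)‖ * ((1 + ‖k‖)^(2*n) * ‖W 0 k (p.2 - h p.1)‖) := by ring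
        _ ≤ _ := by gcongr
    rw [← ENNReal.ofReal_tsum_of_nonneg (fun k => by positivity) hQ, ← ENNReal.ofReal_mul PP_nonneg]
    exact ENNReal.ofReal_le_ofReal (ev_sq_le hr p.1)
  have hc : ∀ k, Continuous (W 0 k) := fun k => continuous_iff_continuousAt.2 fun z => (hW.deriv 0 k z).continuousAt
  calc _ ≤ ∫⁻ p in fluidCell n h, ENNReal.ofReal (PP n) * ∑' k, ENNReal.ofReal ((1 + ‖k‖)^(2*n) * ‖W 0 k (p.2 - h p.1)‖^2) :=
        lintegral_mono h1
    _ = ENNReal.ofReal (PP n) * ∫⁻ p in fluidCell n h, ∑' k, ENNReal.ofReal ((1 + ‖k‖)^(2*n) * ‖W 0 k (p.2 - h p.1)‖^2) :=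
        lintegral_const_mul' _ _ ENNReal.ofReal_ne_top
    _ ≤ ENNReal.ofReal (PP n) * ∫⁻ z in Set.Iic (0:ℝ), ∑' k, ENNReal.ofReal ((1 + ‖k‖)^(2*n) * ‖W 0 k z‖^2) := by
        gcongr
        exact shear_lintegral h hh.continuous (fun z => ∑' k, ENNReal.ofReal ((1 + ‖k‖)^(2*n) * ‖W 0 k z‖^2))
    _ < ⊤ := ENNReal.mul_lt_top ENNReal.ofReal_lt_top (lint_finite hf hc hfw)

section
variable {ψ c : (Fin n → ℤ) → ℂ} {F : Fin n → (Fin n → ℤ) → LL}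
    {b b1 : (Fin n → ℤ) → LL} {U : ℕ → (Fin n → ℤ) → ℝ → ℂ}
    {h : (Fin n → ℝ) → ℝ} (hh : ContDiff ℝ (⊤ : ℕ∞) h) (hp : Per h)
    (M : Modes (tf h) ψ c F b b1 U)
include hh hp M

lemma Modes.gradL2 : IntegrableOn (gradSqE n (Rh h (WW U))) (fluidCell n h) := by
  obtain ⟨C, hC⟩ : ∃ C : ℝ, ∀ i x, |pdX n h i x| ≤ C := by
    choose C hC using fun i => (pdX_per hp i).bounded (pdX_smooth hh i).continuous
    refine ⟨∑ i, |C i|, fun i x => ?_⟩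
    refine (hC i x).trans ((le_abs_self _).trans ?_)
    exact Finset.single_le_sum (f := fun i => |C i|) (fun _ _ => abs_nonneg _) (Finset.mem_univ i)
  have hb := SN_sq_int hh M.nice.sh M.rapb (fun k => (M.l2b k).mono fun z hz hz0 => by
    rw [hz hz0, shN, WW_eq U _ _ hz0])
  have hF := fun i => SN_sq_int hh (M.nice.d i) (M.rapF i) (fun k => (M.l2F i k).mono fun z hz hz0 => by
    rw [hz hz0, dN, WW_eq U _ _ hz0])
  have hs := Rh_contDiff hh M.nice
  have hcont : Continuous (gradSqE n (Rh h (WW U))) := by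
    unfold gradSqE pdE
    have h1 := hs.continuous_fderiv (by simp)
    fun_prop
  refine Integrable.mono' ((integrable_finsetSum Finset.univ fun i _ => (((hF i).const_mul 2).add (hb.const_mul (2*C^2)))).add hb)
    hcont.aestronglyMeasurable (Filter.Eventually.of_forall fun p => ?_)
  rw [gradSqE, Rh_eY hh M.nice, Real.norm_of_nonneg (by positivity)]
  refine add_le_add ?_ ?_
  ·
    refine Finset.sum_le_sum fun i _ => ?_
    rw [Rh_eX hh M.nice]
    have e1 : (Rh h (dN i (WW U)) p)^2 ≤ ‖Ph h (dN i (WW U)) p‖^2 := sq_le_sq' (by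
      have := Complex.abs_re_le_norm (Ph h (dN i (WW U)) p); rw [abs_le] at this; exact this.1) (Complex.re_le_norm _)
    have e2 : (Rh h (shN (WW U)) p)^2 ≤ ‖Ph h (shN (WW U)) p‖^2 := sq_le_sq' (by
      have := Complex.abs_re_le_norm (Ph h (shN (WW U)) p); rw [abs_le] at this; exact this.1) (Complex.re_le_norm _)
    have e3 : (pdX n h i p.1)^2 ≤ C^2 := by
      rw [← sq_abs]; gcongr; exact hC i p.1
    show (Rh h (dN i (WW U)) p - pdX n h i p.1 * Rh h (shN (WW U)) p)^2 ≤
      2 * ‖Ph h (dN i (WW U)) p‖^2 + 2*C^2 * ‖Ph h (shN (WW U)) p‖^2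
    have e4 : (pdX n h i p.1)^2 * (Rh h (shN (WW U)) p)^2 ≤ C^2 * ‖Ph h (shN (WW U)) p‖^2 := by gcongr
    nlinarith [sq_nonneg (Rh h (dN i (WW U)) p + pdX n h i p.1 * Rh h (shN (WW U)) p)]
  · exact sq_le_sq' (by
      have := Complex.abs_re_le_norm (Ph h (shN (WW U)) p); rw [abs_le] at this; exact this.1) (Complex.re_le_norm _)

lemma Modes.isExt : IsHarmonicExt n h (fun x => (ev x ψ).re) (Rh h (WW U)) := by
  refine ⟨Rh_contDiff hh M.nice, fun x y k => ?_, M.lap hh hp, fun x => ?_, M.gradL2 hh hp⟩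
  · simp only [Rh, Ph]
    rw [hp x k, SN_per]
  · simp only [Rh, Ph, SN, sub_self, WW_eq U _ _ le_rfl, M.bc]

end

/-- Fourier coefficients of the Dirichlet to Neumann map -/
def cf (t : Fin n → (Fin n → ℤ) → ℂ) (ψ : (Fin n → ℤ) → ℂ) (hψ : Rap ψ) : (Fin n → ℤ) → ℂ :=
  trk (A0 t (Fsol (A0 t) (Ps ψ hψ)))

lemma exists_modes_tf {h : (Fin n → ℝ) → ℝ} (hh : ContDiff ℝ (⊤ : ℕ∞) h) (hp : Per h) {ψ : (Fin n → ℤ) → ℂ} (hψ : Rap ψ) :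
    ∃ b1 U, Modes (tf h) ψ (cf (tf h) ψ hψ) (fun i k => Fsol (A0 (tf h)) (Ps ψ hψ) (some i) k)
      (fun k => Fsol (A0 (tf h)) (Ps ψ hψ) none k) b1 U := by
  obtain ⟨μ, hμ⟩ := isInv_tf hh hp
  exact exists_Modes (tf_rap hh hp) hμ hψ (exists_Sol (tf_cf hh hp) hψ)

lemma exists_ext {h : (Fin n → ℝ) → ℝ} (hh : ContDiff ℝ (⊤ : ℕ∞) h) (hp : Per h) {ψ : (Fin n → ℤ) → ℂ} (hψ : Rap ψ) :
    ∃ φ, IsHarmonicExt n h (fun x => (ev x ψ).re) φ ∧ ∀ x, pdE n φ (eY n) (x, h x)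
      - ∑ i, pdX n h i x * pdE n φ (eX n i) (x, h x) = (ev x (cf (tf h) ψ hψ)).re := by
  obtain ⟨b1, U, M⟩ := exists_modes_tf hh hp hψ
  exact ⟨_, M.isExt hh hp, M.normal hh hp hψ⟩

end ShapeD

namespace ShapeD

variable {n : ℕ}

lemma pdE_smooth {g : (Fin n → ℝ) × ℝ → ℝ} (hg : ContDiff ℝ (⊤ : ℕ∞) g) (v) : ContDiff ℝ (⊤ : ℕ∞) (pdE n g v) := by
  unfold pdE
  exact (hg.fderiv_right (m := (⊤ : ℕ∞)) (by simp)).clm_apply contDiff_const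

lemma pdE_per {g : (Fin n → ℝ) × ℝ → ℝ} (hg : ZPeriodicE n g) (v) : ZPeriodicE n (pdE n g v) := by
  intro x y k
  unfold pdE
  have : ((x + fun i => (k i : ℝ)), y) = (x, y) + ((fun i => (k i : ℝ)), (0:ℝ)) := by simp
  rw [this, ← fderiv_comp_add_right]
  congr 2
  ext p
  have := hg p.1 p.2 k
  rw [← this]
  congr 1
  ext <;> simp

lemma sl_hasDerivAt {g : (Fin n → ℝ) × ℝ → ℝ} (hg : ContDiff ℝ (⊤ : ℕ∞) g) (x : Fin n → ℝ) (y t : ℝ) :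
    HasDerivAt (fun t => g (x, y - t)) (-(pdE n g (eY n) (x, y - t))) t := by
  have h1 : HasDerivAt (fun t : ℝ => (x, y - t)) ((0 : Fin n → ℝ), (-1:ℝ)) t :=
    (hasDerivAt_const t x).prodMk ((hasDerivAt_id t).const_sub y)
  have h2 := (hg.differentiable (by simp) (x, y - t)).hasFDerivAt.comp_hasDerivAt t h1
  refine h2.congr_deriv ?_
  have : ((0 : Fin n → ℝ), (-1:ℝ)) = -(eY n) := by ext <;> simp [eY]
  rw [this, map_neg]; rfl

lemma sl_pdX {g : (Fin n → ℝ) × ℝ → ℝ} (hg : ContDiff ℝ (⊤ : ℕ∞) g) {h : (Fin n → ℝ) → ℝ}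
    (hh : ContDiff ℝ (⊤ : ℕ∞) h) (t : ℝ) (i : Fin n) (x : Fin n → ℝ) :
    pdX n (fun x => g (x, h x - t)) i x = pdE n g (eX n i) (x, h x - t) + pdX n h i x * pdE n g (eY n) (x, h x - t) := by
  have h1 : HasFDerivAt (fun x => (x, h x - t)) ((ContinuousLinearMap.id ℝ (Fin n → ℝ)).prod (fderiv ℝ h x)) x :=
    (hasFDerivAt_id x).prodMk ((hh.differentiable (by simp) x).hasFDerivAt.sub_const t)
  have h2 := (hg.differentiable (by simp) (x, h x - t)).hasFDerivAt.comp x h1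
  unfold pdX
  rw [show (fun x => g (x, h x - t)) = g ∘ (fun x => (x, h x - t)) from rfl, h2.fderiv]
  simp only [ContinuousLinearMap.comp_apply, ContinuousLinearMap.prod_apply, ContinuousLinearMap.id_apply]
  have : ((Pi.single i 1 : Fin n → ℝ), fderiv ℝ h x (Pi.single i 1)) = eX n i + (fderiv ℝ h x (Pi.single i 1)) • eY n := by
    ext <;> simp [eX, eY]
  rw [this, map_add, map_smul]; rfl

lemma integral_pdX {f : (Fin n → ℝ) → ℝ} (hf : Per f) (hs : ContDiff ℝ (⊤ : ℕ∞) f) (i : Fin n) :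
    ∫ x in cell n, pdX n f i x = 0 := by
  have := integral_pd (cx_per hf) (cx_smooth hs) i
  rw [pd_cx hs] at this
  simp only [cx] at this
  rw [integral_complex_ofReal] at this
  exact_mod_cast this

section
attribute [local instance] instMSCircle instHaarCircle instProbCircle

lemma cell_zero {f : (Fin n → ℝ) → ℝ} (hf : Per f) (hc : Continuous f) (h0 : ∀ x, 0 ≤ f x)
    (hi : ∫ x in cell n, f x = 0) (x) : f x = 0 := by
  have hct := continuous_tl hf hc
  have hnn : 0 ≤ tl f := fun t => h0 _
  rw [integral_cell_eq hf, integral_eq_zero_iff_of_nonneg hnn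
    (by simpa using hct.continuousOn.integrableOn_compact (μ := volume) isCompact_univ), Continuous.ae_eq_iff_eq volume hct continuous_zero] at hi
  rw [← tl_tp hf x, hi]; rfl

end

lemma pdE_mul {f g : (Fin n → ℝ) × ℝ → ℝ} (hf : ContDiff ℝ (⊤ : ℕ∞) f) (hg : ContDiff ℝ (⊤ : ℕ∞) g) (v p) :
    pdE n (fun p => f p * g p) v p = pdE n f v p * g p + f p * pdE n g v p := by
  unfold pdE
  rw [fderiv_fun_mul (hf.differentiable (by simp) p) (hg.differentiable (by simp) p)]
  simp; ring

lemma shear_int {h : (Fin n → ℝ) → ℝ} (hh : Continuous h) {g : (Fin n → ℝ) × ℝ → ℝ}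
    (hg : IntegrableOn g (fluidCell n h)) : IntegrableOn (fun t => ∫ x in cell n, g (x, h x - t)) (Set.Ioi (0:ℝ)) := by
  have mp : MeasurePreserving (fun p : (Fin n → ℝ) × ℝ => (p.1, h p.1 - p.2)) (volume.prod volume) (volume.prod volume) :=
    (MeasurePreserving.id volume).skew_product (g := fun x y => h x - y) (by fun_prop)
      (Filter.Eventually.of_forall fun x => Measure.map_sub_left_eq_self volume (h x))
  have h2 := (mp.restrict_preimage (fluid_meas hh)).integrable_comp_of_integrable hg
  have h3 : (fun p : (Fin n → ℝ) × ℝ => (p.1, h p.1 - p.2)) ⁻¹' (fluidCell n h) = cell n ×ˢ Set.Ioi (0:ℝ) := by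
    ext p; simp [fluidCell]
  rw [h3, ← Measure.prod_restrict] at h2
  exact h2.integral_prod_right

/-- real-variable core of the uniqueness argument -/
lemma energy_zero {e D N K P : ℝ → ℝ} {C : ℝ} (hC : 0 < C) (he : ∀ t, HasDerivAt e (K t) t)
    (hK : ∀ t, 0 < t → K t = D t) (hD : ∀ t, 0 ≤ D t)
    (hN : ∀ t, HasDerivAt N (P t) t) (hN0 : N 0 = 0) (he0 : e 0 = 0)
    (hNP : ∀ t a, 0 < a → P t ≤ N t / a + a * D t)
    (heD : ∀ t a, 0 < a → e t ≤ a * C * D t + N t / (2 * a)) (hNn : ∀ t, 0 ≤ N t)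
    (hint : IntegrableOn D (Set.Ioi 0)) : ∀ t, 0 < t → D t = 0 := by
  have mono : MonotoneOn e (Set.Ici 0) := by
    refine monotoneOn_of_hasDerivWithinAt_nonneg (convex_Ici 0) (fun t _ => (he t).continuousAt.continuousWithinAt)
      (fun t _ => (he t).hasDerivWithinAt) (fun t ht => ?_)
    rw [interior_Ici] at ht
    rw [hK t ht]; exact hD t
  have enn : ∀ t, 0 ≤ t → 0 ≤ e t := fun t ht => by
    have := mono (Set.mem_Ici.2 le_rfl) (Set.mem_Ici.2 ht) ht
    rwa [he0] at this
  have Nle : ∀ t, 0 < t → N t ≤ 3 * t * e t := by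
    intro t ht
    have hm : MonotoneOn (fun s => t * e s - Real.exp (-(s/t)) * N s) (Set.Ici 0) := by
      have hd : ∀ s, HasDerivAt (fun s => t * e s - Real.exp (-(s/t)) * N s)
          (t * K s - ((Real.exp (-(s/t)) * (-(1/t))) * N s + Real.exp (-(s/t)) * P s)) s := fun s =>
        ((he s).const_mul t).sub ((((hasDerivAt_id s).div_const t).neg.exp).mul (hN s))
      refine monotoneOn_of_hasDerivWithinAt_nonneg (convex_Ici 0) (fun t _ => (hd t).continuousAt.continuousWithinAt)
        (fun t _ => (hd t).hasDerivWithinAt) (fun s hs => ?_)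
      rw [interior_Ici] at hs
      have hs : 0 < s := hs
      rw [hK s hs]
      have h1 : Real.exp (-(s/t)) ≤ 1 := Real.exp_le_one_iff.2 (by have : 0 < s/t := by positivity
                                                                   linarith)
      have h2 := hNP s t ht
      have h3 : Real.exp (-(s/t)) * P s ≤ Real.exp (-(s/t)) * (N s / t + t * D s) := by gcongr
      have h4 : Real.exp (-(s/t)) * (t * D s) ≤ 1 * (t * D s) := by
        have := hD s
        gcongr
      have h5 : Real.exp (-(s/t)) * (-(1/t)) * N s = - (Real.exp (-(s/t)) * (N s / t)) := by ring
      rw [h5]; nlinarith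
    have h1 := hm (Set.mem_Ici.2 le_rfl) (Set.mem_Ici.2 ht.le) ht.le
    simp only [he0, hN0, mul_zero, sub_zero, div_self ht.ne'] at h1
    have h2 : Real.exp 1 * Real.exp (-1) = 1 := by rw [← Real.exp_add]; simp
    have h3 : Real.exp 1 ≤ 3 := by have := Real.exp_one_lt_d9; linarith
    have h4 : N t ≤ Real.exp 1 * (t * e t) := by
      calc N t = Real.exp 1 * (Real.exp (-1) * N t) := by rw [← mul_assoc, h2, one_mul]
        _ ≤ _ := mul_le_mul_of_nonneg_left (by linarith) (Real.exp_pos 1).le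
    have h5 : 0 ≤ t * e t := mul_nonneg ht.le (enn t ht.le)
    nlinarith
  have eD : ∀ t, 0 < t → e t ≤ 6 * C * t * D t := by
    intro t ht
    have h1 := heD t (3*t) (by positivity)
    have h2 : N t / (2 * (3 * t)) ≤ e t / 2 := by
      rw [div_le_iff₀ (by positivity)]
      have := Nle t ht
      linarith
    linarith
  obtain ⟨B, hB⟩ : ∃ B, ∀ t, 0 ≤ t → e t ≤ B := by
    refine ⟨∫ s in Set.Ioi 0, D s, fun t ht => ?_⟩
    have hi : IntervalIntegrable D volume 0 t := by
      rw [intervalIntegrable_iff_integrableOn_Ioc_of_le ht]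
      exact hint.mono_set Set.Ioc_subset_Ioi_self
    have h1 := intervalIntegral.integral_eq_sub_of_hasDerivAt_of_le ht
      (fun s _ => (he s).continuousAt.continuousWithinAt) (f' := D)
      (fun s hs => by have := he s; rwa [hK s hs.1] at this) hi
    rw [he0, sub_zero] at h1
    rw [← h1, intervalIntegral.integral_of_le ht]
    exact setIntegral_mono_set hint (Filter.Eventually.of_forall hD) Set.Ioc_subset_Ioi_self.eventuallyLE
  have ez : ∀ t, 0 < t → e t = 0 := by
    intro t ht
    by_contra hne
    have hpos : 0 < e t := lt_of_le_of_ne (enn t ht.le) (Ne.symm hne)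
    set κ := e t / (6 * C) with hκ
    have hκ0 : 0 < κ := by positivity
    have hm : MonotoneOn (fun s => e s - κ * Real.log s) (Set.Ici t) := by
      have hd : ∀ s, 0 < s → HasDerivAt (fun s => e s - κ * Real.log s) (K s - κ * s⁻¹) s := fun s hs =>
        (he s).sub ((Real.hasDerivAt_log hs.ne').const_mul κ)
      refine monotoneOn_of_hasDerivWithinAt_nonneg (convex_Ici t)
        (fun s hs => (hd s (ht.trans_le hs)).continuousAt.continuousWithinAt)
        (fun s hs => (hd s (ht.trans_le (interior_subset hs))).hasDerivWithinAt) (fun s hs => ?_)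
      have hs' := interior_subset hs
      have hs0 := ht.trans_le hs'
      rw [hK s hs0]
      have h1 := eD s hs0
      have h2 : e t ≤ e s := mono (Set.mem_Ici.2 ht.le) (Set.mem_Ici.2 hs0.le) hs'
      have h3 : κ * s⁻¹ ≤ D s := by
        rw [hκ, ← div_eq_mul_inv, div_div, div_le_iff₀ (by positivity)]
        linarith
      linarith
    have hlog := Real.tendsto_log_atTop
    obtain ⟨s, hs1, hs2⟩ := ((hlog.eventually_gt_atTop ((B - e t + κ * Real.log t)/κ)).and (Filter.eventually_ge_atTop t)).exists
    have h1 := hm (Set.mem_Ici.2 le_rfl) (Set.mem_Ici.2 hs2) hs2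
    simp only at h1
    have h2 := hB s (ht.le.trans hs2)
    rw [div_lt_iff₀ hκ0] at hs1
    linarith
  intro t ht
  have h1 : HasDerivAt e 0 t := (hasDerivAt_const t (0:ℝ)).congr_of_eventuallyEq
    (Filter.mem_of_superset (Ioi_mem_nhds ht) (fun s hs => ez s hs))
  rw [← hK t ht]
  exact (he t).unique h1

end ShapeD

namespace ShapeD

variable {n : ℕ}

lemma gradSqE_cont {g : (Fin n → ℝ) × ℝ → ℝ} (hg : ContDiff ℝ (⊤ : ℕ∞) g) : Continuous (gradSqE n g) := by
  unfold gradSqE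
  have h1 := fun v => (pdE_smooth hg v).continuous
  fun_prop

lemma sl_per {g : (Fin n → ℝ) × ℝ → ℝ} (hg : ZPeriodicE n g) {h : (Fin n → ℝ) → ℝ} (hp : Per h) (t : ℝ) :
    Per (fun x => g (x, h x - t)) := fun x k => by
  simp only
  rw [hp x k, hg]

lemma grad_zero {h : (Fin n → ℝ) → ℝ} (hh : ContDiff ℝ (⊤ : ℕ∞) h) (hp : Per h)
    {w : (Fin n → ℝ) × ℝ → ℝ} (hw : ContDiff ℝ (⊤ : ℕ∞) w) (hwp : ZPeriodicE n w)
    (hlap : ∀ p : (Fin n → ℝ) × ℝ, p.2 < h p.1 → lapE n w p = 0) (hb : ∀ x, w (x, h x) = 0)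
    (hint : IntegrableOn (gradSqE n w) (fluidCell n h)) (x : Fin n → ℝ) : gradSqE n w (x, h x) = 0 := by
  set wy := pdE n w (eY n) with hwy
  set wx := fun i => pdE n w (eX n i) with hwx
  have hwys : ContDiff ℝ (⊤ : ℕ∞) wy := pdE_smooth hw _
  have hwxs : ∀ i, ContDiff ℝ (⊤ : ℕ∞) (wx i) := fun i => pdE_smooth hw _
  have hwc := hw.continuous
  have hwyc := hwys.continuous
  have hwxc := fun i => (hwxs i).continuous
  have hwyyc := (pdE_smooth hwys (eY n)).continuous
  have hwxyc := fun i => (pdE_smooth (hwxs i) (eY n)).continuous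
  have hhc := hh.continuous
  have hac := fun i => (pdX_smooth hh i).continuous
  have hGc := gradSqE_cont hw
  have hGn : ∀ p, 0 ≤ gradSqE n w p := fun p => by unfold gradSqE; positivity
  obtain ⟨C, hC⟩ : ∃ C : ℝ, ∀ x, ∑ i, (pdX n h i x)^2 ≤ C := by
    obtain ⟨C, hC⟩ := Per.bounded (f := fun x => ∑ i, (pdX n h i x)^2) (fun x k => by
      simp only [fun i => pdX_per hp i x k]) (by fun_prop)
    exact ⟨C, fun x => (le_abs_self _).trans (hC x)⟩
  have hC0 : 0 ≤ C := (Finset.sum_nonneg fun i _ => sq_nonneg _).trans (hC 0)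
  have key := energy_zero (C := 1 + C)
    (e := fun t => ∫ x in cell n, -((wy (x, h x - t) - ∑ i, pdX n h i x * wx i (x, h x - t)) * w (x, h x - t)))
    (D := fun t => ∫ x in cell n, gradSqE n w (x, h x - t))
    (N := fun t => ∫ x in cell n, (w (x, h x - t))^2)
    (K := fun t => ∫ x in cell n, ((pdE n wy (eY n) (x, h x - t) - ∑ i, pdX n h i x * pdE n (wx i) (eY n) (x, h x - t)) * w (x, h x - t)
      + (wy (x, h x - t) - ∑ i, pdX n h i x * wx i (x, h x - t)) * wy (x, h x - t)))
    (P := fun t => ∫ x in cell n, -(2 * w (x, h x - t) * wy (x, h x - t)))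
    (by linarith) ?_ ?_ ?_ ?_ ?_ ?_ ?_ ?_ ?_ ?_
  · have hz : ∀ t, 0 < t → gradSqE n w (x, h x - t) = 0 := fun t ht => by
      refine cell_zero (f := fun x => gradSqE n w (x, h x - t)) ?_ (by fun_prop) (fun x => hGn _) (key t ht) x
      refine sl_per (fun x y k => ?_) hp t
      simp only [gradSqE, pdE_per hwp _ x y k]
    have hc : Continuous (fun t => gradSqE n w (x, h x - t)) := by fun_prop
    have h1 : Filter.Tendsto (fun t => gradSqE n w (x, h x - t)) (nhdsWithin 0 (Set.Ioi 0)) (nhds (gradSqE n w (x, h x))) := by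
      have := (hc.tendsto 0).mono_left (nhdsWithin_le_nhds (s := Set.Ioi 0))
      simpa using this
    refine tendsto_nhds_unique h1 ((tendsto_const_nhds (x := (0:ℝ))).congr' ?_)
    filter_upwards [self_mem_nhdsWithin] with t ht
    exact (hz t ht).symm
  · -- derivative of e
    intro t
    refine hasDerivAt_integral_cell
      (F := fun x t => -((wy (x, h x - t) - ∑ i, pdX n h i x * wx i (x, h x - t)) * w (x, h x - t)))
      (F' := fun x t => ((pdE n wy (eY n) (x, h x - t) - ∑ i, pdX n h i x * pdE n (wx i) (eY n) (x, h x - t)) * w (x, h x - t)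
      + (wy (x, h x - t) - ∑ i, pdX n h i x * wx i (x, h x - t)) * wy (x, h x - t)))
      (by simp only [Function.uncurry_def]; fun_prop) (by simp only [Function.uncurry_def]; fun_prop) (fun x t => ?_) t
    have h1 := (((sl_hasDerivAt hwys x (h x) t).sub (HasDerivAt.fun_sum (u := Finset.univ) fun i _ =>
      (sl_hasDerivAt (hwxs i) x (h x) t).const_mul (pdX n h i x))).mul (sl_hasDerivAt hw x (h x) t)).neg
    refine h1.congr_deriv ?_
    simp only [mul_neg, Finset.sum_neg_distrib, Pi.sub_apply]
    ring
  · -- Green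
    intro t ht
    have h0 : ∀ i, ∫ x in cell n, pdX n (fun x => wx i (x, h x - t) * w (x, h x - t)) i x = 0 := fun i => by
      refine integral_pdX ?_ ?_ i
      · exact fun x k => by
          have h1 := sl_per (pdE_per hwp (eX n i)) hp t x k
          have h2 := sl_per hwp hp t x k
          simp only at h1 h2 ⊢
          rw [h2]; exact congrArg (· * _) h1
      · have := hwxs i
        fun_prop
    have h1 : ∀ x, gradSqE n w (x, h x - t) = ((pdE n wy (eY n) (x, h x - t) - ∑ i, pdX n h i x * pdE n (wx i) (eY n) (x, h x - t)) * w (x, h x - t)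
      + (wy (x, h x - t) - ∑ i, pdX n h i x * wx i (x, h x - t)) * wy (x, h x - t)) +
        ∑ i, pdX n (fun x => wx i (x, h x - t) * w (x, h x - t)) i x := by
      intro x
      have hl := hlap (x, h x - t) (by simp only; linarith)
      unfold lapE at hl
      have h2 : ∀ i, pdX n (fun x => wx i (x, h x - t) * w (x, h x - t)) i x =
          pdE n (wx i) (eX n i) (x, h x - t) * w (x, h x - t) + wx i (x, h x - t) * wx i (x, h x - t)
          + pdX n h i x * pdE n (wx i) (eY n) (x, h x - t) * w (x, h x - t) + pdX n h i x * wx i (x, h x - t) * wy (x, h x - t) := fun i => by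
        rw [sl_pdX (g := fun p => wx i p * w p) ((hwxs i).mul hw) hh, pdE_mul (hwxs i) hw, pdE_mul (hwxs i) hw]
        simp only [hwx, hwy]; ring
      simp only [h2, Finset.sum_add_distrib, ← Finset.sum_mul]
      have h3 : pdE n wy (eY n) (x, h x - t) = - ∑ i, pdE n (wx i) (eX n i) (x, h x - t) := by
        simp only [hwx, hwy]; linarith
      rw [h3, gradSqE]
      simp only [pow_two]
      simp only [hwx, hwy]
      ring
    simp only [h1]
    have hci : ∀ i, Continuous (fun x => pdX n (fun x => wx i (x, h x - t) * w (x, h x - t)) i x) := fun i => by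
      refine (pdX_smooth ?_ i).continuous
      have := hwxs i
      fun_prop
    symm
    rw [integral_add (integrableOn_cell (by fun_prop)) (integrableOn_cell (by fun_prop)),
      integral_finsetSum _ (fun i _ => integrableOn_cell (hci i))]
    simp [h0]
  · intro t; exact integral_nonneg fun x => hGn _
  · -- derivative of N
    intro t
    refine hasDerivAt_integral_cell
      (F := fun x t => (w (x, h x - t))^2)
      (F' := fun x t => -(2 * w (x, h x - t) * wy (x, h x - t)))
      (by simp only [Function.uncurry_def]; fun_prop) (by simp only [Function.uncurry_def]; fun_prop) (fun x t => ?_) t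
    refine ((sl_hasDerivAt hw x (h x) t).pow 2).congr_deriv ?_
    simp [hwy]
  · simp [hb]
  · simp [hb]
  · intro t a ha
    show ∫ x in cell n, -(2 * w (x, h x - t) * wy (x, h x - t)) ≤ (∫ x in cell n, (w (x, h x - t))^2) / a + a * ∫ x in cell n, gradSqE n w (x, h x - t)
    rw [← integral_div, ← integral_const_mul, ← integral_add (integrableOn_cell (by fun_prop)) (integrableOn_cell (by fun_prop))]
    refine integral_mono (integrableOn_cell (by fun_prop)) (integrableOn_cell (by fun_prop)) fun x => ?_
    simp only
    have h1 : (wy (x, h x - t))^2 ≤ gradSqE n w (x, h x - t) := by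
      unfold gradSqE; simp only [hwy]
      have : 0 ≤ ∑ i, (pdE n w (eX n i) (x, h x - t))^2 := by positivity
      linarith
    have h2 : 0 ≤ (w (x, h x - t) + a * wy (x, h x - t))^2 / a := by positivity
    have h3 : (w (x, h x - t) + a * wy (x, h x - t))^2 / a = (w (x, h x - t))^2 / a + 2 * w (x, h x - t) * wy (x, h x - t) + a * (wy (x, h x - t))^2 := by
      field_simp; ring
    nlinarith
  · intro t a ha
    show ∫ x in cell n, -((wy (x, h x - t) - ∑ i, pdX n h i x * wx i (x, h x - t)) * w (x, h x - t)) ≤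
      a * (1 + C) * (∫ x in cell n, gradSqE n w (x, h x - t)) + (∫ x in cell n, (w (x, h x - t))^2) / (2*a)
    rw [← integral_div, ← integral_const_mul, ← integral_add (integrableOn_cell (by fun_prop)) (integrableOn_cell (by fun_prop))]
    refine integral_mono (integrableOn_cell (by fun_prop)) (integrableOn_cell (by fun_prop)) fun x => ?_
    simp only
    set S := ∑ i, pdX n h i x * wx i (x, h x - t) with hS
    set y := wy (x, h x - t) with hy
    set z := w (x, h x - t) with hz
    have h1 : S^2 ≤ C * ∑ i, (wx i (x, h x - t))^2 := by
      refine (Finset.sum_mul_sq_le_sq_mul_sq _ _ _).trans ?_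
      gcongr
      exact hC x
    have hG : gradSqE n w (x, h x - t) = (∑ i, (wx i (x, h x - t))^2) + y^2 := rfl
    have hX : 0 ≤ ∑ i, (wx i (x, h x - t))^2 := by positivity
    have h2 : (y - S)^2 ≤ 2 * (1 + C) * gradSqE n w (x, h x - t) := by
      rw [hG]; nlinarith [sq_nonneg (y + S), mul_nonneg hC0 (sq_nonneg y)]
    have h3 : 0 ≤ (z + a * (y - S))^2 / (2*a) := by positivity
    have h4 : (z + a * (y - S))^2 / (2*a) = z^2/(2*a) + (y - S) * z + a * ((y - S)^2/2) := by
      field_simp; ring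
    have h5 : a * ((y-S)^2/2) ≤ a * ((1 + C) * gradSqE n w (x, h x - t)) := by
      gcongr; linarith
    nlinarith
  · intro t; exact integral_nonneg fun x => sq_nonneg _
  · exact shear_int hhc hint

lemma pdE_sub {f g : (Fin n → ℝ) × ℝ → ℝ} (hf : ContDiff ℝ (⊤ : ℕ∞) f) (hg : ContDiff ℝ (⊤ : ℕ∞) g) (v) :
    pdE n (fun p => f p - g p) v = fun p => pdE n f v p - pdE n g v p := by
  ext p
  unfold pdE
  rw [fderiv_fun_sub (hf.differentiable (by simp) p) (hg.differentiable (by simp) p)]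
  simp

lemma ext_unique {h ψ : (Fin n → ℝ) → ℝ} (hh : ContDiff ℝ (⊤ : ℕ∞) h) (hp : Per h) {φ₁ φ₂ : (Fin n → ℝ) × ℝ → ℝ}
    (h1 : IsHarmonicExt n h ψ φ₁) (h2 : IsHarmonicExt n h ψ φ₂) (x : Fin n → ℝ) :
    pdE n φ₁ (eY n) (x, h x) = pdE n φ₂ (eY n) (x, h x) ∧ ∀ i, pdE n φ₁ (eX n i) (x, h x) = pdE n φ₂ (eX n i) (x, h x) := by
  have hw : ContDiff ℝ (⊤ : ℕ∞) (fun p => φ₁ p - φ₂ p) := h1.smooth.sub h2.smooth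
  have hsub := pdE_sub h1.smooth h2.smooth
  have := grad_zero hh hp hw (fun x y k => by simp only [h1.periodic x y k, h2.periodic x y k])
    (fun p hp => by
      have e1 := h1.harmonic p hp
      have e2 := h2.harmonic p hp
      unfold lapE at e1 e2 ⊢
      simp only [hsub, pdE_sub (pdE_smooth h1.smooth _) (pdE_smooth h2.smooth _), Finset.sum_sub_distrib]
      linarith) (fun x => by rw [h1.boundary, h2.boundary, sub_self])
    (by
      refine Integrable.mono' ((h1.gradL2.const_mul 2).add (h2.gradL2.const_mul 2)) (gradSqE_cont hw).aestronglyMeasurable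
        (Filter.Eventually.of_forall fun p => ?_)
      rw [Real.norm_of_nonneg (by unfold gradSqE; positivity)]
      show _ ≤ 2 * gradSqE n φ₁ p + 2 * gradSqE n φ₂ p
      have e : ∀ v, (pdE n (fun p => φ₁ p - φ₂ p) v p)^2 ≤ 2 * (pdE n φ₁ v p)^2 + 2 * (pdE n φ₂ v p)^2 := fun v => by
        rw [hsub]; nlinarith [sq_nonneg (pdE n φ₁ v p + pdE n φ₂ v p)]
      have e' := Finset.sum_le_sum (s := Finset.univ) fun i _ => e (eX n i)
      have e'' := e (eY n)
      simp only [Finset.sum_add_distrib, ← Finset.mul_sum] at e'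
      unfold gradSqE
      linarith) x
  unfold gradSqE at this
  rw [add_eq_zero_iff_of_nonneg (by positivity) (by positivity), Finset.sum_eq_zero_iff_of_nonneg (fun i _ => sq_nonneg _)] at this
  simp only [hsub] at this
  refine ⟨?_, fun i => ?_⟩
  · have := this.2
    rw [sq_eq_zero_iff, sub_eq_zero] at this; exact this
  · have := this.1 i (Finset.mem_univ i)
    rw [sq_eq_zero_iff, sub_eq_zero] at this; exact this

/-- The Dirichlet to Neumann map in terms of Fourier coefficients. -/
lemma DtN_eq {h : (Fin n → ℝ) → ℝ} (hh : ContDiff ℝ (⊤ : ℕ∞) h) (hp : Per h) {ψ : (Fin n → ℤ) → ℂ} (hψ : Rap ψ)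
    (x : Fin n → ℝ) : DtN n h (fun x => (ev x ψ).re) x = (ev x (cf (tf h) ψ hψ)).re := by
  obtain ⟨φ, h1, h2⟩ := exists_ext hh hp hψ
  have H : ∃ φ, IsHarmonicExt n h (fun x => (ev x ψ).re) φ := ⟨φ, h1⟩
  rw [DtN, dif_pos H, ← h2]
  have h3 := ext_unique hh hp H.choose_spec h1 x
  rw [h3.1]
  simp only [h3.2]

lemma DtN_eq' {h ψ : (Fin n → ℝ) → ℝ} (hh : ContDiff ℝ (⊤ : ℕ∞) h) (hp : Per h) (hψ : ContDiff ℝ (⊤ : ℕ∞) ψ) (hψp : Per ψ)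
    (x : Fin n → ℝ) : DtN n h ψ x = (ev x (cf (tf h) (fc (cx ψ)) (fc_rap (cx_per hψp) (cx_smooth hψ)))).re := by
  rw [← DtN_eq hh hp]
  congr 1
  ext x
  rw [ev_fc (cx_per hψp) (cx_smooth hψ)]
  simp [cx]

end ShapeD

namespace ShapeD

variable {n : ℕ}

section abstractD
variable {H : Type*} [NormedAddCommGroup H] [InnerProductSpace ℂ H] [CompleteSpace H]

/-- derivative of `Aop` -/
def dA (T Z : Fin n → H →L[ℂ] H) : EE n H →L[ℂ] EE n H :=
  -(CT Z * (1 - RT T)) - (1 - CT T) * RT Z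

lemma dA_some (T Z : Fin n → H →L[ℂ] H) (F : EE n H) (i) :
    dA T Z F (some i) = - Z i (F none) := by
  simp [dA]

lemma dA_none (T Z : Fin n → H →L[ℂ] H) (F : EE n H) :
    dA T Z F none = - ∑ i, Z i (F (some i) - T i (F none)) + ∑ i, T i (Z i (F none)) := by
  simp [dA]

lemma mapE_dA (S : H →L[ℂ] H) (T Ts Z Zs : Fin n → H →L[ℂ] H) (h : ∀ i x, S (Ts i x) = T i (S x))
    (h' : ∀ i x, S (Zs i x) = Z i (S x)) (F : EE n H) :
    mapE S (dA Ts Zs F) = dA T Z (mapE S F) := by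
  ext j
  cases j with
  | none => simp [dA_none, h, h']
  | some i => simp [dA_some, h']

lemma Aop_hasDerivAt (T Z : Fin n → H →L[ℂ] H) :
    HasDerivAt (fun ε : ℂ => Aop (fun i => T i + ε • Z i)) (dA T Z) 0 := by
  have h1 : HasDerivAt (fun ε : ℂ => (1 : EE n H →L[ℂ] EE n H) - CT (fun i => T i + ε • Z i))
      (-CT Z) 0 := by
    simp only [CT_affine]
    have := (((hasDerivAt_id (0:ℂ)).smul_const (CT Z)).const_add (CT T)).const_sub
      (1 : EE n H →L[ℂ] EE n H)
    simpa using this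
  have h2 : HasDerivAt (fun ε : ℂ => (1 : EE n H →L[ℂ] EE n H) - RT (fun i => T i + ε • Z i))
      (-RT Z) 0 := by
    simp only [RT_affine]
    have := (((hasDerivAt_id (0:ℂ)).smul_const (RT Z)).const_add (RT T)).const_sub
      (1 : EE n H →L[ℂ] EE n H)
    simpa using this
  have h3 := h1.mul h2
  refine h3.congr_deriv ?_
  simp only [zero_smul, add_zero]
  ext F j
  cases j <;> simp [dA, sub_eq_add_neg]

variable (V : Submodule ℂ (EE n H)) [V.HasOrthogonalProjection]

lemma Bop'_hasDerivAt {A : ℂ → EE n H →L[ℂ] EE n H} {A' : EE n H →L[ℂ] EE n H}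
    (hA : HasDerivAt A A' 0) :
    HasDerivAt (fun ε => Bop' V (A ε)) (PV V * A' * PV V) 0 :=
  ((hA.const_mul (PV V)).mul_const (PV V)).add_const (1 - PV V)

lemma Bop'_eventually {A : ℂ → EE n H →L[ℂ] EE n H} {A' : EE n H →L[ℂ] EE n H}
    (hA : HasDerivAt A A' 0) (hu : IsUnit (Bop' V (A 0))) :
    ∀ᶠ ε in nhds (0:ℂ), IsUnit (Bop' V (A ε)) :=
  (Bop'_hasDerivAt V hA).continuousAt.eventually (Units.isOpen.mem_nhds hu)

lemma Gsol_diff {A : ℂ → EE n H →L[ℂ] EE n H} {A' : EE n H →L[ℂ] EE n H}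
    (hA : HasDerivAt A A' 0) (hu : IsUnit (Bop' V (A 0))) (Ψ : EE n H) :
    DifferentiableAt ℂ (fun ε => Gsol V (A ε) Ψ) 0 := by
  have hi : DifferentiableAt ℂ (fun ε => Ring.inverse (Bop' V (A ε))) 0 := by
    have h1 : DifferentiableAt ℂ (Ring.inverse : (EE n H →L[ℂ] EE n H) → _) (Bop' V (A 0)) :=
      differentiableAt_inverse hu
    exact DifferentiableAt.comp (0:ℂ) (f := fun ε => Bop' V (A ε)) h1
      (Bop'_hasDerivAt V hA).differentiableAt
  have h2 : DifferentiableAt ℂ (fun ε => A ε Ψ) 0 :=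
    hA.differentiableAt.clm_apply (differentiableAt_const Ψ)
  have h3 : DifferentiableAt ℂ (fun ε => PV V (A ε Ψ)) 0 :=
    (PV V).differentiableAt.comp (0:ℂ) h2
  exact hi.clm_apply h3

lemma abs_deriv {A : ℂ → EE n H →L[ℂ] EE n H} {A' : EE n H →L[ℂ] EE n H} (hA : HasDerivAt A A' 0)
    (hu : IsUnit (Bop' V (A 0))) (Ψ : EE n H) :
    ∃ F' : EE n H, F' ∈ V ∧ HasDerivAt (fun ε => Ψ - Gsol V (A ε) Ψ) F' 0 ∧
      PV V (A' (Ψ - Gsol V (A 0) Ψ) + A 0 F') = 0 := by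
  have hev := Bop'_eventually V hA hu
  obtain ⟨G', hG'⟩ : ∃ G', HasDerivAt (fun ε => Gsol V (A ε) Ψ) G' 0 :=
    ⟨_, (Gsol_diff V hA hu Ψ).hasDerivAt⟩
  have hF : HasDerivAt (fun ε => Ψ - Gsol V (A ε) Ψ) (-G') 0 := hG'.const_sub Ψ
  refine ⟨-G', ?_, hF, ?_⟩
  · have h1 : HasDerivAt (fun ε => PV V (Gsol V (A ε) Ψ)) (PV V G') 0 :=
      (PV V).hasFDerivAt.comp_hasDerivAt (0:ℂ) hG'
    have h2 : (fun ε => PV V (Gsol V (A ε) Ψ)) =ᶠ[nhds 0] (fun ε => Gsol V (A ε) Ψ) := by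
      filter_upwards [hev] with ε hε
      exact Gsol_mem _ hε Ψ
    have h3 := (hG'.congr_of_eventuallyEq h2).unique h1
    rw [h3]
    exact V.neg_mem (Submodule.starProjection_apply_mem _ _)
  · have h1 : HasDerivAt (fun ε => PV V (A ε (Ψ - Gsol V (A ε) Ψ)))
        (PV V (A' (Ψ - Gsol V (A 0) Ψ) + A 0 (-G'))) 0 :=
      (PV V).hasFDerivAt.comp_hasDerivAt (0:ℂ) (hA.clm_apply hF)
    have h2 : (fun ε => PV V (A ε (Ψ - Gsol V (A ε) Ψ))) =ᶠ[nhds 0] (fun ε => (0 : EE n H)) := by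
      filter_upwards [hev] with ε hε
      exact Gsol_orth V hε Ψ
    exact h1.unique ((hasDerivAt_const (0:ℂ) (0 : EE n H)).congr_of_eventuallyEq h2)

lemma abs_deriv' {A : ℂ → EE n H →L[ℂ] EE n H} {A' : EE n H →L[ℂ] EE n H} (hA : HasDerivAt A A' 0)
    (hu : IsUnit (Bop' V (A 0))) (Ψ : EE n H) (Λ : EE n H →L[ℂ] ℂ) :
    ∃ F' : EE n H, F' ∈ V ∧ PV V (A' (Ψ - Gsol V (A 0) Ψ) + A 0 F') = 0 ∧
      HasDerivAt (fun ε : ℝ => (Λ (A ε (Ψ - Gsol V (A ε) Ψ))).re)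
        (Λ (A' (Ψ - Gsol V (A 0) Ψ) + A 0 F')).re 0 := by
  obtain ⟨F', h1, h2, h3⟩ := abs_deriv V hA hu Ψ
  refine ⟨F', h1, h3, ?_⟩
  have h4 : HasDerivAt (fun ε => Λ (A ε (Ψ - Gsol V (A ε) Ψ)))
      (Λ (A' (Ψ - Gsol V (A 0) Ψ) + A 0 F')) 0 :=
    Λ.hasFDerivAt.comp_hasDerivAt (0:ℂ) (hA.clm_apply h2)
  have h5 : HasDerivAt (fun ε => Λ (A ε (Ψ - Gsol V (A ε) Ψ)))
      (Λ (A' (Ψ - Gsol V (A 0) Ψ) + A 0 F')) ((0:ℝ):ℂ) := by rw [Complex.ofReal_zero]; exact h4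
  exact h5.real_of_complex

lemma Bop'_eventually' {A : ℂ → EE n H →L[ℂ] EE n H} {A' : EE n H →L[ℂ] EE n H}
    (hA : HasDerivAt A A' 0) (hu : IsUnit (Bop' V (A 0))) :
    ∀ᶠ ε : ℝ in nhds 0, IsUnit (Bop' V (A (ε : ℂ))) := by
  have hc : Filter.Tendsto (fun ε : ℝ => (ε : ℂ)) (nhds 0) (nhds 0) := by
    have := Complex.continuous_ofReal.tendsto 0
    simpa using this
  exact hc.eventually (Bop'_eventually V hA hu)

end abstractD

/-- `trk` as a continuous linear map -/
def trkL (k : Fin n → ℤ) : E' n →L[ℂ] ℂ :=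
  (innerSL ℂ (chi (-1))).comp (cmp none k) +
    (innerSL ℂ (pp (-1))).comp (-∑ i, dk i k • cmp (some i) k)

lemma trkL_apply (k : Fin n → ℤ) (M : E' n) : trkL k M = trk M k := by
  simp [trkL, trk, tr, sum_apply, inner_sum, inner_smul_right]

lemma trk_add (M N : E' n) (k) : trk (M + N) k = trk M k + trk N k := by
  simp only [← trkL_apply, map_add]

lemma trk_sub (M N : E' n) (k) : trk (M - N) k = trk M k - trk N k := by
  simp only [← trkL_apply, map_sub]

lemma trk_bound : ∃ C : ℝ, 0 ≤ C ∧ ∀ k (M : E' n), ‖trk M k‖ ≤ C * (1 + ‖k‖) * ‖M‖ := by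
  have h : ∀ i : Fin n, ∃ C : ℝ, 0 ≤ C ∧ ∀ k : Fin n → ℤ, ‖dk i k‖ ≤ C * (1 + ‖k‖) := by
    intro i
    refine ⟨2 * Real.pi, by positivity, fun k => ?_⟩
    exact norm_dk_le i k
  choose C hC0 hC using h
  refine ⟨‖chi (-1)‖ + ‖pp (-1)‖ * ∑ i, C i, ?_, fun k M => ?_⟩
  · have := Finset.sum_nonneg fun i (_ : i ∈ Finset.univ) => hC0 i
    positivity
  have e1 : ‖M none k‖ ≤ ‖M‖ := E_comp_le M _ _
  have e2 : ‖-∑ i, dk i k • M (some i) k‖ ≤ ((∑ i, C i) * (1 + ‖k‖)) * ‖M‖ := by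
    rw [norm_neg, Finset.sum_mul, Finset.sum_mul]
    refine norm_sum_le_of_le _ fun i _ => ?_
    rw [norm_smul]
    exact mul_le_mul (hC i k) (E_comp_le M _ _) (norm_nonneg _)
      (mul_nonneg (hC0 i) (by positivity))
  calc ‖trk M k‖ ≤ ‖chi (-1)‖ * ‖M none k‖ + ‖pp (-1)‖ * ‖-∑ i, dk i k • M (some i) k‖ :=
        (norm_add_le _ _).trans (add_le_add (norm_inner_le_norm _ _) (norm_inner_le_norm _ _))
    _ ≤ ‖chi (-1)‖ * ‖M‖ + ‖pp (-1)‖ * (((∑ i, C i) * (1 + ‖k‖)) * ‖M‖) := by gcongr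
    _ ≤ (‖chi (-1)‖ * (1 + ‖k‖)) * ‖M‖ + ‖pp (-1)‖ * (((∑ i, C i) * (1 + ‖k‖)) * ‖M‖) := by
        gcongr
        exact le_mul_of_one_le_right (norm_nonneg _) (by linarith [norm_nonneg k])
    _ = _ := by ring

lemma trk_mapJ {δ : ℝ} (hδ : 0 ≤ δ) (s : ℕ) (M : E' n) (k) :
    trk (mapE (Jw δ s) M) k = ((((wt δ k) ^ s)⁻¹ : ℝ) : ℂ) * trk M k := by
  simp only [trk, tr, mapJ_apply hδ]
  rw [mul_add, inner_smul_right, ← inner_smul_right (pp (-1))]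
  congr 2
  rw [smul_neg, Finset.smul_sum]
  congr 1
  exact Finset.sum_congr rfl fun i _ => smul_comm _ _ _

/-- evaluation functional -/
lemma exists_Lam {δ : ℝ} (hδ : 0 < δ) (hδ1 : δ ≤ 1) (x : Fin n → ℝ) :
    ∃ Λ : E' n →L[ℂ] ℂ, ∀ M, Λ M = ev x (trk (mapE (Jw δ (2 * n + 1)) M)) := by
  obtain ⟨C, hC, hb⟩ := trk_bound (n := n)
  set L : (Fin n → ℤ) → E' n →L[ℂ] ℂ := fun k =>
    (ek k x * ((((wt δ k) ^ (2 * n + 1))⁻¹ : ℝ) : ℂ)) • trkL k with hL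
  have hLb : ∀ k, ‖L k‖ ≤ C * (δ ^ (2 * n + 1))⁻¹ * ((1 + ‖k‖) ^ (2 * n))⁻¹ := by
    intro k
    refine ContinuousLinearMap.opNorm_le_bound _ (by positivity) fun M => ?_
    have hw := wt_pos hδ.le k
    rw [hL]
    simp only [smul_apply, smul_eq_mul, norm_mul, norm_ek, one_mul, trkL_apply, Complex.norm_real]
    rw [Real.norm_of_nonneg (by positivity)]
    have h1 : 0 < 1 + ‖k‖ := by positivity
    have h2 : δ * (1 + ‖k‖) ≤ wt δ k := by unfold wt; nlinarith [norm_nonneg k]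
    calc (wt δ k ^ (2 * n + 1))⁻¹ * ‖trk M k‖
        ≤ ((δ * (1 + ‖k‖)) ^ (2 * n + 1))⁻¹ * (C * (1 + ‖k‖) * ‖M‖) := by
          gcongr
          exact hb k M
      _ = _ := by
          rw [mul_pow, pow_succ (1 + ‖k‖)]
          field_simp
  have hs : Summable L := by
    refine Summable.of_norm_bounded ((summable_lattice n).mul_left _) hLb
  refine ⟨∑' k, L k, fun M => ?_⟩
  have := ((ContinuousLinearMap.apply ℂ ℂ M).hasSum hs.hasSum).tsum_eq
  simp only [ContinuousLinearMap.apply_apply] at this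
  rw [← this, ev]
  refine tsum_congr fun k => ?_
  rw [trk_mapJ hδ.le, hL]
  simp only [smul_apply, smul_eq_mul, trkL_apply]
  ring

lemma Tw_affine {t z : (Fin n → ℤ) → ℂ} (ht : Rap t) (hz : Rap z) {δ : ℝ} (hδ : 0 ≤ δ) (hδ1 : δ ≤ 1)
    (s : ℕ) (ε : ℂ) (hr : Rap (fun k => t k + ε * z k)) :
    (Tw δ s (fun k => t k + ε * z k) : HH n LL →L[ℂ] HH n LL) = Tw δ s t + ε • Tw δ s z := by
  ext1 F
  ext1
  ext1 k
  have h1 := Tw_hasSum hr hδ hδ1 s F k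
  have h2 := (Tw_hasSum ht hδ hδ1 s F k).add ((Tw_hasSum hz hδ hδ1 s F k).const_smul ε)
  show Tw δ s (fun k => t k + ε * z k) F k = Tw δ s t F k + ε • Tw δ s z F k
  have e : (fun m => ((t m + ε * z m) * (((wt δ k / wt δ (k - m)) ^ s : ℝ) : ℂ)) • F (k - m)) =
      fun m => (t m * (((wt δ k / wt δ (k - m)) ^ s : ℝ) : ℂ)) • F (k - m) +
        ε • (z m * (((wt δ k / wt δ (k - m)) ^ s : ℝ) : ℂ)) • F (k - m) := by
    funext m
    rw [smul_smul, ← add_smul]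
    congr 1
    ring
  rw [e] at h1
  exact h1.unique h2

lemma Rap.affine {t z : (Fin n → ℤ) → ℂ} (ht : Rap t) (hz : Rap z) (ε : ℂ) :
    Rap (fun k => t k + ε * z k) := by
  refine ht.add ?_
  refine rap_of_le hz ‖ε‖ 0 fun k => ?_
  simp

lemma Cf.affine {t z : Fin n → (Fin n → ℤ) → ℂ} (ht : Cf t) (hz : Cf z) (ε : ℝ) :
    Cf (fun i k => t i k + (ε : ℂ) * z i k) :=
  ⟨fun i => (ht.rap i).affine (hz.rap i) ε, fun i m => by simp [ht.sym, hz.sym]⟩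

/-- derivative of `A0` -/
def dA0 (t z : Fin n → (Fin n → ℤ) → ℂ) : E' n →L[ℂ] E' n :=
  dA (fun i => Tm (t i)) (fun i => Tm (z i))

lemma Aw_hasDerivAt {t z : Fin n → (Fin n → ℤ) → ℂ} (ht : Cf t) (hz : Cf z) {δ : ℝ} (hδ : 0 ≤ δ)
    (hδ1 : δ ≤ 1) (s : ℕ) :
    HasDerivAt (fun ε : ℂ => Aw δ s (fun i k => t i k + ε * z i k))
      (dA (fun i => Tw δ s (t i)) (fun i => Tw δ s (z i))) 0 := by
  have h1 := Aop_hasDerivAt (fun i => (Tw δ s (t i) : HH n LL →L[ℂ] HH n LL)) (fun i => Tw δ s (z i))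
  have e : (fun ε : ℂ => Aw δ s (fun i k => t i k + ε * z i k)) =
      fun ε => Aop (fun i => (Tw δ s (t i) : HH n LL →L[ℂ] HH n LL) + ε • Tw δ s (z i)) := by
    funext ε
    show Aop _ = _
    congr 1
    funext i
    exact Tw_affine (ht.rap i) (hz.rap i) hδ hδ1 s ε ((ht.rap i).affine (hz.rap i) ε)
  rw [e]
  exact h1

lemma mapJ_dA {t z : Fin n → (Fin n → ℤ) → ℂ} (ht : Cf t) (hz : Cf z) {δ : ℝ} (hδ : 0 ≤ δ)
    (hδ1 : δ ≤ 1) (s : ℕ) (F : E' n) :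
    mapE (Jw δ s) (dA (fun i => Tw δ s (t i)) (fun i => Tw δ s (z i)) F) =
      dA0 t z (mapE (Jw δ s) F) :=
  mapE_dA _ _ _ _ _ (fun i x => Jw_Tw (ht.rap i) hδ hδ1 s x)
      (fun i x => Jw_Tw (hz.rap i) hδ hδ1 s x) _

lemma cf_hasDerivAt {t z : Fin n → (Fin n → ℤ) → ℂ} (ht : Cf t) (hz : Cf z)
    {ψ : (Fin n → ℤ) → ℂ} (hψ : Rap ψ) (x : Fin n → ℝ) :
    ∃ G : E' n, G ∈ Vs n ∧
      PV (Vs n) (dA0 t z (Fsol (A0 t) (Ps ψ hψ)) + A0 t G) = 0 ∧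
      HasDerivAt (fun ε : ℝ => (ev x (cf (fun i k => t i k + (ε : ℂ) * z i k) ψ hψ)).re)
        (ev x (trk (dA0 t z (Fsol (A0 t) (Ps ψ hψ)) + A0 t G))).re 0 := by
  obtain ⟨s, hs⟩ : ∃ s, s = 2 * n + 1 := ⟨_, rfl⟩
  obtain ⟨δ, hδ, hδ1, hu⟩ := exists_delta ht s
  obtain ⟨Λ, hΛ⟩ := exists_Lam hδ hδ1 x
  rw [← hs] at hΛ
  obtain ⟨Ψ, hΨ⟩ : ∃ Ψ, Ψ = Ps (wps δ s ψ) (wps_rap hδ.le hδ1 s hψ) := ⟨_, rfl⟩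
  have hA := Aw_hasDerivAt ht hz hδ.le hδ1 s
  have htr := fun ε : ℝ => fun hε => Fsol_transfer (ht.affine hz ε) hδ.le hδ1 (s := s) hε hψ
  have htr0 := Fsol_transfer ht hδ.le hδ1 (s := s) hu hψ
  have hmA := fun ε : ℝ => mapJ_Aw (ht.affine hz ε).rap hδ.le hδ1 s
  have hmA0 := mapJ_Aw ht.rap hδ.le hδ1 s
  have hmd := mapJ_dA ht hz hδ.le hδ1 s
  have hA00 : Aw δ s (fun i k => t i k + (0:ℂ) * z i k) = Aw δ s t := by simp
  simp only [← hΨ] at htr htr0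
  generalize hAdef : (fun ε : ℂ => Aw δ s (fun i k => t i k + ε * z i k)) = A at hA
  have hAe : ∀ ε : ℝ, Aw δ s (fun i k => t i k + (ε : ℂ) * z i k) = A (ε : ℂ) := by
    intro ε; rw [← hAdef]
  have hAe0 : Aw δ s t = A 0 := by rw [← hAdef, ← hA00]
  simp only [hAe] at htr hmA
  rw [hAe0] at hu htr0 hmA0
  generalize (dA (H := HH n LL) (fun i => Tw δ s (t i)) (fun i => Tw δ s (z i))) = A' at hA hmd
  have hev := Bop'_eventually' (Vs n) hA hu
  obtain ⟨F', hF'V, hF'0, hF'⟩ := abs_deriv' (Vs n) hA hu Ψ Λ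
  have hJ : mapE (Jw δ s) (A' (Ψ - Gsol (Vs n) (A 0) Ψ) + A 0 F') =
      dA0 t z (Fsol (A0 t) (Ps ψ hψ)) + A0 t (mapE (Jw δ s) F') := by
    rw [map_add, hmd, hmA0, ← htr0, Fsol]
  have hE : ∀ ε : ℝ, IsUnit (Bop' (Vs n) (A (ε : ℂ))) →
      ev x (cf (fun i k => t i k + (ε : ℂ) * z i k) ψ hψ) =
        Λ (A (ε : ℂ) (Ψ - Gsol (Vs n) (A (ε : ℂ)) Ψ)) := by
    intro ε hε
    have h1 := htr ε hε
    have h2 := hmA ε (Ψ - Gsol (Vs n) (A (ε : ℂ)) Ψ)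
    have h3 : Fsol (A (ε : ℂ)) Ψ = Ψ - Gsol (Vs n) (A (ε : ℂ)) Ψ := rfl
    rw [h3] at h1
    rw [h1] at h2
    rw [cf, ← h2]
    exact (hΛ _).symm
  have hV := mapJ_mem hδ.le s hF'V
  refine ⟨_, hV, ?_, ?_⟩
  · rw [← hJ, ← mapJ_PV hδ.le, hF'0, map_zero]
  · rw [hΛ, hJ] at hF'
    refine hF'.congr_of_eventuallyEq ?_
    exact hev.mono fun ε hε => congrArg Complex.re (hE ε hε)

end ShapeD

namespace ShapeD

variable {n : ℕ}

lemma wd.conv {t : (Fin n → ℤ) → ℂ} (ht : Rap t) {f g : (Fin n → ℤ) → LL} {c : (Fin n → ℤ) → ℂ}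
    (hf : Rap f) (hg : Rap g) (hc : Rap c) (h : ∀ k, wd (f k) (g k) (c k)) (k) :
    wd (conv t f k) (conv t g k) (conv t c k) := by
  refine wd.hasSum (ι := Fin n → ℤ) (fun m => ?_) (conv_summable ht hf k).hasSum
    (conv_summable ht hg k).hasSum (conv_summable ht hc k).hasSum
  exact (h (k - m)).smul (t m)

lemma wd_zero_unique {g : LL} {c : ℂ} (h : wd 0 g c) : g = 0 := by
  have h1 : ∀ z ≤ (0:ℝ), inner ℂ (chi z) g = c := by
    intro z hz
    have h2 := pp_inner_hasDeriv g hz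
    have h3 : HasDerivWithinAt (fun a : ℝ => inner ℂ (pp a) g) (-c) (Set.Iic 0) z := by
      have h4 : HasDerivWithinAt (fun a : ℝ => -(a : ℂ) * c) (-c) (Set.Iic 0) z := by
        have := ((Complex.ofRealCLM.hasDerivAt (x := z)).neg.mul_const c).hasDerivWithinAt (s := Set.Iic 0)
        simpa using this
      refine h4.congr_of_mem (fun a ha => ?_) hz
      have := h a ha
      simpa using this
    have h5 := (uniqueDiffOn_Iic (0:ℝ) z hz).eq_deriv _ h2 h3
    simpa using h5
  have h0 : c = 0 := by
    rw [← h1 0 le_rfl, chi_zero, inner_zero_left]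
  exact eq_zero_of_chi fun a ha => by rw [h1 a ha, h0]

lemma wd.unique {f g g' : LL} {c c' : ℂ} (h : wd f g c) (h' : wd f g' c') : g = g' := by
  have := h.sub h'
  rw [sub_self] at this
  exact sub_eq_zero.1 (wd_zero_unique this)

lemma dA0_some {t z : Fin n → (Fin n → ℤ) → ℂ} (hz : ∀ i, Rap (z i)) (F : E' n) (i k) :
    dA0 t z F (some i) k = - conv (z i) (fun k => F none k) k := by
  rw [dA0, dA_some]
  show - (Tm (z i) (F none) k) = _
  rw [Tm_apply (hz i)]

lemma dA0_none {t z : Fin n → (Fin n → ℤ) → ℂ} (ht : ∀ i, Rap (t i)) (hz : ∀ i, Rap (z i))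
    (F : E' n) (k) :
    dA0 t z F none k =
      - ∑ i, conv (z i) (fun k => F (some i) k - conv (t i) (fun k => F none k) k) k
      + ∑ i, conv (t i) (fun k => conv (z i) (fun k => F none k) k) k := by
  rw [dA0, dA_none]
  show - ((∑ i, Tm (z i) (F (some i) - Tm (t i) (F none)) : HH n LL) k)
    + (∑ i, Tm (t i) (Tm (z i) (F none)) : HH n LL) k = _
  rw [HH_sum_apply, HH_sum_apply]
  have e1 : ∀ i : Fin n, Tm (z i) (F (some i) - Tm (t i) (F none)) k
      = conv (z i) (fun k => F (some i) k - conv (t i) (fun k => F none k) k) k := by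
    intro i
    rw [Tm_apply (hz i)]
    congr 1
    ext1 k
    show F (some i) k - Tm (t i) (F none) k = _
    rw [Tm_apply (ht i)]
  have e2 : ∀ i : Fin n, Tm (t i) (Tm (z i) (F none)) k
      = conv (t i) (fun k => conv (z i) (fun k => F none k) k) k := by
    intro i
    rw [Tm_apply (ht i)]
    congr 1
    ext1 k
    rw [Tm_apply (hz i)]
  simp only [e1, e2]

section ident
variable {t : Fin n → (Fin n → ℤ) → ℂ} {ψ ζ β : (Fin n → ℤ) → ℂ} {F : Fin n → (Fin n → ℤ) → LL}
  {b b1 : (Fin n → ℤ) → LL}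

/-- flux -/
def mF (t : Fin n → (Fin n → ℤ) → ℂ) (F : Fin n → (Fin n → ℤ) → LL) (b : (Fin n → ℤ) → LL)
    (i : Fin n) (k : Fin n → ℤ) : LL := F i k - conv (t i) b k

/-- derivative of the flux -/
def m1F (t : Fin n → (Fin n → ℤ) → ℂ) (b b1 : (Fin n → ℤ) → LL)
    (i : Fin n) (k : Fin n → ℤ) : LL := dk i k • b k - conv (t i) b1 k

/-- trace of the flux -/
def muF (t : Fin n → (Fin n → ℤ) → ℂ) (ψ β : (Fin n → ℤ) → ℂ)
    (i : Fin n) (k : Fin n → ℤ) : ℂ := dk i k * ψ k - conv (t i) β k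

lemma mF_rap (ht : ∀ i, Rap (t i)) (hF : ∀ i, Rap (F i)) (hb : Rap b) (i) : Rap (mF t F b i) :=
  (hF i).sub ((ht i).conv hb)

lemma m1F_rap (ht : ∀ i, Rap (t i)) (hb : Rap b) (hb1 : Rap b1) (i) : Rap (m1F t b b1 i) :=
  (hb.dk_smul i).sub ((ht i).conv hb1)

lemma muF_rap (ht : ∀ i, Rap (t i)) (hψ : Rap ψ) (hβ : Rap β) (i) : Rap (muF t ψ β i) :=
  (hψ.dk_smul i).sub ((ht i).conv hβ)

lemma mF_wd (ht : ∀ i, Rap (t i)) (hb : Rap b) (hb1 : Rap b1) (hβ : Rap β)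
    (hwF : ∀ i k, wd (F i k) (dk i k • b k) (dk i k * ψ k)) (hwb : ∀ k, wd (b k) (b1 k) (β k)) (i k) :
    wd (mF t F b i k) (m1F t b b1 i k) (muF t ψ β i k) :=
  (hwF i k).sub (wd.conv (ht i) hb hb1 hβ hwb k)

lemma flux_pde (ht : ∀ i, Rap (t i)) (hF : ∀ i, Rap (F i)) (hb : Rap b) (hb1 : Rap b1) (hψ : Rap ψ)
    (hβ : Rap β) {c : (Fin n → ℤ) → ℂ}
    (hwF : ∀ i k, wd (F i k) (dk i k • b k) (dk i k * ψ k)) (hwb : ∀ k, wd (b k) (b1 k) (β k))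
    (hq : ∀ k, wd (b k - ∑ i, conv (t i) (mF t F b i) k) (-∑ i, dk i k • mF t F b i k) (c k)) (k) :
    b1 k - ∑ i, conv (t i) (m1F t b b1 i) k = -∑ i, dk i k • mF t F b i k := by
  have h1 : wd (b k - ∑ i, conv (t i) (mF t F b i) k) (b1 k - ∑ i, conv (t i) (m1F t b b1 i) k)
      (β k - ∑ i, conv (t i) (muF t ψ β i) k) := by
    refine (hwb k).sub (wd.sum _ fun i _ => ?_)
    exact wd.conv (ht i) (mF_rap ht hF hb i) (m1F_rap ht hb hb1 i) (muF_rap ht hψ hβ i)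
      (mF_wd ht hb hb1 hβ hwF hwb i) k
  exact h1.unique (hq k)

lemma ident_some (ht : ∀ i, Rap (t i)) (hζ : Rap ζ) (hb : Rap b) (hb1 : Rap b1) (i k) :
    - conv (fun m => dk i m * ζ m) b k + (dk i k • conv ζ b k - conv (t i) (conv ζ b1) k)
      = conv ζ (m1F t b b1 i) k := by
  have h1 := conv_leibniz hζ hb i k
  have h2 := conv_swap (ht i) hζ hb1 k
  have h3 : conv ζ (m1F t b b1 i) k = conv ζ (fun m => dk i m • b m) k - conv ζ (conv (t i) b1) k :=
    conv_sub hζ (hb.dk_smul i) ((ht i).conv hb1) k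
  rw [h1, h2, h3]
  abel

lemma ident_none (ht : ∀ i, Rap (t i)) (hζ : Rap ζ) (hF : ∀ i, Rap (F i)) (hb : Rap b) (hb1 : Rap b1)
    (hp : ∀ k, b1 k - ∑ i, conv (t i) (m1F t b b1 i) k = -∑ i, dk i k • mF t F b i k) (k) :
    (- ∑ i, conv (fun m => dk i m * ζ m) (mF t F b i) k
      + ∑ i, conv (t i) (fun k => conv (fun m => dk i m * ζ m) b k) k)
    + (conv ζ b1 k - ∑ i, conv (t i) (fun k => dk i k • conv ζ b k - conv (t i) (conv ζ b1) k) k)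
      = -∑ i, dk i k • conv ζ (mF t F b i) k := by
  have hm := mF_rap ht hF hb
  have hm1 := m1F_rap ht hb hb1
  have h1 : ∀ i, conv (t i) (fun k => dk i k • conv ζ b k - conv (t i) (conv ζ b1) k) k =
      conv ζ (conv (t i) (m1F t b b1 i)) k + conv (t i) (fun k => conv (fun m => dk i m * ζ m) b k) k := by
    intro i
    have hz : Rap (fun m => dk i m * ζ m) := hζ.dk_smul i
    have e := conv_add (ht i) (hζ.conv (hm1 i)) (hz.conv hb) k
    rw [conv_swap hζ (ht i) (hm1 i)]
    refine Eq.trans ?_ e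
    congr 1
    ext1 k
    rw [← ident_some ht hζ hb hb1]
    abel
  have h2 : conv ζ b1 k - ∑ i, conv ζ (conv (t i) (m1F t b b1 i)) k
      = - ∑ i, conv ζ (fun k => dk i k • mF t F b i k) k := by
    rw [← conv_sum _ hζ (fun i => (ht i).conv (hm1 i)),
      ← conv_sum _ hζ (fun i => (hm i).dk_smul i), ← conv_neg,
      ← conv_sub hζ hb1 (Rap.sum _ (fun i _ => (ht i).conv (hm1 i)))]
    congr 1
    ext1 k
    exact hp k
  simp only [h1, conv_leibniz hζ (hm _), Finset.sum_add_distrib]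
  rw [neg_add, ← h2]
  abel

/-- candidate derivative -/
def candF (ζ : (Fin n → ℤ) → ℂ) (b b1 : (Fin n → ℤ) → LL) : Option (Fin n) → (Fin n → ℤ) → LL
  | none => conv ζ b1
  | some i => fun k => dk i k • conv ζ b k

lemma candF_rap (hζ : Rap ζ) (hb : Rap b) (hb1 : Rap b1) (j) : Rap (candF ζ b b1 j) := by
  cases j with
  | none => exact hζ.conv hb1
  | some i => exact (hζ.conv hb).dk_smul i

lemma abs_unique {H : Type*} [NormedAddCommGroup H] [InnerProductSpace ℂ H] [CompleteSpace H]
    (V : Submodule ℂ (EE n H)) [V.HasOrthogonalProjection] {A : EE n H →L[ℂ] EE n H}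
    (hu : IsUnit (Bop' V A)) {D : EE n H} (hD : D ∈ V) (h : PV V (A D) = 0) : D = 0 := by
  have hp : PV V D = D := Submodule.starProjection_eq_self_iff.2 hD
  refine Bop'_inj V hu ?_
  rw [Bop'_apply, hp, h, map_zero, sub_self, add_zero]

lemma abs_ident {H : Type*} [NormedAddCommGroup H] [InnerProductSpace ℂ H] [CompleteSpace H]
    (V : Submodule ℂ (EE n H)) [V.HasOrthogonalProjection] {A : EE n H →L[ℂ] EE n H}
    (hu : IsUnit (Bop' V A)) {G B F' R : EE n H} (hG : G ∈ V) (hB : B - F' ∈ V)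
    (h1 : PV V (R + A G) = 0) (h2 : PV V (R + A B) = 0) (h3 : PV V (A F') = 0) :
    R + A G = (R + A B) - A F' := by
  have : G - (B - F') = 0 := by
    refine abs_unique V hu (V.sub_mem hG hB) ?_
    have e : A (G - (B - F')) = (R + A G) - (R + A B) + A F' := by
      rw [map_sub, map_sub]; abel
    rw [e, map_add, map_sub, h1, h2, h3]; simp
  rw [sub_eq_zero.1 this, map_sub]; abel

lemma identification (ht : Cf t) (hψ : Rap ψ) (hζ : Rap ζ) (hβ : Rap β) (hb1 : Rap b1)
    (hwb : ∀ k, wd (Fsol (A0 t) (Ps ψ hψ) none k) (b1 k) (β k)) {G : E' n} (hG : G ∈ Vs n)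
    (hPV : PV (Vs n) (dA0 t (fun i m => dk i m * ζ m) (Fsol (A0 t) (Ps ψ hψ)) + A0 t G) = 0) (k) :
    trk (dA0 t (fun i m => dk i m * ζ m) (Fsol (A0 t) (Ps ψ hψ)) + A0 t G) k =
      -∑ i, dk i k * conv ζ (muF t ψ β i) k - cf t (conv ζ β) (hζ.conv hβ) k := by
  have hS := exists_Sol ht hψ
  have hS' := exists_Sol ht (hζ.conv hβ)
  have hO' := Fsol_orth (A0_unit ht) (Ps _ (hζ.conv hβ))
  unfold cf
  generalize Fsol (A0 t) (Ps ψ hψ) = F at *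
  generalize Fsol (A0 t) (Ps _ (hζ.conv hβ)) = F' at *
  have hz : ∀ i : Fin n, Rap (fun m => dk i m * ζ m) := fun i => hζ.dk_smul i
  obtain ⟨B, hB⟩ : ∃ B, B = mkE (candF ζ (fun k => F none k) b1) (candF_rap hζ hS.rapb hb1) := ⟨_, rfl⟩
  have hBs : ∀ i k, B (some i) k = dk i k • conv ζ (fun k => F none k) k := by
    intro i k; rw [hB, mkE_apply]; rfl
  have hBn : ∀ k, B none k = conv ζ b1 k := by
    intro k; rw [hB, mkE_apply]; rfl
  obtain ⟨M, hM⟩ : ∃ M, M = dA0 t (fun i m => dk i m * ζ m) F + A0 t B := ⟨_, rfl⟩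
  have hMs : ∀ i k, M (some i) k = conv ζ (m1F t (fun k => F none k) b1 i) k := by
    intro i k
    rw [← ident_some ht.rap hζ hS.rapb hb1, hM]
    show dA0 t (fun i m => dk i m * ζ m) F (some i) k + A0 t B (some i) k = _
    rw [dA0_some hz, A0_some ht.rap, hBs]
    simp only [hBn]
  have hpde := flux_pde ht.rap hS.rapF hS.rapb hb1 hψ hβ hS.wdF hwb hS.wdq
  have hMn : ∀ k, M none k
      = -∑ i, dk i k • conv ζ (mF t (fun i k => F (some i) k) (fun k => F none k) i) k := by
    intro k
    rw [← ident_none ht.rap hζ hS.rapF hS.rapb hb1 hpde, hM]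
    show dA0 t (fun i m => dk i m * ζ m) F none k + A0 t B none k = _
    rw [dA0_none ht.rap hz, A0_none ht.rap, hBn]
    simp only [hBn, hBs]
    rfl
  have hw : ∀ i k, wd (conv ζ (mF t (fun i k => F (some i) k) (fun k => F none k) i) k) (M (some i) k)
      (conv ζ (muF t ψ β i) k) := by
    intro i k
    rw [hMs]
    exact wd.conv hζ (mF_rap ht.rap hS.rapF hS.rapb i) (m1F_rap ht.rap hS.rapb hb1 i)
      (muF_rap ht.rap hψ hβ i) (mF_wd ht.rap hS.rapb hb1 hβ hS.wdF hwb i) k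
  have hMo : PV (Vs n) M = 0 := orth_of_wd hw hMn
  have hMt : trk M k = -∑ i, dk i k * conv ζ (muF t ψ β i) k := by
    rw [trk, hMn]
    exact ((wd.sum _ fun i _ => (hw i k).smul (dk i k)).neg).tr
  have hBF : B - F' ∈ Vs n := by
    rw [mem_Vs]
    intro i k
    have h1 := ((wd.conv hζ hS.rapb hb1 hβ hwb k).smul (dk i k)).sub (hS'.wdF i k)
    rw [sub_self, ← smul_sub, ← hBs, ← hBn] at h1
    exact h1
  rw [hM] at hMo
  rw [abs_ident (Vs n) (A0_unit ht) hG hBF hPV hMo hO', trk_sub, ← hM, hMt]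

end ident

end ShapeD

namespace ShapeD

variable {n : ℕ}

lemma Modes.rapU1 {t : Fin n → (Fin n → ℤ) → ℂ} {ψ c : (Fin n → ℤ) → ℂ} {F : Fin n → (Fin n → ℤ) → LL}
    {b b1 : (Fin n → ℤ) → LL} {U : ℕ → (Fin n → ℤ) → ℝ → ℂ} (M : Modes t ψ c F b b1 U) :
    Rap (fun k => U 1 k 0) := by
  have := M.nice.rap 1 0
  simpa only [WW_eq U _ _ le_rfl] using this

lemma Modes.rapc {t : Fin n → (Fin n → ℤ) → ℂ} {ψ c : (Fin n → ℤ) → ℂ} {F : Fin n → (Fin n → ℤ) → LL}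
    {b b1 : (Fin n → ℤ) → LL} {U : ℕ → (Fin n → ℤ) → ℝ → ℂ} (M : Modes t ψ c F b b1 U)
    (ht : ∀ i, Rap (t i)) (hψ : Rap ψ) : Rap c := by
  have h1 : c = fun k => U 1 k 0
      - ∑ i, conv (t i) (muF t ψ (fun k => U 1 k 0) i) k := by
    ext k; exact (M.neu k).symm
  rw [h1]
  exact M.rapU1.sub (Rap.sum _ fun i _ => (ht i).conv (muF_rap ht hψ M.rapU1 i))

lemma cf_rap {h : (Fin n → ℝ) → ℝ} (hh : ContDiff ℝ (⊤ : ℕ∞) h) (hp : Per h)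
    {ψ : (Fin n → ℤ) → ℂ} (hψ : Rap ψ) : Rap (cf (tf h) ψ hψ) := by
  obtain ⟨b1, U, M⟩ := exists_modes_tf hh hp hψ
  exact M.rapc (tf_rap hh hp) hψ

/-- constant profiles -/
def cstW (F : (Fin n → ℤ) → ℂ) : ℕ → (Fin n → ℤ) → ℝ → ℂ
  | 0 => fun k _ => F k
  | _ + 1 => fun _ _ => 0

lemma cstW_nice {F : (Fin n → ℤ) → ℂ} (hF : Rap F) : Nice (cstW F) := by
  refine ⟨fun j k z => ?_, fun j N R => ?_⟩
  · cases j with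
    | zero => exact hasDerivAt_const z (F k)
    | succ j => exact hasDerivAt_const z (0:ℂ)
  · cases j with
    | zero =>
      obtain ⟨C, hC⟩ := hF N
      exact ⟨C, fun k z _ => hC k⟩
    | succ j => exact ⟨0, fun k z _ => by simp [cstW]⟩

lemma pdX_ev {F : (Fin n → ℤ) → ℂ} (hF : Rap F) (i : Fin n) (x : Fin n → ℝ) :
    pdX n (fun x => (ev x F).re) i x = (ev x (fun k => dk i k * F k)).re := by
  have h1 := SN_hasFDerivAt (cstW_nice hF) (x, 0)
  have h2 : HasFDerivAt (fun y : Fin n → ℝ => (y, (0:ℝ)))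
      (ContinuousLinearMap.inl ℝ (Fin n → ℝ) ℝ) x := hasFDerivAt_prodMk_left x 0
  have h3 := Complex.reCLM.hasFDerivAt.comp x (h1.comp x h2)
  have h4 : HasFDerivAt (fun x => (ev x F).re) (Complex.reCLM.comp
    ((SL (cstW F) (x,0)).comp (ContinuousLinearMap.inl ℝ (Fin n → ℝ) ℝ))) x := h3
  rw [pdX, h4.fderiv]
  show (SL (cstW F) (x,0) (Pi.single i 1, 0)).re = _
  rw [SL_apply]
  have h5 : ∑ j, ((Pi.single (M := fun _ => ℝ) i 1 j : ℝ) : ℂ) * SN (dN j (cstW F)) (x, 0)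
      = SN (dN i (cstW F)) (x, 0) := by
    rw [Finset.sum_eq_single i]
    · simp
    · intro j _ hj; simp [hj]
    · simp
  simp only [h5, Complex.ofReal_zero, zero_mul, add_zero]
  rfl

lemma tf_eq {ζ : (Fin n → ℝ) → ℝ} (hζ : ContDiff ℝ (⊤ : ℕ∞) ζ) (hp : Per ζ) (i : Fin n) :
    tf ζ i = fun m => dk i m * fc (cx ζ) m := by
  ext m
  rw [tf, ← pd_cx hζ, fc_pd (cx_per hp) (cx_smooth hζ)]

lemma ev_dk_fc {ψ : (Fin n → ℝ) → ℝ} (hψ : ContDiff ℝ (⊤ : ℕ∞) ψ) (hp : Per ψ) (i : Fin n) (x) :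
    ev x (fun k => dk i k * fc (cx ψ) k) = (pdX n ψ i x : ℝ) := by
  rw [← tf_eq hψ hp, ev_tf hψ hp]

lemma tf_affine {h ζ : (Fin n → ℝ) → ℝ} (hh : ContDiff ℝ (⊤ : ℕ∞) h) (hhp : Per h)
    (hζ : ContDiff ℝ (⊤ : ℕ∞) ζ) (hζp : Per ζ) (ε : ℝ) :
    tf (fun z => h z + ε * ζ z) = fun i k => tf h i k + (ε : ℂ) * tf ζ i k := by
  have hs : ContDiff ℝ (⊤ : ℕ∞) (fun z => h z + ε * ζ z) := hh.add (contDiff_const.mul hζ)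
  have hp : Per (fun z => h z + ε * ζ z) := fun x k => by simp only [hhp x k, hζp x k]
  funext i
  refine ev_inj (tf_rap hs hp i) ((tf_rap hh hhp i).affine (tf_rap hζ hζp i) ε) fun x => ?_
  have hr : Rap (fun k => (ε : ℂ) * tf ζ i k) :=
    rap_of_le (tf_rap hζ hζp i) |ε| 0 fun k => by simp
  rw [ev_tf hs hp, ev_add (tf_rap hh hhp i) hr, ev_tf hh hhp]
  have e1 : ev x (fun k => (ε : ℂ) * tf ζ i k) = (ε : ℂ) * ev x (tf ζ i) := by
    rw [ev, ev, ← tsum_mul_left]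
    exact tsum_congr fun k => by simp only [smul_eq_mul]; ring
  rw [e1, ev_tf hζ hζp]
  have e2 : pdX n (fun z => h z + ε * ζ z) i x = pdX n h i x + ε * pdX n ζ i x := by
    have h1 : HasFDerivAt (fun z => h z + ε * ζ z) (fderiv ℝ h x + ε • fderiv ℝ ζ x) x :=
      (hh.differentiable (by simp) x).hasFDerivAt.add
        ((hζ.differentiable (by simp) x).hasFDerivAt.const_mul ε)
    rw [pdX, h1.fderiv]
    rfl
  rw [e2]; push_cast; rfl

theorem main (h ψ ζ : (Fin n → ℝ) → ℝ)
    (hh : ContDiff ℝ (⊤ : ℕ∞) h) (hhper : Per h)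
    (hψ : ContDiff ℝ (⊤ : ℕ∞) ψ) (hψper : Per ψ)
    (hζ : ContDiff ℝ (⊤ : ℕ∞) ζ) (hζper : Per ζ) (x : Fin n → ℝ) :
    HasDerivAt (fun ε : ℝ => DtN n (fun z => h z + ε * ζ z) ψ x)
      ( - DtN n h (fun z => frakB n h ψ z * ζ z) x
        - divX n (fun z i => frakV n h ψ z i * ζ z) x ) 0 := by
  have hψr : Rap (fc (cx ψ)) := fc_rap (cx_per hψper) (cx_smooth hψ)
  have hζr : Rap (fc (cx ζ)) := fc_rap (cx_per hζper) (cx_smooth hζ)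
  have hevζ : ∀ x, ev x (fc (cx ζ)) = (ζ x : ℂ) := ev_fc (cx_per hζper) (cx_smooth hζ)
  have ht := tf_rap hh hhper
  have e0 : (fun ε : ℝ => DtN n (fun z => h z + ε * ζ z) ψ x) =
      fun ε : ℝ => (ev x (cf (fun i k => tf h i k + (ε : ℂ) * tf ζ i k) (fc (cx ψ)) hψr)).re := by
    funext ε
    have hs : ContDiff ℝ (⊤ : ℕ∞) (fun z => h z + ε * ζ z) := hh.add (contDiff_const.mul hζ)
    have hp : Per (fun z => h z + ε * ζ z) := fun x k => by simp only [hhper x k, hζper x k]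
    rw [DtN_eq' hs hp hψ hψper, tf_affine hh hhper hζ hζper]
  rw [e0]
  obtain ⟨b1, U, M⟩ := exists_modes_tf hh hhper hψr
  obtain ⟨G, hG, hPV, hd⟩ := cf_hasDerivAt (tf_cf hh hhper) (tf_cf hζ hζper) hψr x
  refine hd.congr_deriv ?_
  have hzt : tf ζ = fun i m => dk i m * fc (cx ζ) m := funext fun i => tf_eq hζ hζper i
  rw [hzt] at hPV ⊢
  have hβ := M.rapU1
  have hneu := M.neu_ev hh hhper hψr
  have hid := identification (tf_cf hh hhper) hψr hζr hβ M.rapb1 M.wdb hG hPV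
  obtain ⟨β, hβe⟩ : ∃ β, β = fun k => U 1 k 0 := ⟨_, rfl⟩
  simp only [← hβe] at hβ hid hneu
  rw [funext hid]
  have hmu := muF_rap ht hψr hβ
  have hB : ∀ y, (ev y β).re = frakB n h ψ y := by
    intro y
    have h1 := congrArg Complex.re (hneu y)
    rw [← DtN_eq' hh hhper hψ hψper] at h1
    simp only [ev_dk_fc hψ hψper, Complex.sub_re, Complex.re_sum, Complex.re_ofReal_mul,
      Complex.ofReal_re, mul_sub, Finset.sum_sub_distrib] at h1
    have hpos : (0:ℝ) < 1 + ∑ i, (pdX n h i y)^2 := by positivity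
    rw [frakB, eq_div_iff hpos.ne', ← h1, mul_add, Finset.mul_sum]
    have : ∑ i, (ev y β).re * pdX n h i y ^ 2 = ∑ i, pdX n h i y * (pdX n h i y * (ev y β).re) :=
      Finset.sum_congr rfl fun i _ => by ring
    rw [this]; ring
  have hBζ : (fun z => frakB n h ψ z * ζ z) = fun z => (ev z (conv (fc (cx ζ)) β)).re := by
    funext z
    rw [ev_conv hζr hβ, hevζ, smul_eq_mul, Complex.re_ofReal_mul, hB, mul_comm]
  have hV : ∀ i, (fun z => frakV n h ψ z i * ζ z) =
      fun z => (ev z (conv (fc (cx ζ)) (muF (tf h) (fc (cx ψ)) β i))).re := by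
    intro i
    funext z
    have e : ev z (muF (tf h) (fc (cx ψ)) β i)
        = ev z (fun k => dk i k * fc (cx ψ) k) - ev z (conv (tf h i) β) :=
      ev_sub (hψr.dk_smul i) ((ht i).conv hβ) z
    rw [ev_conv hζr (hmu i), hevζ, smul_eq_mul, Complex.re_ofReal_mul, e, ev_dk_fc hψ hψper,
      ev_conv (ht i) hβ, ev_tf hh hhper, smul_eq_mul, Complex.sub_re, Complex.re_ofReal_mul,
      Complex.ofReal_re, hB, frakV]
    ring
  have hr1 : ∀ i, Rap (fun k => dk i k * conv (fc (cx ζ)) (muF (tf h) (fc (cx ψ)) β i) k) :=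
    fun i => (hζr.conv (hmu i)).dk_smul i
  rw [ev_sub ((Rap.sum _ fun i _ => hr1 i).neg) (cf_rap hh hhper _), ev_neg, ev_sum _ hr1, hBζ,
    DtN_eq hh hhper (hζr.conv hβ), Complex.sub_re, Complex.neg_re, Complex.re_sum, divX]
  simp only [hV, pdX_ev (hζr.conv (hmu _))]
  ring

end ShapeD

/-- shape derivative formula for the Dirichlet-to-Neumann operator:
ε ↦ G(h+εζ)ψ is differentiable at ε = 0 with derivative −G(h)(𝔅ζ) − div(𝔙ζ). -/
theorem DtN_shape_derivative (n : ℕ) (hn : 1 ≤ n) (h ψ ζ : (Fin n → ℝ) → ℝ)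
    (hh : ContDiff ℝ (⊤ : ℕ∞) h) (hhper : ZPeriodic n h)
    (hψ : ContDiff ℝ (⊤ : ℕ∞) ψ) (hψper : ZPeriodic n ψ)
    (hζ : ContDiff ℝ (⊤ : ℕ∞) ζ) (hζper : ZPeriodic n ζ) :
    ∀ x, HasDerivAt (fun ε : ℝ => DtN n (fun z => h z + ε * ζ z) ψ x)
      ( - DtN n h (fun z => frakB n h ψ z * ζ z) x
        - divX n (fun z i => frakV n h ψ z i * ζ z) x ) 0 := by
  exact fun x => ShapeD.main h ψ ζ hh hhper hψ hψper hζ hζper x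

end
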